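/- Let C be an isotropic convex body in ℝⁿ which is a ψ₂-body with constant ϱ, and let K be a centrally symmetric convex body in ℝⁿ. There is an absolute constant c > 0 such that for every s ≥ 1 and every t ∈ ℝˢ, ∫_C⋯∫_C ‖∑_{j=1}^s t_j x_j‖_K dx₁⋯dx_s ≤ c ϱ² √n M(K) ‖t‖₂. -/

import Mathlib

open MeasureTheory Real
open scoped ENNReal RealInnerProductSpace

noncomputable section

/-- A convex body: compact, convex, with non-empty interior. -/
def IsConvexBody {n : ℕ} (C : Set (EuclideanSpace ℝ (Fin n))) : Prop :=
  Convex ℝ C ∧ IsCompact C ∧ (interior C).Nonempty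

/-- A centrally symmetric convex body. -/
def IsSymmConvexBody {n : ℕ} (C : Set (EuclideanSpace ℝ (Fin n))) : Prop :=
  Convex ℝ C ∧ IsCompact C ∧ (interior C).Nonempty ∧ C = -C

/-- `C` is isotropic with isotropic constant `L`. -/
def IsIsotropic {n : ℕ} (C : Set (EuclideanSpace ℝ (Fin n))) (L : ℝ) : Prop :=
  volume C = 1 ∧ (∫ x in C, x) = 0 ∧ 0 < L ∧
    ∀ ξ : EuclideanSpace ℝ (Fin n), ‖ξ‖ = 1 → (∫ x in C, ⟪x, ξ⟫ ^ 2) = L ^ 2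

/-- `C` (of volume 1) is a `ψ₂`-body with constant `ϱ`: for every unit vector `ξ`, the
Orlicz `ψ₂`-norm of `⟨·,ξ⟩` on `C` is at most `ϱ` times its `L₂(C)`-norm. -/
def IsPsiTwoBody {n : ℕ} (C : Set (EuclideanSpace ℝ (Fin n))) (ϱ : ℝ) : Prop :=
  ∀ ξ : EuclideanSpace ℝ (Fin n), ‖ξ‖ = 1 →
    sInf {r : ℝ | 0 < r ∧ (∫ x in C, Real.exp ((|⟪x, ξ⟫| / r) ^ 2)) ≤ 2}
      ≤ ϱ * Real.sqrt (∫ x in C, ⟪x, ξ⟫ ^ 2)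

/-- `M(K) = ∫_{S^{n-1}} ‖ξ‖_K dσ(ξ)`. -/
def sphereM {n : ℕ} (K : Set (EuclideanSpace ℝ (Fin n))) : ℝ :=
  ⨍ ξ, gauge K (ξ : EuclideanSpace ℝ (Fin n))
    ∂((volume : Measure (EuclideanSpace ℝ (Fin n))).toSphere)

/-- The Euclidean norm of `t ∈ ℝˢ`. -/
def euclNorm {s : ℕ} (t : Fin s → ℝ) : ℝ := Real.sqrt (∑ j, t j ^ 2)

section Auxiliary

open ProbabilityTheory

lemma measure_add_le_of_isCompact {K K' S : Set ℝ} (hK : IsCompact K) (hK' : IsCompact K')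
    (hn : K.Nonempty) (hn' : K'.Nonempty) {a b : ℝ} (ha : 0 < a) (hb : 0 < b)
    (hS : ∀ x ∈ K, ∀ y ∈ K', a * x + b * y ∈ S) :
    ENNReal.ofReal a * volume K + ENNReal.ofReal b * volume K' ≤ volume S := by
  obtain ⟨k, hk, hkmax⟩ := hK.exists_isMaxOn hn continuousOn_id
  obtain ⟨l, hl, hlmin⟩ := hK'.exists_isMinOn hn' continuousOn_id
  have e1 : volume ((fun x => a * x + b * l) '' K) = ENNReal.ofReal a * volume K := by
    have : (fun x => a * x + b * l) '' K = (fun x => x + b * l) '' ((fun x => a • x) '' K) := by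
      rw [Set.image_image]; rfl
    rw [this, Set.image_add_right, measure_preimage_add_right]
    rw [Set.image_smul, Measure.addHaar_smul]
    simp [abs_of_pos ha]
  have e2 : volume ((fun x => b * x + a * k) '' K') = ENNReal.ofReal b * volume K' := by
    have : (fun x => b * x + a * k) '' K' = (fun x => x + a * k) '' ((fun x => b • x) '' K') := by
      rw [Set.image_image]; rfl
    rw [this, Set.image_add_right, measure_preimage_add_right]
    rw [Set.image_smul, Measure.addHaar_smul]
    simp [abs_of_pos hb]
  rw [← e1, ← e2, ← measure_union₀]
  · apply measure_mono
    rintro _ (⟨x, hx, rfl⟩ | ⟨y, hy, rfl⟩)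
    · exact hS x hx l hl
    · have := hS k hk y hy
      rwa [add_comm] at this
  · exact (hK'.image (by fun_prop)).measurableSet.nullMeasurableSet
  · refine measure_mono_null ?_ (measure_singleton (a * k + b * l) (μ := volume))
    rintro _ ⟨⟨x, hx, rfl⟩, ⟨y, hy, hxy⟩⟩
    have h1 : x ≤ k := hkmax hx
    have h2 : l ≤ y := hlmin hy
    simp only [Set.mem_singleton_iff] at hxy ⊢
    nlinarith

lemma measure_add_le_of_measurableSet {A B S : Set ℝ} (hA : MeasurableSet A) (hB : MeasurableSet B)
    (hn : A.Nonempty) (hn' : B.Nonempty) {a b : ℝ} (ha : 0 < a) (hb : 0 < b)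
    (hS : ∀ x ∈ A, ∀ y ∈ B, a * x + b * y ∈ S) :
    ENNReal.ofReal a * volume A + ENNReal.ofReal b * volume B ≤ volume S := by
  obtain ⟨x0, hx0⟩ := hn
  obtain ⟨y0, hy0⟩ := hn'
  rw [hA.measure_eq_iSup_isCompact, hB.measure_eq_iSup_isCompact]
  simp only [ENNReal.mul_iSup, iSup_and']
  have : ∀ K K' : Set ℝ, (K ⊆ A ∧ IsCompact K) → (K' ⊆ B ∧ IsCompact K') →
      ENNReal.ofReal a * volume K + ENNReal.ofReal b * volume K' ≤ volume S := by
    intro K K' hK hK'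
    refine le_trans ?_ (measure_add_le_of_isCompact (hK.2.insert x0) (hK'.2.insert y0)
      ⟨x0, by simp⟩ ⟨y0, by simp⟩ ha hb (S := S) ?_)
    · gcongr <;> simp
    · rintro x hx y hy
      apply hS
      · rcases hx with rfl | hx
        exacts [hx0, hK.1 hx]
      · rcases hy with rfl | hy
        exacts [hy0, hK'.1 hy]
  refine ENNReal.biSup_add_biSup_le' (p := fun K => K ⊆ A ∧ IsCompact K)
    (q := fun K => K ⊆ B ∧ IsCompact K) ⟨∅, by simp⟩ ⟨∅, by simp⟩ ?_
  intro K hK K' hK'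
  exact this K K' hK hK'

/-- The Prékopa–Leindler inequality holds for the measure `μ`. -/
def PrekopaLeindler {E : Type*} [AddCommGroup E] [Module ℝ E] [MeasurableSpace E]
    (μ : Measure E) : Prop :=
  ∀ (a b : ℝ), 0 < a → 0 < b → a + b = 1 → ∀ f g h : E → ℝ≥0∞, Measurable f → Measurable g →
    Measurable h → (∀ x y, f x ^ a * g y ^ b ≤ h (a • x + b • y)) →
    (∫⁻ x, f x ∂μ) ^ a * (∫⁻ x, g x ∂μ) ^ b ≤ ∫⁻ x, h x ∂μ

lemma lintegral_eq_mul_lintegral_level {f : ℝ → ℝ} (hf : Measurable f) (hf0 : ∀ x, 0 ≤ f x)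
    {M : ℝ} (hM : 0 < M) (hfM : ∀ x, f x ≤ M) :
    ∫⁻ x, ENNReal.ofReal (f x) =
      ENNReal.ofReal M * ∫⁻ t in Set.Ioo (0:ℝ) 1, volume {x | M * t < f x} := by
  have h1 : ∀ x, ENNReal.ofReal (f x) = ENNReal.ofReal M * ENNReal.ofReal (f x / M) := by
    intro x
    rw [← ENNReal.ofReal_mul hM.le, mul_div_cancel₀ _ hM.ne']
  simp_rw [h1]
  rw [lintegral_const_mul _ (by fun_prop)]
  congr 1
  rw [lintegral_eq_lintegral_meas_lt _ (Filter.Eventually.of_forall fun x => by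
    have := hf0 x; positivity) (by fun_prop)]
  have h2 : ∀ t, volume {x | t < f x / M} = volume {x | M * t < f x} := by
    intro t
    congr 1; ext x; simp only [Set.mem_ofPred_eq]; rw [lt_div_iff₀ hM, mul_comm]
  simp_rw [h2]
  have : Set.Ioi (0:ℝ) = Set.Ioo 0 1 ∪ Set.Ici 1 := by
    rw [Set.Ioo_union_Ici_eq_Ioi one_pos]
  rw [this, lintegral_union measurableSet_Ici (by
    rw [Set.disjoint_left]; rintro x hx hx'; exact absurd hx.2 (not_lt.2 hx'))]
  have : ∫⁻ t in Set.Ici (1:ℝ), volume {x | M * t < f x} = 0 := by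
    rw [setLIntegral_congr_fun (g := fun _ => 0) measurableSet_Ici]
    · simp
    · intro t ht
      have : {x | M * t < f x} = ∅ := by
        ext x; simp only [Set.mem_ofPred_eq, Set.mem_empty_iff_false, iff_false, not_lt]
        have := hfM x
        have ht : (1:ℝ) ≤ t := ht
        nlinarith
      simp [this]
  rw [this, add_zero]

lemma ENNReal.rpow_mul_rpow_le_add {a b : ℝ} (ha : 0 < a) (hb : 0 < b) (hab : a + b = 1)
    (u v : ℝ≥0∞) : u ^ a * v ^ b ≤ ENNReal.ofReal a * u + ENNReal.ofReal b * v := by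
  by_cases hu : u = ∞
  · subst hu
    rw [ENNReal.mul_top (by simpa using ha)]; simp
  by_cases hv : v = ∞
  · subst hv
    rw [ENNReal.mul_top (a := ENNReal.ofReal b) (by simpa using hb)]; simp
  lift u to NNReal using hu
  lift v to NNReal using hv
  have := NNReal.geom_mean_le_arith_mean2_weighted (⟨a, ha.le⟩ : NNReal) ⟨b, hb.le⟩ u v
    (NNReal.eq hab)
  rw [← ENNReal.coe_rpow_of_nonneg _ ha.le, ← ENNReal.coe_rpow_of_nonneg _ hb.le,
    ENNReal.ofReal, ENNReal.ofReal, Real.toNNReal_of_nonneg ha.le, Real.toNNReal_of_nonneg hb.le]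
  exact_mod_cast this

lemma prekopaLeindler_real_of_bounded {a b : ℝ} (ha : 0 < a) (hb : 0 < b) (hab : a + b = 1)
    {f g : ℝ → ℝ} {h : ℝ → ℝ≥0∞} (hf : Measurable f) (hg : Measurable g) (hh : Measurable h)
    (hf0 : ∀ x, 0 ≤ f x) (hg0 : ∀ x, 0 ≤ g x) (hfb : BddAbove (Set.range f))
    (hgb : BddAbove (Set.range g))
    (H : ∀ x y, ENNReal.ofReal (f x) ^ a * ENNReal.ofReal (g y) ^ b ≤ h (a * x + b * y)) :
    (∫⁻ x, ENNReal.ofReal (f x)) ^ a * (∫⁻ x, ENNReal.ofReal (g x)) ^ b ≤ ∫⁻ x, h x := by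
  set M := ⨆ x, f x
  set N := ⨆ x, g x
  have hfM : ∀ x, f x ≤ M := le_ciSup hfb
  have hgN : ∀ x, g x ≤ N := le_ciSup hgb
  rcases ((hf0 0).trans (hfM 0)).eq_or_lt with hM | hM
  · have : ∀ x, f x = 0 := fun x => le_antisymm (by rw [hM]; exact hfM x) (hf0 x)
    simp [this, ha]
  rcases ((hg0 0).trans (hgN 0)).eq_or_lt with hN | hN
  · have : ∀ x, g x = 0 := fun x => le_antisymm (by rw [hN]; exact hgN x) (hg0 x)
    simp [this, hb]
  set P : ℝ := M ^ a * N ^ b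
  have hP : 0 < P := by positivity
  -- truncate `h`
  let h' : ℝ → ℝ := fun z => (min (h z) (ENNReal.ofReal P)).toReal
  have hh' : Measurable h' := by fun_prop
  have hfin : ∀ z, min (h z) (ENNReal.ofReal P) ≠ ∞ :=
    fun z => ((min_le_right _ _).trans_lt ENNReal.ofReal_lt_top).ne
  have hh'P : ∀ z, h' z ≤ P := fun z =>
    ENNReal.toReal_le_of_le_ofReal hP.le (min_le_right _ _)
  have hle : ∫⁻ x, ENNReal.ofReal (h' x) ≤ ∫⁻ x, h x := by
    apply lintegral_mono
    intro x
    simp only [h', ENNReal.ofReal_toReal (hfin x)]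
    exact min_le_left _ _
  refine le_trans ?_ hle
  rw [lintegral_eq_mul_lintegral_level hf hf0 hM hfM, lintegral_eq_mul_lintegral_level hg hg0 hN hgN,
    lintegral_eq_mul_lintegral_level hh' (fun _ => ENNReal.toReal_nonneg) hP hh'P]
  rw [ENNReal.mul_rpow_of_nonneg _ _ ha.le, ENNReal.mul_rpow_of_nonneg _ _ hb.le, mul_mul_mul_comm,
    ENNReal.ofReal_rpow_of_pos hM, ENNReal.ofReal_rpow_of_pos hN,
    ← ENNReal.ofReal_mul (by positivity)]
  gcongr
  refine (ENNReal.rpow_mul_rpow_le_add ha hb hab _ _).trans ?_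
  rw [← lintegral_const_mul' _ _ ENNReal.ofReal_ne_top, ← lintegral_const_mul' _ _ ENNReal.ofReal_ne_top]
  refine le_trans (le_lintegral_add _ _) ?_
  refine setLIntegral_mono' measurableSet_Ioo ?_
  rintro t ⟨ht0, ht1⟩
  apply measure_add_le_of_measurableSet
  · exact measurableSet_lt measurable_const hf
  · exact measurableSet_lt measurable_const hg
  · have : M * t < M := by nlinarith
    exact exists_lt_of_lt_ciSup this
  · have : N * t < N := by nlinarith
    exact exists_lt_of_lt_ciSup this
  · exact ha
  · exact hb
  · intro x hx y hy
    simp only [Set.mem_ofPred_eq] at hx hy ⊢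
    have hMt : 0 < M * t := by positivity
    have hNt : 0 < N * t := by positivity
    have h1 : P * t < f x ^ a * g y ^ b := by
      have : P * t = (M * t) ^ a * (N * t) ^ b := by
        rw [Real.mul_rpow hM.le ht0.le, Real.mul_rpow hN.le ht0.le, mul_mul_mul_comm,
          ← Real.rpow_add ht0, hab, Real.rpow_one]
      rw [this]
      have e1 := Real.rpow_lt_rpow hMt.le hx ha
      have e2 := Real.rpow_lt_rpow hNt.le hy hb
      exact mul_lt_mul'' e1 e2 (by positivity) (by positivity)
    have h2 := H x y
    rw [ENNReal.ofReal_rpow_of_nonneg (hf0 x) ha.le, ENNReal.ofReal_rpow_of_nonneg (hg0 y) hb.le,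
      ← ENNReal.ofReal_mul (Real.rpow_nonneg (hf0 x) _)] at h2
    have h3 : ENNReal.ofReal (P * t) < min (h (a * x + b * y)) (ENNReal.ofReal P) := by
      apply lt_min
      · refine lt_of_lt_of_le ?_ h2
        exact (ENNReal.ofReal_lt_ofReal_iff_of_nonneg (by positivity)).2 h1
      · exact (ENNReal.ofReal_lt_ofReal_iff_of_nonneg (by positivity)).2 (by nlinarith)
    exact (ENNReal.ofReal_lt_iff_lt_toReal (by positivity) (hfin _)).1 h3

lemma lintegral_iSup_min_nat {E : Type*} [MeasurableSpace E] {μ : Measure E} {f : E → ℝ≥0∞}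
    (hf : Measurable f) : ∫⁻ x, f x ∂μ = ⨆ k : ℕ, ∫⁻ x, min (f x) k ∂μ := by
  rw [← lintegral_iSup]
  · congr 1; ext x
    rw [← inf_iSup_eq, ENNReal.iSup_natCast]; simp
  · intro k; fun_prop
  · intro i j hij x
    simp only
    gcongr

lemma ENNReal.iSup_rpow_of_pos {ι : Type*} {a : ℝ} (ha : 0 < a) (u : ι → ℝ≥0∞) :
    (⨆ i, u i) ^ a = ⨆ i, u i ^ a := by
  exact (ENNReal.orderIsoRpow a ha).map_iSup u

theorem prekopaLeindler_real : PrekopaLeindler (volume : Measure ℝ) := by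
  intro a b ha hb hab f g h hf hg hh H
  rw [lintegral_iSup_min_nat hf, lintegral_iSup_min_nat hg, ENNReal.iSup_rpow_of_pos ha,
    ENNReal.iSup_rpow_of_pos hb]
  rw [ENNReal.iSup_mul]
  refine iSup_le fun k => ?_
  rw [ENNReal.mul_iSup]
  refine iSup_le fun l => ?_
  have e1 : ∀ (f : ℝ → ℝ≥0∞) (k : ℕ) (x : ℝ),
      min (f x) k = ENNReal.ofReal ((min (f x) k).toReal) := by
    intro f k x
    rw [ENNReal.ofReal_toReal]
    exact ((min_le_right _ _).trans_lt (ENNReal.natCast_lt_top k)).ne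
  have e2 : ∀ (f : ℝ → ℝ≥0∞) (k : ℕ), BddAbove (Set.range fun x => (min (f x) k).toReal) := by
    intro f k
    refine ⟨k, ?_⟩
    rintro _ ⟨x, rfl⟩
    have := ENNReal.toReal_mono (ENNReal.natCast_ne_top k) (min_le_right (f x) k)
    simpa using this
  rw [lintegral_congr (e1 f k), lintegral_congr (e1 g l)]
  apply prekopaLeindler_real_of_bounded ha hb hab (by fun_prop) (by fun_prop) hh
    (fun _ => ENNReal.toReal_nonneg) (fun _ => ENNReal.toReal_nonneg) (e2 f k) (e2 g l)
  intro x y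
  rw [← e1, ← e1]
  refine le_trans ?_ (H x y)
  gcongr
  exacts [min_le_left _ _, min_le_left _ _]

theorem PrekopaLeindler.prod {E F : Type*} [AddCommGroup E] [Module ℝ E] [MeasurableSpace E]
    [AddCommGroup F] [Module ℝ F] [MeasurableSpace F] {μ : Measure E} {ν : Measure F}
    [SFinite μ] [SFinite ν] (hμ : PrekopaLeindler μ) (hν : PrekopaLeindler ν) :
    PrekopaLeindler (μ.prod ν) := by
  intro a b ha hb hab f g h hf hg hh H
  rw [lintegral_prod _ hf.aemeasurable, lintegral_prod _ hg.aemeasurable,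
    lintegral_prod _ hh.aemeasurable]
  refine hμ a b ha hb hab _ _ _ hf.lintegral_prod_right' hg.lintegral_prod_right'
    hh.lintegral_prod_right' ?_
  intro x y
  refine hν a b ha hb hab _ _ _ (by fun_prop) (by fun_prop) (by fun_prop) ?_
  intro u v
  exact H (x, u) (y, v)

theorem PrekopaLeindler.of_measurePreserving {E F : Type*} [AddCommGroup E] [Module ℝ E]
    [MeasurableSpace E] [AddCommGroup F] [Module ℝ F] [MeasurableSpace F] {μ : Measure E}
    {ν : Measure F} (hμ : PrekopaLeindler μ) (e : E →ₗ[ℝ] F) (he : MeasurePreserving e μ ν) :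
    PrekopaLeindler ν := by
  intro a b ha hb hab f g h hf hg hh H
  rw [← he.lintegral_comp hf, ← he.lintegral_comp hg, ← he.lintegral_comp hh]
  refine hμ a b ha hb hab _ _ _ (hf.comp he.measurable) (hg.comp he.measurable)
    (hh.comp he.measurable) ?_
  intro x y
  simpa using H (e x) (e y)

theorem prekopaLeindler_pi : ∀ n : ℕ, PrekopaLeindler (volume : Measure (Fin n → ℝ))
  | 0 => by
    intro a b ha hb hab f g h hf hg hh H
    have := H 0 0
    have h0 : a • (0 : Fin 0 → ℝ) + b • 0 = 0 := by simp
    rw [h0] at this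
    simp only [lintegral_unique]
    have h1 : (volume : Measure (Fin 0 → ℝ)) Set.univ = 1 := by simp [volume_pi]
    rw [h1, mul_one, mul_one, mul_one]
    convert this
  | n + 1 => by
    have h := prekopaLeindler_real.prod (prekopaLeindler_pi n)
    refine h.of_measurePreserving (F := Fin (n + 1) → ℝ) (Fin.consLinearEquiv ℝ (fun _ => ℝ)).toLinearMap ?_
    have := (volume_preserving_piFinSuccAbove (fun _ : Fin (n + 1) => ℝ) 0).symm
    convert this using 1
    swap
    · rfl
    ext x i
    refine Fin.cases ?_ (fun j => ?_) i <;> simp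
    
theorem prekopaLeindler_euclideanSpace (n : ℕ) :
    PrekopaLeindler (volume : Measure (EuclideanSpace ℝ (Fin n))) :=
  (prekopaLeindler_pi n).of_measurePreserving
    (WithLp.linearEquiv 2 ℝ (Fin n → ℝ)).symm.toLinearMap
    (EuclideanSpace.volume_preserving_symm_measurableEquiv_toLp (Fin n)).symm

section Gaussian

set_option linter.unusedSectionVars false

variable {E : Type*} [NormedAddCommGroup E] [InnerProductSpace ℝ E] [FiniteDimensional ℝ E]
  [MeasurableSpace E] [BorelSpace E]

theorem prekopaLeindler_innerProductSpace : PrekopaLeindler (volume : Measure E) :=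
  (prekopaLeindler_euclideanSpace _).of_measurePreserving
    (stdOrthonormalBasis ℝ E).repr.symm.toLinearEquiv.toLinearMap
    (stdOrthonormalBasis ℝ E).repr.symm.measurePreserving

variable (E) in
/-- The density of the standard Gaussian measure with respect to Lebesgue measure. -/
noncomputable def gaussDensity (x : E) : ℝ :=
  (2 * π) ^ (-(Module.finrank ℝ E : ℝ) / 2) * exp (-(‖x‖ ^ 2 / 2))

lemma gaussDensity_pos (x : E) : 0 < gaussDensity E x := by
  unfold gaussDensity; positivity

@[fun_prop]
lemma measurable_gaussDensity : Measurable (gaussDensity E) := by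
  unfold gaussDensity; fun_prop

lemma integral_gaussDensity : ∫ x, gaussDensity E x = 1 := by
  unfold gaussDensity
  rw [integral_const_mul]
  have := GaussianFourier.integral_rexp_neg_mul_sq_norm (V := E) (b := 1 / 2) (by norm_num)
  have e : ∀ x : E, exp (-(‖x‖ ^ 2 / 2)) = exp (-(1 / 2) * ‖x‖ ^ 2) := fun x => by ring_nf
  simp_rw [e, this]
  rw [show π / (1 / 2) = 2 * π by ring, ← Real.rpow_add (by positivity)]
  ring_nf; simp

lemma integrable_gaussDensity : Integrable (gaussDensity E) := by
  by_contra h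
  have := integral_gaussDensity (E := E)
  rw [integral_undef h] at this
  norm_num at this

theorem stdGaussian_eq_withDensity :
    stdGaussian E = volume.withDensity (fun x => ENNReal.ofReal (gaussDensity E x)) := by
  have : IsProbabilityMeasure
      (volume.withDensity (fun x => ENNReal.ofReal (gaussDensity E x))) := by
    constructor
    rw [withDensity_apply _ MeasurableSet.univ, setLIntegral_univ,
      ← ofReal_integral_eq_lintegral_ofReal integrable_gaussDensity
      (Filter.Eventually.of_forall fun x => (gaussDensity_pos x).le), integral_gaussDensity]
    simp
  apply Measure.ext_of_charFun
  ext t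
  rw [charFun_stdGaussian, charFun_apply, integral_withDensity_eq_integral_toReal_smul (by fun_prop)
    (Filter.Eventually.of_forall fun x => ENNReal.ofReal_lt_top)]
  have h := GaussianFourier.integral_cexp_neg_mul_sq_norm_add (V := E) (b := 1 / 2) (by norm_num)
    Complex.I t
  have e : ∀ x : E, (ENNReal.ofReal (gaussDensity E x)).toReal • Complex.exp (⟪x, t⟫ * Complex.I) =
      (((2 * π) ^ (-(Module.finrank ℝ E : ℝ) / 2) : ℝ) : ℂ) *
        Complex.exp (-(1 / 2) * ‖x‖ ^ 2 + Complex.I * ⟪t, x⟫) := by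
    intro x
    rw [ENNReal.toReal_ofReal (gaussDensity_pos x).le, gaussDensity, Complex.real_smul,
      Complex.ofReal_mul, mul_assoc, Complex.ofReal_exp, ← Complex.exp_add, real_inner_comm]
    congr 2
    push_cast
    ring
  simp_rw [e]
  rw [integral_const_mul, h, ← mul_assoc]
  have e1 : ((π : ℂ) / (1 / 2)) ^ (Module.finrank ℝ E / 2 : ℂ) =
      (((2 * π) ^ ((Module.finrank ℝ E : ℝ) / 2) : ℝ) : ℂ) := by
    rw [Complex.ofReal_cpow (by positivity)]
    push_cast
    congr 1; ring
  rw [e1, ← Complex.ofReal_mul, ← Real.rpow_add (by positivity)]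
  have : (-(Module.finrank ℝ E : ℝ) / 2 + (Module.finrank ℝ E : ℝ) / 2) = 0 := by ring
  rw [this]
  simp only [Complex.ofReal_one, Real.rpow_zero, one_mul, Complex.I_sq]
  congr 1
  ring

lemma lintegral_stdGaussian {f : E → ℝ≥0∞} (hf : Measurable f) :
    ∫⁻ x, f x ∂(stdGaussian E) = ∫⁻ x, ENNReal.ofReal (gaussDensity E x) * f x := by
  rw [stdGaussian_eq_withDensity, lintegral_withDensity_eq_lintegral_mul _ (by fun_prop) hf]
  rfl

lemma integral_stdGaussian (f : E → ℝ) :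
    ∫ x, f x ∂(stdGaussian E) = ∫ x, gaussDensity E x * f x := by
  rw [stdGaussian_eq_withDensity, integral_withDensity_eq_integral_toReal_smul (by fun_prop)
    (Filter.Eventually.of_forall fun x => ENNReal.ofReal_lt_top)]
  simp [ENNReal.toReal_ofReal (gaussDensity_pos _).le]

lemma gauss_lintegral_exp_mul_le {f : E → ℝ} {σ : ℝ} (hf : ∀ x y, |f x - f y| ≤ σ * ‖x - y‖)
    (hm : Measurable f) :
    (∫⁻ x, ENNReal.ofReal (exp (f x)) ∂(stdGaussian E)) *
      (∫⁻ x, ENNReal.ofReal (exp (-f x)) ∂(stdGaussian E)) ≤ ENNReal.ofReal (exp (σ ^ 2)) := by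
  rw [lintegral_stdGaussian (by fun_prop), lintegral_stdGaussian (by fun_prop)]
  have h := prekopaLeindler_innerProductSpace (E := E) (1 / 2) (1 / 2) (by norm_num) (by norm_num)
    (by norm_num) (fun x => ENNReal.ofReal (gaussDensity E x) * ENNReal.ofReal (exp (f x)))
    (fun x => ENNReal.ofReal (gaussDensity E x) * ENNReal.ofReal (exp (-f x)))
    (fun x => ENNReal.ofReal (gaussDensity E x * exp (σ ^ 2 / 2)))
    (by fun_prop) (by fun_prop) (by fun_prop) ?_
  · rw [← ENNReal.mul_rpow_of_nonneg _ _ (by norm_num)] at h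
    have h2 := ENNReal.rpow_le_rpow h (show (0:ℝ) ≤ 2 by norm_num)
    rw [← ENNReal.rpow_mul] at h2
    norm_num at h2
    refine h2.trans ?_
    simp_rw [ENNReal.ofReal_mul (gaussDensity_pos _).le]
    rw [lintegral_mul_const _ (by fun_prop), ← ofReal_integral_eq_lintegral_ofReal
      integrable_gaussDensity (Filter.Eventually.of_forall fun x => (gaussDensity_pos x).le),
      integral_gaussDensity]
    rw [ENNReal.ofReal_one, one_mul, ← ENNReal.ofReal_pow (by positivity), ← Real.exp_nat_mul]
    apply le_of_eq; congr 2; push_cast; ring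
  · intro x y
    simp only [← ENNReal.ofReal_mul (gaussDensity_pos _).le]
    rw [ENNReal.ofReal_rpow_of_pos (mul_pos (gaussDensity_pos _) (exp_pos _)),
      ENNReal.ofReal_rpow_of_pos (mul_pos (gaussDensity_pos _) (exp_pos _)),
      ← ENNReal.ofReal_mul (by have := gaussDensity_pos x; positivity)]
    apply ENNReal.ofReal_le_ofReal
    simp only [gaussDensity]
    set c : ℝ := (2 * π) ^ (-(Module.finrank ℝ E : ℝ) / 2)
    have hc : 0 < c := by positivity
    rw [mul_assoc, mul_assoc, mul_assoc, ← Real.exp_add, ← Real.exp_add, ← Real.exp_add,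
      Real.mul_rpow hc.le (exp_pos _).le, Real.mul_rpow hc.le (exp_pos _).le, mul_mul_mul_comm,
      ← Real.rpow_add hc, ← Real.exp_mul, ← Real.exp_mul, ← Real.exp_add]
    rw [show (1 / 2 + 1 / 2 : ℝ) = 1 by norm_num, Real.rpow_one]
    refine mul_le_mul_of_nonneg_left (Real.exp_le_exp.2 ?_) hc.le
    have e1 : ‖(1 / 2 : ℝ) • x + (1 / 2 : ℝ) • y‖ ^ 2 = (‖x‖ ^ 2 + ‖y‖ ^ 2) / 2 - ‖x - y‖ ^ 2 / 4 := by
      rw [@norm_add_sq_real, @norm_sub_sq_real, norm_smul, norm_smul, real_inner_smul_left,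
        real_inner_smul_right]
      norm_num
      ring
    rw [e1]
    have := (abs_le.1 (hf x y)).2
    nlinarith [sq_nonneg (σ - ‖x - y‖ / 2), norm_nonneg (x - y)]

omit [NormedAddCommGroup E] [InnerProductSpace ℝ E] [FiniteDimensional ℝ E] [BorelSpace E] in
lemma ofReal_integral_le_lintegral {μ : Measure E} (f : E → ℝ) :
    ENNReal.ofReal (∫ x, f x ∂μ) ≤ ∫⁻ x, ENNReal.ofReal (f x) ∂μ := by
  by_cases hf : Integrable f μ
  · rw [integral_eq_lintegral_pos_part_sub_lintegral_neg_part hf]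
    refine (ENNReal.ofReal_le_ofReal (sub_le_self _ ENNReal.toReal_nonneg)).trans ?_
    exact ENNReal.ofReal_toReal_le
  · simp [integral_undef hf]

lemma integrable_norm_stdGaussian : Integrable (fun x : E => ‖x‖) (stdGaussian E) :=
  IsGaussian.integrable_id.norm

lemma integrable_of_lipschitz_stdGaussian {f : E → ℝ} {σ : ℝ}
    (hf : ∀ x y, |f x - f y| ≤ σ * ‖x - y‖) (hm : Measurable f) :
    Integrable f (stdGaussian E) := by
  refine Integrable.mono' (g := fun x => |f 0| + σ * ‖x‖)
    ((integrable_const _).add (integrable_norm_stdGaussian.const_mul _)) hm.aestronglyMeasurable ?_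
  refine Filter.Eventually.of_forall fun x => ?_
  have := hf x 0
  rw [sub_zero] at this
  rw [Real.norm_eq_abs]
  have := abs_sub_abs_le_abs_sub (f x) (f 0)
  linarith

/-- Gaussian concentration: Laplace transform of a centred Lipschitz function. -/
theorem gauss_lintegral_exp_le {f : E → ℝ} {σ : ℝ} (hf : ∀ x y, |f x - f y| ≤ σ * ‖x - y‖)
    (hm : Measurable f) (l : ℝ) :
    ∫⁻ x, ENNReal.ofReal (exp (l * (f x - ∫ y, f y ∂(stdGaussian E)))) ∂(stdGaussian E) ≤
      ENNReal.ofReal (exp (l ^ 2 * σ ^ 2)) := by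
  set m := ∫ y, f y ∂(stdGaussian E)
  have hi := integrable_of_lipschitz_stdGaussian hf hm
  have h := gauss_lintegral_exp_mul_le (f := fun x => l * (f x - m)) (σ := |l| * σ) (by
    intro x y
    rw [← mul_sub, abs_mul, sub_sub_sub_cancel_right, mul_assoc]
    gcongr
    exact hf x y) (by fun_prop)
  rw [mul_pow, sq_abs] at h
  refine le_trans ?_ h
  refine le_mul_of_one_le_right zero_le ?_
  have h1 : ∫ x, (1 - l * (f x - m)) ∂(stdGaussian E) = 1 := by
    rw [integral_sub (integrable_const _) (Integrable.const_mul (by fun_prop) _),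
      integral_const_mul, integral_sub hi (integrable_const _)]
    simp [m]
  calc (1 : ℝ≥0∞) = ENNReal.ofReal (∫ x, (1 - l * (f x - m)) ∂(stdGaussian E)) := by simp [h1]
    _ ≤ ∫⁻ x, ENNReal.ofReal (1 - l * (f x - m)) ∂(stdGaussian E) :=
        ofReal_integral_le_lintegral _
    _ ≤ _ := by
        apply lintegral_mono
        intro x
        apply ENNReal.ofReal_le_ofReal
        have := Real.add_one_le_exp (-(l * (f x - m)))
        linarith

lemma map_inner_stdGaussian (y : E) :
    (stdGaussian E).map (fun x => ⟪x, y⟫) = gaussianReal 0 (‖y‖ ^ 2).toNNReal := by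
  have h := IsGaussian.map_eq_gaussianReal (μ := stdGaussian E) (innerSL ℝ y)
  rw [integral_strongDual_stdGaussian, variance_dual_stdGaussian] at h
  simp only [innerSL_apply_norm] at h
  rw [← h]
  congr 1
  ext x
  simp [real_inner_comm]

lemma integral_exp_inner_stdGaussian (y : E) :
    ∫ x, exp ⟪x, y⟫ ∂(stdGaussian E) = exp (‖y‖ ^ 2 / 2) := by
  have h := mgf_gaussianReal (p := stdGaussian E) (map_inner_stdGaussian y) 1
  simp [mgf] at h
  exact h

lemma integrable_exp_inner_stdGaussian (y : E) :
    Integrable (fun x => exp ⟪x, y⟫) (stdGaussian E) := by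
  by_contra h
  have := integral_exp_inner_stdGaussian y
  rw [integral_undef h] at this
  exact (exp_pos _).ne this

lemma integral_inner_sq_stdGaussian (y : E) :
    ∫ x, ⟪x, y⟫ ^ 2 ∂(stdGaussian E) = ‖y‖ ^ 2 := by
  have h := variance_dual_stdGaussian (innerSL ℝ y)
  rw [variance_eq_integral (by fun_prop), integral_strongDual_stdGaussian, innerSL_apply_norm] at h
  simpa [real_inner_comm] using h

lemma integral_inner_stdGaussian (y : E) : ∫ x, ⟪x, y⟫ ∂(stdGaussian E) = 0 := by
  have := integral_strongDual_stdGaussian (innerSL ℝ y)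
  simpa [real_inner_comm] using this

lemma integrable_inner_stdGaussian (y : E) : Integrable (fun x => ⟪x, y⟫) (stdGaussian E) := by
  refine integrable_of_lipschitz_stdGaussian (σ := ‖y‖) (fun a b => ?_) (by fun_prop)
  rw [← inner_sub_left, mul_comm]
  exact abs_real_inner_le_norm _ _

lemma exp_neg_mul_measure_le_stdGaussian (y : E) {A : Set E} (hA : MeasurableSet A)
    (hs : ∀ x ∈ A, -x ∈ A) :
    ENNReal.ofReal (exp (-(‖y‖ ^ 2 / 2))) * stdGaussian E A ≤
      stdGaussian E ((fun x => x - y) ⁻¹' A) := by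
  have key : ∀ z : E, stdGaussian E ((fun x => x - z) ⁻¹' A) =
      ENNReal.ofReal (exp (-(‖z‖ ^ 2 / 2))) * ∫⁻ x in A, ENNReal.ofReal (exp (-⟪x, z⟫))
        ∂(stdGaussian E) := by
    intro z
    rw [stdGaussian_eq_withDensity, withDensity_apply _ (hA.preimage (by fun_prop)),
      setLIntegral_withDensity_eq_setLIntegral_mul _ (by fun_prop) (by fun_prop) hA,
      ← lintegral_const_mul _ (by fun_prop)]
    have hp : MeasurePreserving (fun x : E => x - z) volume volume :=
      measurePreserving_sub_right volume z
    have := hp.setLIntegral_comp_preimage hA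
      (f := fun x => ENNReal.ofReal (gaussDensity E (x + z))) (by fun_prop)
    simp only [sub_add_cancel] at this
    rw [this]
    congr 1
    ext x
    rw [Pi.mul_apply, ← ENNReal.ofReal_mul (gaussDensity_pos _).le,
      ← ENNReal.ofReal_mul (exp_pos _).le]
    congr 1
    simp only [gaussDensity]
    rw [mul_left_comm, mul_assoc, ← exp_add, ← exp_add, norm_add_sq_real]
    congr 2
    ring
  have hneg : stdGaussian E ((fun x => x - -y) ⁻¹' A) = stdGaussian E ((fun x => x - y) ⁻¹' A) := by
    have h1 : MeasurePreserving (fun x : E => -x) (stdGaussian E) (stdGaussian E) :=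
      ⟨by fun_prop, by simpa using stdGaussian_map (LinearIsometryEquiv.neg ℝ (E := E))⟩
    rw [← h1.measure_preimage (hA.preimage (by fun_prop)).nullMeasurableSet]
    congr 1
    ext x
    simp only [Set.mem_preimage]
    constructor <;> intro h <;> have := hs _ h <;> convert this using 1 <;> abel
  have h2 : 2 * (ENNReal.ofReal (exp (-(‖y‖ ^ 2 / 2))) * stdGaussian E A) ≤
      2 * stdGaussian E ((fun x => x - y) ⁻¹' A) := by
    calc 2 * (ENNReal.ofReal (exp (-(‖y‖ ^ 2 / 2))) * stdGaussian E A)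
        = ENNReal.ofReal (exp (-(‖y‖ ^ 2 / 2))) * ∫⁻ x in A, 2 ∂(stdGaussian E) := by
          rw [setLIntegral_const]; ring
      _ ≤ ENNReal.ofReal (exp (-(‖y‖ ^ 2 / 2))) * ∫⁻ x in A, (ENNReal.ofReal (exp (-⟪x, y⟫)) +
            ENNReal.ofReal (exp (-⟪x, -y⟫))) ∂(stdGaussian E) := by
          gcongr with x
          rw [← ENNReal.ofReal_add (exp_pos _).le (exp_pos _).le]
          rw [show (2 : ℝ≥0∞) = ENNReal.ofReal 2 by norm_num]
          apply ENNReal.ofReal_le_ofReal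
          have h1 := Real.add_one_le_exp (-⟪x, y⟫)
          have h2 := Real.add_one_le_exp (-⟪x, -y⟫)
          rw [inner_neg_right] at h2 ⊢
          linarith
      _ = _ := by
          rw [lintegral_add_left (by fun_prop), mul_add, ← key]
          have := key (-y)
          rw [norm_neg] at this
          rw [← this, hneg, two_mul]
  exact (ENNReal.mul_le_mul_iff_right (by norm_num) (by norm_num)).1 h2

end Gaussian

section Comparison

set_option linter.unusedSectionVars false

lemma measurable_finset_sup' {Ω ι : Type*} [MeasurableSpace Ω] {s : Finset ι} (hs : s.Nonempty)
    {f : ι → Ω → ℝ} (hf : ∀ i ∈ s, Measurable (f i)) :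
    Measurable (fun x => s.sup' hs (fun i => f i x)) := by
  have := Finset.measurable_sup' hs hf
  convert this using 1
  ext x
  rw [Finset.sup'_apply]

lemma integral_sup'_le_of_subgaussian {Ω ι : Type*} [MeasurableSpace Ω] {μ : Measure Ω}
    [IsProbabilityMeasure μ] {s : Finset ι} (hs : s.Nonempty) {Z : ι → Ω → ℝ}
    (hm : ∀ i ∈ s, Measurable (Z i)) {l δ : ℝ} (hl : 0 < l)
    (hZ : ∀ i ∈ s, ∫⁻ x, ENNReal.ofReal (exp (l * Z i x)) ∂μ ≤ ENNReal.ofReal (exp (l ^ 2 * δ ^ 2)))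
    (hi : Integrable (fun x => s.sup' hs (fun i => Z i x)) μ) :
    ∫ x, s.sup' hs (fun i => Z i x) ∂μ ≤ log s.card / l + l * δ ^ 2 := by
  set W : Ω → ℝ := fun x => s.sup' hs (fun i => Z i x)
  have hcard : (0:ℝ) < s.card := by exact_mod_cast hs.card_pos
  set L := log s.card + l ^ 2 * δ ^ 2
  have h1 : ∫⁻ x, ENNReal.ofReal (exp (l * W x - L)) ∂μ ≤ 1 := by
    have hb : ∀ x, ENNReal.ofReal (exp (l * W x - L)) ≤
        ENNReal.ofReal (exp (-L)) * ∑ i ∈ s, ENNReal.ofReal (exp (l * Z i x)) := by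
      intro x
      obtain ⟨i, his, hiW⟩ := Finset.exists_mem_eq_sup' hs (fun i => Z i x)
      rw [show W x = Z i x from hiW, sub_eq_neg_add, exp_add,
        ENNReal.ofReal_mul (exp_pos _).le]
      gcongr
      exact Finset.single_le_sum (f := fun i => ENNReal.ofReal (exp (l * Z i x)))
        (fun _ _ => zero_le) his
    calc _ ≤ ∫⁻ x, ENNReal.ofReal (exp (-L)) * ∑ i ∈ s, ENNReal.ofReal (exp (l * Z i x)) ∂μ :=
          lintegral_mono hb
      _ = ENNReal.ofReal (exp (-L)) * ∑ i ∈ s, ∫⁻ x, ENNReal.ofReal (exp (l * Z i x)) ∂μ := by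
          rw [lintegral_const_mul' _ _ ENNReal.ofReal_ne_top, lintegral_finsetSum']
          intro i hi
          have := hm i hi
          fun_prop
      _ ≤ ENNReal.ofReal (exp (-L)) * ∑ i ∈ s, ENNReal.ofReal (exp (l ^ 2 * δ ^ 2)) := by
          gcongr with i hi
          exact hZ i hi
      _ = 1 := by
          rw [Finset.sum_const, nsmul_eq_mul, ← ENNReal.ofReal_natCast, ← ENNReal.ofReal_mul hcard.le,
            ← ENNReal.ofReal_mul (exp_pos _).le]
          simp only [L]
          rw [neg_add, exp_add, exp_neg, exp_log hcard, exp_neg]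
          field_simp
          simp
  have h2 : ENNReal.ofReal (∫ x, (l * W x - L + 1) ∂μ) ≤ 1 := by
    refine (ofReal_integral_le_lintegral _).trans (le_trans ?_ h1)
    apply lintegral_mono
    intro x
    exact ENNReal.ofReal_le_ofReal (Real.add_one_le_exp _)
  rw [ENNReal.ofReal_le_one, integral_add (by fun_prop)
    (integrable_const _), integral_sub (hi.const_mul _) (integrable_const _), integral_const_mul] at h2
  simp only [integral_const, probReal_univ, smul_eq_mul, one_mul] at h2
  have h3 : l * ∫ x, W x ∂μ ≤ L := by linarith
  have h4 : ∫ x, W x ∂μ ≤ L / l := by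
    rw [le_div_iff₀ hl]; linarith
  refine h4.trans (le_of_eq ?_)
  simp only [L]
  field_simp

variable {E : Type*} [NormedAddCommGroup E] [InnerProductSpace ℝ E] [FiniteDimensional ℝ E]
  [MeasurableSpace E] [BorelSpace E]

/-- The support function of a finite set. -/
noncomputable def supp {ι : Type*} (s : Finset ι) (hs : s.Nonempty) (t : ι → E) (x : E) : ℝ :=
  s.sup' hs (fun i => ⟪x, t i⟫)

lemma supp_sub_le {ι : Type*} {s : Finset ι} (hs : s.Nonempty) {t : ι → E} {δ : ℝ}
    (ht : ∀ i ∈ s, ‖t i‖ ≤ δ) (x y : E) : supp s hs t x - supp s hs t y ≤ δ * ‖x - y‖ := by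
  rw [sub_le_iff_le_add, supp]
  apply Finset.sup'_le
  intro i hi
  have h1 : ⟪y, t i⟫ ≤ supp s hs t y := Finset.le_sup' (fun i => ⟪y, t i⟫) hi
  have h2 : ⟪x - y, t i⟫ ≤ δ * ‖x - y‖ := by
    refine (real_inner_le_norm _ _).trans ?_
    rw [mul_comm]
    gcongr
    exact ht i hi
  rw [inner_sub_left] at h2
  linarith

lemma abs_supp_sub_le {ι : Type*} {s : Finset ι} (hs : s.Nonempty) {t : ι → E} {δ : ℝ}
    (ht : ∀ i ∈ s, ‖t i‖ ≤ δ) (x y : E) : |supp s hs t x - supp s hs t y| ≤ δ * ‖x - y‖ := by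
  rw [abs_le]
  have h1 := supp_sub_le hs ht x y
  have h2 := supp_sub_le hs ht y x
  rw [norm_sub_rev] at h2
  constructor <;> linarith

@[fun_prop]
lemma measurable_supp {ι : Type*} {s : Finset ι} (hs : s.Nonempty) {t : ι → E} :
    Measurable (supp s hs t) := by
  unfold supp
  exact measurable_finset_sup' hs (fun i _ => by fun_prop)

lemma integrable_supp {ι : Type*} {s : Finset ι} (hs : s.Nonempty) {t : ι → E} :
    Integrable (supp s hs t) (stdGaussian E) := by
  refine integrable_of_lipschitz_stdGaussian (σ := ∑ i ∈ s, ‖t i‖) (abs_supp_sub_le hs ?_)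
    (by fun_prop)
  intro i hi
  exact Finset.single_le_sum (f := fun i => ‖t i‖) (fun _ _ => norm_nonneg _) hi

lemma supp_sub_const {ι : Type*} {s : Finset ι} (hs : s.Nonempty) (t : ι → E) (c x : E) :
    supp s hs (fun i => t i - c) x = supp s hs t x - ⟪x, c⟫ := by
  unfold supp
  apply le_antisymm
  · apply Finset.sup'_le
    intro i hi
    rw [inner_sub_right]
    have := Finset.le_sup' (fun i => ⟪x, t i⟫) hi
    linarith
  · rw [sub_le_iff_le_add]
    apply Finset.sup'_le
    intro i hi
    have := Finset.le_sup' (fun i => ⟪x, t i - c⟫) hi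
    simp only [inner_sub_right] at this ⊢
    linarith

lemma integral_supp_sub_const {ι : Type*} {s : Finset ι} (hs : s.Nonempty) (t : ι → E) (c : E) :
    ∫ x, supp s hs (fun i => t i - c) x ∂(stdGaussian E) = ∫ x, supp s hs t x ∂(stdGaussian E) := by
  simp_rw [supp_sub_const]
  rw [integral_sub (integrable_supp hs) (integrable_inner_stdGaussian c), integral_inner_stdGaussian,
    sub_zero]

lemma integral_supp_nonneg {ι : Type*} {s : Finset ι} (hs : s.Nonempty) (t : ι → E) :
    0 ≤ ∫ x, supp s hs t x ∂(stdGaussian E) := by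
  obtain ⟨i, hi⟩ := id hs
  rw [← integral_inner_stdGaussian (t i)]
  refine integral_mono (integrable_inner_stdGaussian _) (integrable_supp hs) fun x => ?_
  exact Finset.le_sup' (fun i => ⟪x, t i⟫) hi

/-- Half of the Sudakov minoration for points in a ball, through Gaussian shifts. -/
lemma sudakov_aux {ι : Type*} {s : Finset ι} (hs : s.Nonempty) {t : ι → E} {a0 : E} {ρ a r : ℝ}
    (ht : ∀ i ∈ s, ‖t i - a0‖ ≤ ρ) (hsep : ∀ i ∈ s, ∀ j ∈ s, i ≠ j → a < ‖t i - t j‖) (ha : 0 ≤ a)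
    (hr : 0 < r) (hM : 8 * ∫ x, supp s hs t x ∂(stdGaussian E) ≤ r * a ^ 2) :
    (s.card : ℝ) ≤ 2 * exp (r ^ 2 * ρ ^ 2 / 2) := by
  set M := ∫ x, supp s hs t x ∂(stdGaussian E) with hMdef
  have hM0 : 0 ≤ M := integral_supp_nonneg hs t
  set V : Set E := {x | supp s hs t x + supp s hs t (-x) ≤ 4 * M}
  have hVm : MeasurableSet V := measurableSet_le (by fun_prop) measurable_const
  have hpair : ∀ x, ∀ i ∈ s, ∀ j ∈ s, ⟪x, t i⟫ - ⟪x, t j⟫ ≤ supp s hs t x + supp s hs t (-x) := by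
    intro x i hi j hj
    have h1 := Finset.le_sup' (fun i => ⟪x, t i⟫) hi
    have h2 := Finset.le_sup' (fun i => ⟪-x, t i⟫) hj
    simp only [inner_neg_left] at h1 h2
    unfold supp
    simp only [inner_neg_left]
    linarith
  have hnegmp : MeasurePreserving (fun x : E => -x) (stdGaussian E) (stdGaussian E) :=
      ⟨by fun_prop, by simpa using stdGaussian_map (LinearIsometryEquiv.neg ℝ (E := E))⟩
  have hV : (1 / 2 : ℝ≥0∞) ≤ stdGaussian E V := by
    have h_int : Integrable (fun x => supp s hs t x + supp s hs t (-x)) (stdGaussian E) :=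
      (integrable_supp hs).add (hnegmp.integrable_comp_of_integrable (integrable_supp hs))
    have hint2 : Integrable (fun x => supp s hs t (-x)) (stdGaussian E) :=
      hnegmp.integrable_comp_of_integrable (integrable_supp hs)
    have hE : ∫ x, (supp s hs t x + supp s hs t (-x)) ∂(stdGaussian E) = 2 * M := by
      rw [integral_add (integrable_supp hs) hint2, hnegmp.integral_comp (MeasurableEquiv.neg E).measurableEmbedding]
      ring
    have hnn : ∀ x, 0 ≤ supp s hs t x + supp s hs t (-x) := by
      intro x
      obtain ⟨i, hi⟩ := id hs
      simpa using hpair x i hi i hi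
    have hreal : (1 / 2 : ℝ) ≤ (stdGaussian E).real V := by
      have hc : (stdGaussian E).real Vᶜ = 1 - (stdGaussian E).real V := probReal_compl_eq_one_sub hVm
      rcases hM0.eq_or_lt with h0 | h0
      · rw [← h0, mul_zero, integral_eq_zero_iff_of_nonneg hnn h_int] at hE
        have : (stdGaussian E).real V = 1 := by
          have : stdGaussian E V = 1 := by
            rw [prob_compl_eq_zero_iff hVm |>.symm]
            refine measure_mono_null ?_ hE
            intro x hx hx'
            simp only [V, Set.mem_compl_iff, Set.mem_ofPred_eq, not_le, ← h0] at hx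
            have hx' : supp s hs t x + supp s hs t (-x) = 0 := hx'
            linarith
          simp [Measure.real, this]
        linarith
      · have := mul_meas_ge_le_integral_of_nonneg (Filter.Eventually.of_forall hnn) h_int (4 * M)
        rw [hE] at this
        have h2 : (stdGaussian E).real Vᶜ ≤
            (stdGaussian E).real {x | 4 * M ≤ supp s hs t x + supp s hs t (-x)} := by
          refine measureReal_mono ?_ (measure_ne_top _ _)
          intro x hx
          simp only [V, Set.mem_compl_iff, Set.mem_ofPred_eq, not_le] at hx ⊢
          exact hx.le
        have h3 : 4 * M * (stdGaussian E).real Vᶜ ≤ 2 * M := by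
          refine le_trans ?_ this
          gcongr
        nlinarith
    rw [Measure.real, ← ENNReal.ofReal_le_iff_le_toReal (measure_ne_top _ _)] at hreal
    refine le_trans (le_of_eq ?_) hreal
    rw [ENNReal.ofReal_div_of_pos (by norm_num)]; norm_num
  have hshift : ∀ i ∈ s, ENNReal.ofReal (exp (-(r ^ 2 * ρ ^ 2 / 2)) / 2) ≤
      stdGaussian E ((fun x => x - r • (t i - a0)) ⁻¹' V) := by
    intro i hi
    refine le_trans ?_ (exp_neg_mul_measure_le_stdGaussian _ hVm ?_)
    · rw [div_eq_mul_inv, ENNReal.ofReal_mul (exp_pos _).le]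
      gcongr
      · rw [norm_smul, mul_pow, Real.norm_eq_abs, sq_abs]
        gcongr
        exact ht i hi
      · refine le_trans (le_of_eq ?_) hV
        rw [ENNReal.ofReal_inv_of_pos (by norm_num)]; norm_num
    · intro x hx
      simp only [V, Set.mem_ofPred_eq, neg_neg] at hx ⊢
      linarith
  have hdisj : Set.PairwiseDisjoint (s : Set ι) (fun i => (fun x => x - r • (t i - a0)) ⁻¹' V) := by
    intro i hi j hj hij
    rw [Function.onFun, Set.disjoint_left]
    intro z hz hz'
    simp only [V, Set.mem_preimage, Set.mem_ofPred_eq] at hz hz'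
    have h1 := (hpair _ j hj i hi).trans hz
    have h2 := (hpair _ i hi j hj).trans hz'
    have h3 := hsep i hi j hj hij
    have h4 : ⟪z - r • (t i - a0), t j⟫ - ⟪z - r • (t i - a0), t i⟫ +
        (⟪z - r • (t j - a0), t i⟫ - ⟪z - r • (t j - a0), t j⟫) = r * ‖t i - t j‖ ^ 2 := by
      rw [← real_inner_self_eq_norm_sq]
      simp only [inner_sub_left, inner_sub_right, real_inner_smul_left]
      rw [real_inner_comm (t i) (t j)]
      ring
    have h5 : a ^ 2 < ‖t i - t j‖ ^ 2 := by gcongr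
    nlinarith
  have hsum : (s.card : ℝ≥0∞) * ENNReal.ofReal (exp (-(r ^ 2 * ρ ^ 2 / 2)) / 2) ≤ 1 := by
    calc (s.card : ℝ≥0∞) * ENNReal.ofReal (exp (-(r ^ 2 * ρ ^ 2 / 2)) / 2)
        = ∑ i ∈ s, ENNReal.ofReal (exp (-(r ^ 2 * ρ ^ 2 / 2)) / 2) := by
          rw [Finset.sum_const, nsmul_eq_mul]
      _ ≤ ∑ i ∈ s, stdGaussian E ((fun x => x - r • (t i - a0)) ⁻¹' V) := Finset.sum_le_sum hshift
      _ = stdGaussian E (⋃ i ∈ s, (fun x => x - r • (t i - a0)) ⁻¹' V) := by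
          rw [measure_biUnion_finset hdisj]
          intro i hi
          exact hVm.preimage (by fun_prop)
      _ ≤ 1 := prob_le_one
  rw [← ENNReal.ofReal_natCast, ← ENNReal.ofReal_mul (by positivity), ENNReal.ofReal_le_one,
    exp_neg] at hsum
  have := exp_pos (r ^ 2 * ρ ^ 2 / 2)
  field_simp at hsum
  linarith

/-- Sudakov minoration for points in a ball. -/
lemma sudakov {ι : Type*} {s : Finset ι} (hs : s.Nonempty) {t : ι → E} {a0 : E} {ρ : ℝ} (hρ : 0 < ρ)
    (ht : ∀ i ∈ s, ‖t i - a0‖ ≤ ρ) (hsep : ∀ i ∈ s, ∀ j ∈ s, i ≠ j → ρ / 2 < ‖t i - t j‖)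
    (hcard : 4 ≤ s.card) :
    ρ * √(log s.card) / 32 ≤ ∫ x, supp s hs t x ∂(stdGaussian E) := by
  set M := ∫ x, supp s hs t x ∂(stdGaussian E)
  have hM0 : 0 ≤ M := integral_supp_nonneg hs t
  have hN : (4:ℝ) ≤ s.card := by exact_mod_cast hcard
  have h1 : ∀ ε > 0, log s.card ≤ (32 * M / ρ + ε * ρ) ^ 2 := by
    intro ε hε
    have h := sudakov_aux hs ht hsep (by positivity) (r := 32 * M / ρ ^ 2 + ε) (by positivity) (by
      have : (32 * M / ρ ^ 2 + ε) * (ρ / 2) ^ 2 = 8 * M + ε * ρ ^ 2 / 4 := by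
        field_simp; ring
      rw [this]
      have : 0 ≤ ε * ρ ^ 2 / 4 := by positivity
      linarith)
    have h2 : log (s.card / 2) ≤ (32 * M / ρ ^ 2 + ε) ^ 2 * ρ ^ 2 / 2 := by
      rw [log_le_iff_le_exp (by positivity)]
      linarith
    have h3 : log s.card ≤ 2 * log (s.card / 2) := by
      have : (s.card : ℝ) ≤ (s.card / 2 : ℝ) ^ 2 := by nlinarith
      calc log s.card ≤ log ((s.card / 2 : ℝ) ^ 2) := log_le_log (by positivity) this
        _ = _ := by rw [log_pow]; norm_num
    have h4 : 32 * M / ρ + ε * ρ = (32 * M / ρ ^ 2 + ε) * ρ := by field_simp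
    rw [h4, mul_pow]
    linarith
  have h2 : √(log s.card) ≤ 32 * M / ρ := by
    apply le_of_forall_pos_le_add
    intro ε hε
    have := h1 (ε / ρ) (by positivity)
    rw [div_mul_cancel₀ _ hρ.ne'] at this
    exact Real.sqrt_le_iff.2 ⟨by positivity, this⟩
  rw [le_div_iff₀ hρ] at h2
  linarith

end Comparison

section Comparison

set_option linter.unusedSectionVars false

lemma integrable_finset_sup' {Ω ι : Type*} [MeasurableSpace Ω] {μ : Measure Ω} {s : Finset ι}
    (hs : s.Nonempty) {f : ι → Ω → ℝ} (hf : ∀ i ∈ s, Integrable (f i) μ) :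
    Integrable (fun x => s.sup' hs (fun i => f i x)) μ := by
  classical
  induction hs using Finset.Nonempty.cons_induction with
  | singleton a => simpa using hf a (by simp)
  | cons a s ha hs ih =>
    have h1 := ih (fun i hi => hf i (by simp [hi]))
    have h2 := hf a (by simp)
    simp_rw [Finset.sup'_cons hs]
    exact h2.sup h1

variable {E : Type*} [NormedAddCommGroup E] [InnerProductSpace ℝ E] [FiniteDimensional ℝ E]
  [MeasurableSpace E] [BorelSpace E]

open Classical in
/-- The Gaussian width `E max_{t ∈ A} ⟨g, t⟩` of a finite set (`0` for the empty set). -/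
noncomputable def gw (A : Finset E) : ℝ :=
  if h : A.Nonempty then ∫ x, supp A h id x ∂(stdGaussian E) else 0

lemma gw_eq {A : Finset E} (h : A.Nonempty) : gw A = ∫ x, supp A h id x ∂(stdGaussian E) := by
  simp [gw, h]

lemma gw_nonneg (A : Finset E) : 0 ≤ gw A := by
  unfold gw
  split_ifs with h
  · exact integral_supp_nonneg h _
  · exact le_rfl

lemma gw_mono {A B : Finset E} (hAB : A ⊆ B) : gw A ≤ gw B := by
  by_cases h : A.Nonempty
  · rw [gw_eq h, gw_eq (h.mono hAB)]
    refine integral_mono (integrable_supp h) (integrable_supp _) fun x => ?_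
    exact Finset.sup'_mono _ hAB h
  · rw [gw, dif_neg h]; exact gw_nonneg B

/-- The part of `A` in the closed ball of radius `δ` about `c`. -/
noncomputable def ballPart (A : Finset E) (c : E) (δ : ℝ) : Finset E :=
  open Classical in A.filter (fun x => ‖x - c‖ ≤ δ)

lemma mem_ballPart {A : Finset E} {c x : E} {δ : ℝ} :
    x ∈ ballPart A c δ ↔ x ∈ A ∧ ‖x - c‖ ≤ δ := by
  classical
  simp [ballPart]

lemma ballPart_mono {A B : Finset E} (h : A ⊆ B) (c : E) (δ : ℝ) :
    ballPart A c δ ⊆ ballPart B c δ := by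
  intro x hx
  rw [mem_ballPart] at hx ⊢
  exact ⟨h hx.1, hx.2⟩

lemma ballPart_subset (A : Finset E) (c : E) (δ : ℝ) : ballPart A c δ ⊆ A :=
  fun _ hx => (mem_ballPart.1 hx).1

lemma growth {A : Finset E} {N : ℕ} (hN : 4 ≤ N) {c : ℕ → E} {a0 : E} {ρ m : ℝ} (hρ : 0 < ρ)
    (hc : ∀ l < N, c l ∈ A) (hca : ∀ l < N, ‖c l - a0‖ ≤ ρ)
    (hsep : ∀ l < N, ∀ k < N, l ≠ k → ρ / 2 < ‖c l - c k‖)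
    (hm : ∀ l < N, m ≤ gw (ballPart A (c l) (ρ / 256))) :
    ρ * √(log N) / 64 + m ≤ gw A := by
  set δ := ρ / 256 with hδdef
  have hδ : 0 < δ := by positivity
  have hs : (Finset.range N).Nonempty := Finset.nonempty_range_iff.2 (by omega)
  have hA : A.Nonempty := ⟨c 0, hc 0 (by omega)⟩
  have hH : ∀ l ∈ Finset.range N, (ballPart A (c l) δ).Nonempty := fun l hl =>
    ⟨c l, mem_ballPart.2 ⟨hc l (Finset.mem_range.1 hl), by simp [hδ.le]⟩⟩
  classical
  let Y : ℕ → E → ℝ := fun l x =>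
    if h : (ballPart A (c l) δ).Nonempty then supp _ h (fun t => t - c l) x else 0
  have hY : ∀ l (hl : l ∈ Finset.range N), Y l = supp _ (hH l hl) (fun t => t - c l) := by
    intro l hl
    ext x
    simp [Y, hH l hl]
  have hYlip : ∀ l ∈ Finset.range N, ∀ x y, |Y l x - Y l y| ≤ δ * ‖x - y‖ := by
    intro l hl
    rw [hY l hl]
    exact abs_supp_sub_le _ (fun i hi => (mem_ballPart.1 hi).2)
  have hYm : ∀ l ∈ Finset.range N, Measurable (Y l) := by
    intro l hl
    rw [hY l hl]; fun_prop
  have hYi : ∀ l ∈ Finset.range N, Integrable (Y l) (stdGaussian E) := by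
    intro l hl
    rw [hY l hl]; exact integrable_supp _
  have hYint : ∀ l ∈ Finset.range N, ∫ x, Y l x ∂(stdGaussian E) = gw (ballPart A (c l) δ) := by
    intro l hl
    rw [hY l hl, gw_eq (hH l hl)]
    exact integral_supp_sub_const (hH l hl) id (c l)
  let Z : ℕ → E → ℝ := fun l x => (∫ y, Y l y ∂(stdGaussian E)) - Y l x
  have hZi : Integrable (fun x => (Finset.range N).sup' hs (fun l => Z l x)) (stdGaussian E) :=
    integrable_finset_sup' hs (fun l hl => (integrable_const _).sub (hYi l hl))
  have hNr : (4:ℝ) ≤ N := by exact_mod_cast hN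
  have hlog : 0 < log N := log_pos (by linarith)
  have hsq : 0 < √(log N) := Real.sqrt_pos.2 hlog
  have hZ : ∫ x, (Finset.range N).sup' hs (fun l => Z l x) ∂(stdGaussian E) ≤ 2 * δ * √(log N) := by
    have := integral_sup'_le_of_subgaussian hs (Z := Z) (μ := stdGaussian E) (l := √(log N) / δ)
      (δ := δ) (fun l hl => by have := hYm l hl; fun_prop) (by positivity) (fun l hl => by
        have := gauss_lintegral_exp_le (hYlip l hl) (hYm l hl) (-(√(log N) / δ))
        rw [neg_sq] at this
        refine le_trans (le_of_eq ?_) this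
        congr 1
        ext x
        simp only [Z]
        congr 2
        ring) hZi
    rw [Finset.card_range] at this
    refine this.trans (le_of_eq ?_)
    field_simp
    rw [Real.sq_sqrt hlog.le]
    ring
  have hsud := sudakov hs (t := c) hρ (fun l hl => hca l (Finset.mem_range.1 hl))
    (fun l hl k hk h => hsep l (Finset.mem_range.1 hl) k (Finset.mem_range.1 hk) h) (by simpa using hN)
  rw [Finset.card_range] at hsud
  have hpt : ∀ x, supp _ hs c x + m - (Finset.range N).sup' hs (fun l => Z l x) ≤ supp A hA id x := by
    intro x
    obtain ⟨l, hl, hlx⟩ := Finset.exists_mem_eq_sup' hs (fun l => ⟪x, c l⟫)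
    have h1 : Z l x ≤ (Finset.range N).sup' hs (fun l => Z l x) :=
      Finset.le_sup' (fun l => Z l x) hl
    have h2 : Y l x + ⟪x, c l⟫ ≤ supp A hA id x := by
      rw [hY l hl, supp_sub_const (hH l hl) (fun t => t), sub_add_cancel]
      exact Finset.sup'_mono (fun i => ⟪x, i⟫) (ballPart_subset _ _ _) (hH l hl)
    have h3 := hm l (Finset.mem_range.1 hl)
    rw [← hYint l hl] at h3
    have h4 : supp _ hs c x = ⟪x, c l⟫ := hlx
    simp only [Z] at h1 ⊢
    linarith
  have hi1 : Integrable (fun x => supp _ hs c x + m) (stdGaussian E) :=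
    (integrable_supp hs).add (integrable_const m)
  have h1 := integral_mono (hi1.sub hZi) (integrable_supp hA) hpt
  rw [← gw_eq hA] at h1
  rw [integral_sub' hi1 hZi,
    integral_add (integrable_supp hs) (integrable_const m)] at h1
  simp only [integral_const, probReal_univ, smul_eq_mul, one_mul] at h1
  have : ρ * √(log N) / 64 ≤ ρ * √(log N) / 32 - 2 * δ * √(log N) := by
    rw [hδdef]
    have : 0 < ρ * √(log N) := by positivity
    linarith
  linarith

/-- The piece of `A` labelled `i` by `idx`. -/
noncomputable def piece (A : Finset E) (idx : E → ℕ) (i : ℕ) : Finset E :=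
  open Classical in A.filter (fun x => idx x = i)

lemma mem_piece {A : Finset E} {idx : E → ℕ} {i : ℕ} {x : E} :
    x ∈ piece A idx i ↔ x ∈ A ∧ idx x = i := by
  classical
  simp [piece]

/-- Greedy decomposition of a finite set into pieces of radius `a`. -/
lemma exists_greedy (a δ : ℝ) (ha : 0 ≤ a) (A : Finset E) :
    ∃ (c : ℕ → E) (idx : E → ℕ), ∀ t ∈ A, ‖t - c (idx t)‖ ≤ a ∧ idx (c (idx t)) = idx t ∧
      (∀ l ≤ idx t, c l ∈ A) ∧ (∀ l ≤ idx t, ∀ k ≤ idx t, l ≠ k → a < ‖c l - c k‖) ∧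
      ∀ l ≤ idx t, ∀ u ∈ piece A idx (idx t),
        gw (ballPart (piece A idx (idx t)) u δ) ≤ gw (ballPart A (c l) δ) := by
  classical
  induction A using Finset.strongInduction with
  | H A ih =>
  rcases A.eq_empty_or_nonempty with rfl | hA
  · exact ⟨fun _ => 0, fun _ => 0, by simp⟩
  obtain ⟨c0, hc0, hmax⟩ := A.exists_max_image (fun t => gw (ballPart A t δ)) hA
  set A' := A.filter (fun x => ¬ ‖x - c0‖ ≤ a)
  have hA' : A' ⊂ A := by
    refine Finset.filter_ssubset.2 ⟨c0, hc0, by simpa using ha⟩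
  obtain ⟨c', idx', h⟩ := ih A' hA'
  let c : ℕ → E := fun n => n.casesOn c0 c'
  let idx : E → ℕ := fun t => if ‖t - c0‖ ≤ a then 0 else idx' t + 1
  have hmem : ∀ t ∈ A, ¬ ‖t - c0‖ ≤ a → t ∈ A' := fun t ht h => Finset.mem_filter.2 ⟨ht, h⟩
  refine ⟨c, idx, fun t ht => ?_⟩
  by_cases hta : ‖t - c0‖ ≤ a
  · have hi : idx t = 0 := by simp [idx, hta]
    rw [hi]
    refine ⟨hta, by simp [idx, c, ha], ?_, ?_, ?_⟩
    · intro l hl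
      obtain rfl : l = 0 := by omega
      exact hc0
    · intro l hl k hk; omega
    · intro l hl u hu
      obtain rfl : l = 0 := by omega
      refine (gw_mono (ballPart_mono ?_ u δ)).trans (hmax u (mem_piece.1 hu).1)
      exact fun x hx => (mem_piece.1 hx).1
  · have hi : idx t = idx' t + 1 := by simp [idx, hta]
    obtain ⟨h1, h2, h3, h4, h5⟩ := h t (hmem t ht hta)
    have hfar : ∀ l ≤ idx' t, a < ‖c' l - c0‖ := fun l hl =>
      not_le.1 (Finset.mem_filter.1 (h3 l hl)).2
    rw [hi]
    have hpiece : piece A idx (idx' t + 1) ⊆ piece A' idx' (idx' t) := by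
      intro x hx
      rw [mem_piece] at hx ⊢
      by_cases hxa : ‖x - c0‖ ≤ a
      · have := hx.2
        simp [idx, hxa] at this
      · refine ⟨hmem x hx.1 hxa, ?_⟩
        have := hx.2
        simpa [idx, hxa] using this
    refine ⟨h1, ?_, ?_, ?_, ?_⟩
    · have : ¬ ‖c' (idx' t) - c0‖ ≤ a := not_le.2 (hfar _ le_rfl)
      simp [idx, c, this, h2]
    · intro l hl
      rcases l with _ | l
      · exact hc0
      · exact hA'.subset (h3 l (by omega))
    · intro l hl k hk hlk
      rcases l with _ | l <;> rcases k with _ | k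
      · exact absurd rfl hlk
      · have := hfar k (by omega)
        rw [norm_sub_rev] at this
        exact this
      · exact hfar l (by omega)
      · exact h4 l (by omega) k (by omega) (by omega)
    · intro l hl u hu
      have e1 : gw (ballPart (piece A idx (idx' t + 1)) u δ) ≤
          gw (ballPart (piece A' idx' (idx' t)) u δ) := gw_mono (ballPart_mono hpiece u δ)
      rcases l with _ | l
      · refine (gw_mono (ballPart_mono ?_ u δ)).trans (hmax u (mem_piece.1 hu).1)
        exact fun x hx => (mem_piece.1 hx).1
      · refine e1.trans ((h5 l (by omega) u (hpiece hu)).trans ?_)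
        exact gw_mono (ballPart_mono hA'.subset _ _)

/-- The largest Gaussian width of the part of `A` in a ball of radius `δ` centred in `A`. -/
noncomputable def localWidth (δ : ℝ) (A : Finset E) : ℝ :=
  open Classical in if h : A.Nonempty then A.sup' h (fun t => gw (ballPart A t δ)) else 0

lemma le_localWidth {δ : ℝ} {A : Finset E} {t : E} (ht : t ∈ A) :
    gw (ballPart A t δ) ≤ localWidth δ A := by
  have : A.Nonempty := ⟨t, ht⟩
  rw [localWidth, dif_pos this]
  exact Finset.le_sup' (fun t => gw (ballPart A t δ)) ht

lemma localWidth_le {δ m : ℝ} {A : Finset E} (hA : A.Nonempty)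
    (h : ∀ t ∈ A, gw (ballPart A t δ) ≤ m) : localWidth δ A ≤ m := by
  rw [localWidth, dif_pos hA]
  exact Finset.sup'_le _ _ h

lemma localWidth_nonneg (δ : ℝ) (A : Finset E) : 0 ≤ localWidth δ A := by
  by_cases h : A.Nonempty
  · obtain ⟨t, ht⟩ := h
    exact (gw_nonneg _).trans (le_localWidth ht)
  · simp [localWidth, h]

lemma localWidth_mono {δ : ℝ} {A B : Finset E} (h : A ⊆ B) : localWidth δ A ≤ localWidth δ B := by
  by_cases hA : A.Nonempty
  · exact localWidth_le hA fun t ht =>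
      (gw_mono (ballPart_mono h t δ)).trans (le_localWidth (h ht))
  · rw [localWidth, dif_neg hA]; exact localWidth_nonneg _ _

/-- The chaining potential. -/
noncomputable def potential (ρ : ℝ) (A : Finset E) : ℝ :=
  ∑ i ∈ Finset.range 8, localWidth (ρ / 2 ^ i) A

lemma potential_nonneg (ρ : ℝ) (A : Finset E) : 0 ≤ potential ρ A :=
  Finset.sum_nonneg fun _ _ => localWidth_nonneg _ _

lemma potential_le (ρ : ℝ) {A : Finset E} (hA : A.Nonempty) : potential ρ A ≤ 8 * gw A := by
  calc potential ρ A ≤ ∑ i ∈ Finset.range 8, gw A := Finset.sum_le_sum fun i _ =>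
        localWidth_le hA fun t _ => gw_mono (ballPart_subset _ _ _)
    _ = 8 * gw A := by simp

lemma potential_half_add_le {A B : Finset E} {a : E} {ρ d : ℝ} (haA : a ∈ A)
    (hA : ∀ x ∈ A, ‖x - a‖ ≤ ρ) (hBA : B ⊆ A) (hB : localWidth (ρ / 256) B + d ≤ gw A) :
    potential (ρ / 2) B + d ≤ potential ρ A := by
  unfold potential
  rw [Finset.sum_range_succ (fun i => localWidth (ρ / 2 / 2 ^ i) B) 7,
    Finset.sum_range_succ' (fun i => localWidth (ρ / 2 ^ i) A) 7]
  have h1 : ∑ i ∈ Finset.range 7, localWidth (ρ / 2 / 2 ^ i) B ≤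
      ∑ i ∈ Finset.range 7, localWidth (ρ / 2 ^ (i + 1)) A := by
    refine Finset.sum_le_sum fun i _ => ?_
    rw [show ρ / 2 / 2 ^ i = ρ / 2 ^ (i + 1) by rw [pow_succ]; field_simp]
    exact localWidth_mono hBA
  have h2 : gw A ≤ localWidth (ρ / 2 ^ 0) A := by
    rw [pow_zero, div_one]
    refine le_trans (gw_mono ?_) (le_localWidth haA)
    intro x hx
    exact mem_ballPart.2 ⟨hx, hA x hx⟩
  have h3 : ρ / 2 / 2 ^ 7 = ρ / 256 := by norm_num; ring
  rw [h3]
  linarith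

end Comparison

section Comparison

set_option linter.unusedSectionVars false

lemma sqrt_posLog_mul_le {x y : ℝ} :
    √(posLog (x * y)) ≤ √(posLog x) + √(posLog y) :=
  by
  refine (Real.sqrt_le_sqrt posLog_mul).trans (Real.sqrt_le_iff.2 ⟨by positivity, ?_⟩)
  nlinarith [Real.sq_sqrt (posLog_nonneg (x := x)), Real.sq_sqrt (posLog_nonneg (x := y)),
    mul_nonneg (Real.sqrt_nonneg (posLog x)) (Real.sqrt_nonneg (posLog y))]

lemma sqrt_posLog_le_self {x : ℝ} (hx : 0 ≤ x) : √(posLog x) ≤ x := by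
  apply Real.sqrt_le_iff.2 ⟨hx, ?_⟩
  rw [posLog, max_le_iff]
  refine ⟨by positivity, ?_⟩
  rcases hx.eq_or_lt with rfl | hx
  · simp
  · have := Real.log_le_sub_one_of_pos hx
    nlinarith [sq_nonneg (x - 1)]

lemma sum_weights_le (s : Finset ℕ) : ∑ i ∈ s, (1 / ((i + 1 : ℝ) * (i + 2))) ≤ 1 := by
  have h : ∀ n : ℕ, ∑ i ∈ Finset.range n, (1 / ((i + 1 : ℝ) * (i + 2))) = 1 - 1 / (n + 1) := by
    intro n
    induction n with
    | zero => simp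
    | succ n ih => rw [Finset.sum_range_succ, ih]; push_cast; field_simp; ring
  obtain ⟨n, hn⟩ := s.exists_nat_subset_range
  refine (Finset.sum_le_sum_of_subset_of_nonneg hn fun i _ _ => by positivity).trans ?_
  rw [h]
  have : 0 ≤ 1 / ((n : ℝ) + 1) := by positivity
  linarith

lemma weight_bound (i : ℕ) (hi : 3 ≤ i) :
    2 * √(posLog (4 * ((i + 1 : ℝ) * (i + 2)))) ≤ 4 * √(log (i + 1)) := by
  have h3 : (3:ℝ) ≤ i := by exact_mod_cast hi
  have h1 : posLog (4 * ((i + 1 : ℝ) * (i + 2))) ≤ 4 * log (i + 1) := by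
    rw [posLog, max_le_iff]
    have : 0 ≤ log ((i:ℝ) + 1) := log_nonneg (by linarith)
    refine ⟨by positivity, ?_⟩
    calc log (4 * ((i + 1 : ℝ) * (i + 2))) ≤ log ((i + 1 : ℝ) ^ 4) := by
          apply log_le_log (by positivity)
          nlinarith [mul_nonneg (sub_nonneg.2 h3) (sub_nonneg.2 h3), sq_nonneg ((i:ℝ) + 1),
            mul_nonneg (mul_nonneg (sub_nonneg.2 h3) (sub_nonneg.2 h3)) (sub_nonneg.2 h3),
            pow_nonneg (sub_nonneg.2 h3) 4]
      _ = _ := by rw [log_pow]; norm_num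
  have h2 := Real.sqrt_le_sqrt h1
  rw [Real.sqrt_mul (by norm_num), show √(4:ℝ) = 2 by
    rw [show (4:ℝ) = 2 ^ 2 by norm_num]; exact Real.sqrt_sq (by norm_num)] at h2
  linarith

lemma weight_bound' (i : ℕ) (hi : i < 3) :
    2 * √(posLog (4 * ((i + 1 : ℝ) * (i + 2)))) ≤ 4 := by
  have h2 : (i : ℝ) ≤ 2 := by exact_mod_cast (by omega : i ≤ 2)
  have h0 : (0:ℝ) ≤ i := by positivity
  have : √(posLog (4 * ((i + 1 : ℝ) * (i + 2)))) ≤ 2 := by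
    apply Real.sqrt_le_iff.2 ⟨by norm_num, ?_⟩
    rw [posLog, max_le_iff]
    refine ⟨by norm_num, ?_⟩
    rw [log_le_iff_le_exp (by positivity)]
    have h1 : (2.7:ℝ) ^ 4 ≤ exp (2 ^ 2) := by
      have := Real.exp_one_gt_d9
      rw [show (2:ℝ) ^ 2 = (4:ℕ) * 1 by norm_num, Real.exp_nat_mul]
      gcongr
      linarith
    refine le_trans ?_ h1
    nlinarith
  linarith

variable {E : Type*} [NormedAddCommGroup E] [InnerProductSpace ℝ E] [FiniteDimensional ℝ E]
  [MeasurableSpace E] [BorelSpace E]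

/-- A random vector whose linear functionals are subgaussian. -/
def SubgaussianVec {Ω : Type*} [MeasurableSpace Ω] (μ : Measure Ω) (X : Ω → E) : Prop :=
  ∀ (y : E) (ρ : ℝ), 0 < ρ → ‖y‖ ≤ ρ → ∫⁻ w, ENNReal.ofReal (exp (⟪X w, y⟫ ^ 2 / ρ ^ 2)) ∂μ ≤ 2

/-- Chaining along the greedy decomposition. -/
lemma exists_chaining_weight {Ω : Type*} [MeasurableSpace Ω] {μ : Measure Ω} {X : Ω → E}
    (hXm : Measurable X) (hX : SubgaussianVec μ X) (d : ℕ) :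
    ∀ (ρ : ℝ) (_ : 0 < ρ) (A : Finset E) (a : E) (_ : a ∈ A) (_ : ∀ x ∈ A, ‖x - a‖ ≤ ρ)
      (_ : ∀ x ∈ A, ∀ y ∈ A, x ≠ y → ρ / 2 ^ d < ‖x - y‖),
      ∃ Q : Ω → ℝ, Measurable Q ∧ (∀ w, 0 ≤ Q w) ∧ ∫⁻ w, ENNReal.ofReal (Q w) ∂μ ≤ 1 ∧
        ∀ w, ∀ t ∈ A, ⟪X w, t - a⟫ ≤ 256 * potential ρ A + 2 * ρ * √(posLog (Q w)) + 8 * ρ := by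
  induction d with
  | zero =>
    intro ρ hρ A a haA hA hsep
    refine ⟨fun _ => 0, measurable_const, fun _ => le_rfl, by simp, fun w t ht => ?_⟩
    have hta : t = a := by
      by_contra h
      have h1 := hsep t ht a haA h
      have h2 := hA t ht
      norm_num at h1
      linarith
    have := potential_nonneg ρ A
    simp only [hta, sub_self, inner_zero_right]
    positivity
  | succ d ih =>
    intro ρ hρ A a haA hA hsep
    obtain ⟨c, idx, hg⟩ := exists_greedy (ρ / 2) (ρ / 256) (by positivity) A
    classical
    let I := A.image idx
    have hpieces : ∀ i ∈ I, ∃ Q : Ω → ℝ, Measurable Q ∧ (∀ w, 0 ≤ Q w) ∧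
        ∫⁻ w, ENNReal.ofReal (Q w) ∂μ ≤ 1 ∧ ∀ w, ∀ t ∈ piece A idx i, ⟪X w, t - c i⟫ ≤
          256 * potential (ρ / 2) (piece A idx i) + 2 * (ρ / 2) * √(posLog (Q w)) + 8 * (ρ / 2) := by
      intro i hi
      obtain ⟨t, ht, rfl⟩ := Finset.mem_image.1 hi
      obtain ⟨h1, h2, h3, h4, h5⟩ := hg t ht
      refine ih (ρ / 2) (by positivity) _ (c (idx t)) (mem_piece.2 ⟨h3 _ le_rfl, h2⟩) ?_ ?_
      · intro x hx
        rw [mem_piece] at hx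
        have := (hg x hx.1).1
        rwa [hx.2] at this
      · intro x hx y hy hxy
        have := hsep x (mem_piece.1 hx).1 y (mem_piece.1 hy).1 hxy
        rwa [pow_succ, mul_comm, ← div_div] at this
    choose! q hqm hq0 hq1 hq using hpieces
    let u : ℕ → ℝ := fun i => 1 / ((i + 1 : ℝ) * (i + 2))
    have hu : ∀ i, 0 < u i := fun i => by positivity
    let Dx : ℕ → Ω → ℝ := fun i w => exp (⟪X w, c i - a⟫ ^ 2 / ρ ^ 2)
    have hDm : ∀ i, Measurable (Dx i) := fun i => by fun_prop
    have hciA : ∀ i ∈ I, c i ∈ A := by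
      intro i hi
      obtain ⟨t, ht, rfl⟩ := Finset.mem_image.1 hi
      exact (hg t ht).2.2.1 _ le_rfl
    let R : ℕ → Ω → ℝ := fun i w => u i * (1 / 2 * q i w + 1 / 4 * Dx i w)
    have hRm : ∀ i ∈ I, Measurable (R i) := fun i hi => by
      have := hqm i hi
      fun_prop
    have hR0 : ∀ i ∈ I, ∀ w, 0 ≤ R i w := fun i hi w => by
      have h1 := hq0 i hi w
      have h2 := hu i
      have h3 : 0 < Dx i w := exp_pos _
      positivity
    refine ⟨fun w => ∑ i ∈ I, R i w, Finset.measurable_sum _ hRm,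
      fun w => Finset.sum_nonneg fun i hi => hR0 i hi w, ?_, ?_⟩
    · have hone : ∀ i ∈ I, ∫⁻ w, ENNReal.ofReal (R i w) ∂μ ≤ ENNReal.ofReal (u i) := by
        intro i hi
        have hqmi := hqm i hi
        have hDmi := hDm i
        have e : ∀ w, ENNReal.ofReal (R i w) = ENNReal.ofReal (u i) *
            (ENNReal.ofReal (1 / 2) * ENNReal.ofReal (q i w) +
              ENNReal.ofReal (1 / 4) * ENNReal.ofReal (Dx i w)) := by
          intro w
          have h3 : 0 < Dx i w := exp_pos _
          have h1 := hq0 i hi w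
          rw [← ENNReal.ofReal_mul (by norm_num), ← ENNReal.ofReal_mul (by norm_num),
            ← ENNReal.ofReal_add (by positivity) (by positivity), ← ENNReal.ofReal_mul (hu i).le]
        simp_rw [e]
        rw [lintegral_const_mul _ (by fun_prop), lintegral_add_left (by fun_prop),
          lintegral_const_mul _ (by fun_prop), lintegral_const_mul _ (by fun_prop)]
        have hD2 := hX (c i - a) ρ hρ (hA _ (hciA i hi))
        refine mul_le_of_le_one_right zero_le ?_
        calc _ ≤ ENNReal.ofReal (1 / 2) * 1 + ENNReal.ofReal (1 / 4) * 2 := by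
              gcongr
              exact hq1 i hi
          _ = 1 := by
              rw [show (2 : ℝ≥0∞) = ENNReal.ofReal 2 by norm_num, mul_one,
                ← ENNReal.ofReal_mul (by norm_num), ← ENNReal.ofReal_add (by norm_num) (by norm_num)]
              norm_num
      calc ∫⁻ w, ENNReal.ofReal (∑ i ∈ I, R i w) ∂μ
          = ∫⁻ w, ∑ i ∈ I, ENNReal.ofReal (R i w) ∂μ := by
            congr 1; ext w
            rw [ENNReal.ofReal_sum_of_nonneg fun i hi => hR0 i hi w]
        _ = ∑ i ∈ I, ∫⁻ w, ENNReal.ofReal (R i w) ∂μ := by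
            rw [lintegral_finsetSum']
            intro i hi
            have := hRm i hi
            fun_prop
        _ ≤ ∑ i ∈ I, ENNReal.ofReal (u i) := Finset.sum_le_sum hone
        _ = ENNReal.ofReal (∑ i ∈ I, u i) := by
            rw [ENNReal.ofReal_sum_of_nonneg fun i hi => (hu i).le]
        _ ≤ 1 := ENNReal.ofReal_le_one.2 (sum_weights_le I)
    · intro w t ht
      obtain ⟨h1, h2, h3, h4, h5⟩ := hg t ht
      set i := idx t with hidef
      have hi : i ∈ I := Finset.mem_image.2 ⟨t, ht, rfl⟩
      set Q := ∑ i ∈ I, R i w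
      have hRQ : R i w ≤ Q :=
        Finset.single_le_sum (f := fun i => R i w) (fun i hi => hR0 i hi w) hi
      have hQ0 : 0 ≤ Q := (hR0 i hi w).trans hRQ
      have hDpos : 0 < Dx i w := exp_pos _
      have hqpos := hq0 i hi w
      set W : ℝ := 4 * ((i + 1 : ℝ) * (i + 2))
      have hW : 0 < W := by positivity
      have hR : R i w * W = 2 * q i w + Dx i w := by
        simp only [R, u, W]; field_simp; ring
      have hRQ' := mul_le_mul_of_nonneg_right hRQ hW.le
      have hq1 : √(posLog (q i w)) ≤ √(posLog Q) + √(posLog W) := by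
        refine le_trans (Real.sqrt_le_sqrt ?_) sqrt_posLog_mul_le
        exact posLog_le_posLog hqpos (by linarith)
      have hD1 : √(posLog (Dx i w)) ≤ √(posLog Q) + √(posLog W) := by
        refine le_trans (Real.sqrt_le_sqrt ?_) sqrt_posLog_mul_le
        exact posLog_le_posLog hDpos.le (by linarith)
      have hD2 : ⟪X w, c i - a⟫ ≤ ρ * √(posLog (Dx i w)) := by
        have : posLog (Dx i w) = (⟪X w, c i - a⟫ / ρ) ^ 2 := by
          simp only [posLog, Dx, Real.log_exp]
          rw [max_eq_right (by positivity), div_pow]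
        rw [this, Real.sqrt_sq_eq_abs, abs_div, abs_of_pos hρ, mul_div_cancel₀ _ hρ.ne']
        exact le_abs_self _
      have hstep := hq i hi w t (mem_piece.2 ⟨ht, rfl⟩)
      have hsplit : ⟪X w, t - a⟫ = ⟪X w, c i - a⟫ + ⟪X w, t - c i⟫ := by
        rw [← inner_add_right]; congr 1; abel
      have hpA : piece A idx i ⊆ A := fun x hx => (mem_piece.1 hx).1
      have hpne : (piece A idx i).Nonempty := ⟨t, mem_piece.2 ⟨ht, rfl⟩⟩
      have hcore : 2 * √(posLog W) * ρ + 256 * potential (ρ / 2) (piece A idx i) ≤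
          256 * potential ρ A + 4 * ρ := by
        by_cases hi3 : 3 ≤ i
        · have hgr : ∀ x ∈ piece A idx i, ρ * √(log ((i + 1 : ℕ) : ℝ)) / 64 +
              gw (ballPart (piece A idx i) x (ρ / 256)) ≤ gw A := by
            intro x hx
            refine growth (N := i + 1) (by omega) (c := c) (a0 := a) hρ ?_ ?_ ?_ ?_
            · intro l hl; exact h3 l (by omega)
            · intro l hl; exact hA _ (h3 l (by omega))
            · intro l hl k hk hlk; exact h4 l (by omega) k (by omega) hlk
            · intro l hl; exact h5 l (by omega) x hx
          have h6 : localWidth (ρ / 256) (piece A idx i) + ρ * √(log ((i + 1 : ℕ) : ℝ)) / 64 ≤ gw A := by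
            have := localWidth_le (δ := ρ / 256) (m := gw A - ρ * √(log ((i + 1 : ℕ) : ℝ)) / 64) hpne
              (fun x hx => by have := hgr x hx; linarith)
            linarith
          have h7 := potential_half_add_le haA hA hpA h6
          have h8 := mul_le_mul_of_nonneg_right (weight_bound i hi3) hρ.le
          push_cast at h7
          linarith
        · have h6 : localWidth (ρ / 256) (piece A idx i) + 0 ≤ gw A := by
            rw [add_zero]
            exact localWidth_le hpne fun x hx => gw_mono ((ballPart_subset _ _ _).trans hpA)
          have h7 := potential_half_add_le haA hA hpA h6
          have h8 := mul_le_mul_of_nonneg_right (weight_bound' i (by omega)) hρ.le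
          linarith
      have h9 := mul_le_mul_of_nonneg_left hq1 hρ.le
      have h10 := mul_le_mul_of_nonneg_left hD1 hρ.le
      rw [hsplit]
      linarith

lemma norm_le_integral_abs_inner (y : E) : ‖y‖ ≤ 3 * ∫ x, |⟪x, y⟫| ∂(stdGaussian E) := by
  by_cases hy : y = 0
  · simp [hy]
  have hy' : 0 < ‖y‖ := norm_pos_iff.2 hy
  set v := ‖y‖⁻¹ • y
  have hv : ‖v‖ = 1 := by simp [v, norm_smul, hy'.ne']
  have h1 : ∫ x, |⟪x, y⟫| ∂(stdGaussian E) = ‖y‖ * ∫ x, |⟪x, v⟫| ∂(stdGaussian E) := by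
    rw [← integral_const_mul]
    congr 1; ext x
    simp only [v, inner_smul_right, abs_mul, abs_inv, abs_norm]
    field_simp
  have hcos : ∫ x, cos ⟪x, v⟫ ∂(stdGaussian E) = exp (-1 / 2) := by
    have h := charFun_stdGaussian v
    rw [charFun_apply] at h
    have h2 := congrArg Complex.re h
    rw [hv] at h2
    have h_int : Integrable (fun x : E => Complex.exp (⟪x, v⟫ * Complex.I)) (stdGaussian E) := by
      refine Integrable.of_bound (by fun_prop) 1 (Filter.Eventually.of_forall fun x => ?_)
      rw [Complex.norm_exp_ofReal_mul_I]
    have h3 := integral_re h_int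
    simp only [RCLike.re_to_complex, Complex.exp_ofReal_mul_I_re] at h3
    rw [h3, h2]
    rw [← Complex.exp_ofReal_re]
    push_cast
    norm_num
  have hle : 1 - exp (-1 / 2) ≤ ∫ x, |⟪x, v⟫| ∂(stdGaussian E) := by
    have hi : Integrable (fun x : E => cos ⟪x, v⟫) (stdGaussian E) :=
      Integrable.of_bound (by fun_prop) 1 (Filter.Eventually.of_forall fun x => by
        rw [Real.norm_eq_abs]; exact abs_cos_le_one _)
    have h := integral_mono ((integrable_const (1:ℝ)).sub hi) (integrable_inner_stdGaussian v).abs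
      (fun x => by
        simp only [Pi.sub_apply]
        have h1 := Real.cos_sq_add_sin_sq (⟪x, v⟫ / 2)
        have h2 := Real.cos_two_mul (⟪x, v⟫ / 2)
        rw [mul_div_cancel₀ _ (two_ne_zero)] at h2
        have h3 : |sin (⟪x, v⟫ / 2)| ≤ |⟪x, v⟫ / 2| := abs_sin_le_abs
        have h4 := abs_sin_le_one (⟪x, v⟫ / 2)
        have h5 := sq_abs (sin (⟪x, v⟫ / 2))
        rw [abs_div, abs_two] at h3
        nlinarith [abs_nonneg (sin (⟪x, v⟫ / 2))])
    rw [integral_sub' (integrable_const (1:ℝ)) hi, hcos] at h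
    simpa using h
  have he : exp (-1 / 2) ≤ 2 / 3 := by
    rw [show (-1 / 2 : ℝ) = -(1 / 2) by norm_num, exp_neg]
    have := Real.add_one_le_exp (1 / 2)
    rw [inv_le_comm₀ (exp_pos _) (by norm_num)]
    norm_num at this ⊢
    linarith
  rw [h1]
  nlinarith

lemma norm_sub_le_gw {A : Finset E} {a b : E} (ha : a ∈ A) (hb : b ∈ A) : ‖b - a‖ ≤ 6 * gw A := by
  have hA : A.Nonempty := ⟨a, ha⟩
  have h1 := norm_le_integral_abs_inner (b - a)
  have h2 : ∫ x, |⟪x, b - a⟫| ∂(stdGaussian E) ≤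
      ∫ x, (2 * supp A hA id x - ⟪x, a + b⟫) ∂(stdGaussian E) := by
    refine integral_mono (integrable_inner_stdGaussian _).abs
      (((integrable_supp hA).const_mul 2).sub (integrable_inner_stdGaussian _)) fun x => ?_
    have e1 : ⟪x, a⟫ ≤ supp A hA id x := Finset.le_sup' (fun t => ⟪x, t⟫) ha
    have e2 : ⟪x, b⟫ ≤ supp A hA id x := Finset.le_sup' (fun t => ⟪x, t⟫) hb
    simp only [inner_sub_right, inner_add_right]
    rw [abs_le]
    constructor <;> linarith
  rw [integral_sub ((integrable_supp hA).const_mul 2) (integrable_inner_stdGaussian _),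
    integral_const_mul, ← gw_eq, integral_inner_stdGaussian] at h2
  linarith

/-- Majorizing-measure type comparison of a subgaussian process with a Gaussian one. -/
theorem lintegral_supp_le_gw {Ω : Type*} [MeasurableSpace Ω] {μ : Measure Ω} [IsProbabilityMeasure μ]
    {X : Ω → E} (hXm : Measurable X) (hX : SubgaussianVec μ X) {A : Finset E} (h0 : (0:E) ∈ A) :
    ∫⁻ w, ENNReal.ofReal (supp A ⟨0, h0⟩ id (X w)) ∂μ ≤ ENNReal.ofReal (2200 * gw A) := by
  obtain ⟨b, hb, hbmax⟩ := A.exists_max_image (fun t => ‖t‖) ⟨0, h0⟩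
  rcases (norm_nonneg b).eq_or_lt with hb0 | hρ
  · have : ∀ x, supp A ⟨0, h0⟩ id x ≤ 0 := by
      intro x
      apply Finset.sup'_le
      intro t ht
      have : ‖t‖ ≤ 0 := hb0 ▸ hbmax t ht
      have : t = 0 := norm_le_zero_iff.1 this
      simp [this]
    simp [ENNReal.ofReal_of_nonpos (this _)]
  set ρ := ‖b‖
  obtain ⟨d, hd⟩ : ∃ d : ℕ, ∀ x ∈ A, ∀ y ∈ A, x ≠ y → ρ / 2 ^ d < ‖x - y‖ := by
    have hev : ∀ᶠ d : ℕ in Filter.atTop, ∀ x ∈ A, ∀ y ∈ A, x ≠ y → ρ / 2 ^ d < ‖x - y‖ := by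
      rw [Filter.eventually_all_finset]
      intro x hx
      rw [Filter.eventually_all_finset]
      intro y hy
      by_cases hxy : x = y
      · simp [hxy]
      have ht : Filter.Tendsto (fun d : ℕ => ρ / 2 ^ d) Filter.atTop (nhds 0) := by
        have := (tendsto_pow_atTop_nhds_zero_of_lt_one (r := (1/2:ℝ)) (by norm_num) (by norm_num)).const_mul ρ
        simpa [div_eq_mul_inv] using this
      have hp : 0 < ‖x - y‖ := norm_pos_iff.2 (sub_ne_zero.2 hxy)
      filter_upwards [ht.eventually_lt_const hp] with d hd _
      exact hd
    exact hev.exists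
  obtain ⟨Q, hQm, hQ0, hQ1, hQ⟩ := exists_chaining_weight hXm hX d ρ hρ A 0 h0
    (fun x hx => by simpa using hbmax x hx) hd
  have hpot := potential_le ρ (A := A) ⟨0, h0⟩
  have hρ6 : ρ ≤ 6 * gw A := by simpa using norm_sub_le_gw h0 hb
  have hg := gw_nonneg A
  have hpt : ∀ w, supp A ⟨0, h0⟩ id (X w) ≤ 2 * ρ * Q w + (2048 * gw A + 8 * ρ) := by
    intro w
    apply Finset.sup'_le
    intro t ht
    have h1 := hQ w t ht
    rw [sub_zero] at h1
    have h2 := mul_le_mul_of_nonneg_left (sqrt_posLog_le_self (hQ0 w)) (by positivity : 0 ≤ 2 * ρ)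
    simp only [id]
    linarith
  calc ∫⁻ w, ENNReal.ofReal (supp A ⟨0, h0⟩ id (X w)) ∂μ
      ≤ ∫⁻ w, (ENNReal.ofReal (2 * ρ) * ENNReal.ofReal (Q w) + ENNReal.ofReal (2048 * gw A + 8 * ρ)) ∂μ := by
        refine lintegral_mono fun w => ?_
        have hw := hpt w
        show ENNReal.ofReal _ ≤ ENNReal.ofReal (2 * ρ) * ENNReal.ofReal (Q w) +
          ENNReal.ofReal (2048 * gw A + 8 * ρ)
        rw [← ENNReal.ofReal_mul (by positivity), ← ENNReal.ofReal_add
          (mul_nonneg (by positivity) (hQ0 w)) (by positivity)]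
        exact ENNReal.ofReal_le_ofReal (hpt w)
    _ = ENNReal.ofReal (2 * ρ) * ∫⁻ w, ENNReal.ofReal (Q w) ∂μ + ENNReal.ofReal (2048 * gw A + 8 * ρ) := by
        rw [lintegral_add_right _ measurable_const, lintegral_const_mul _ (by fun_prop)]
        simp
    _ ≤ ENNReal.ofReal (2 * ρ) * 1 + ENNReal.ofReal (2048 * gw A + 8 * ρ) := by gcongr
    _ ≤ ENNReal.ofReal (2200 * gw A) := by
        rw [mul_one, ← ENNReal.ofReal_add (by positivity) (by positivity)]
        apply ENNReal.ofReal_le_ofReal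
        linarith

end Comparison

section LogConcave

set_option linter.unusedSectionVars false

/-- Log-concavity of a measure. -/
def IsLogConcaveMeasure {V : Type*} [AddCommGroup V] [Module ℝ V] [MeasurableSpace V]
    (η : Measure V) : Prop :=
  ∀ a b : ℝ, 0 < a → 0 < b → a + b = 1 → ∀ A B D : Set V, MeasurableSet A → MeasurableSet B →
    MeasurableSet D → (∀ x ∈ A, ∀ y ∈ B, a • x + b • y ∈ D) → η A ^ a * η B ^ b ≤ η D

lemma PrekopaLeindler.isLogConcaveMeasure {V : Type*} [AddCommGroup V] [Module ℝ V]
    [MeasurableSpace V] {μ : Measure V} (hμ : PrekopaLeindler μ) {w : V → ℝ≥0∞} (hw : Measurable w)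
    (hlc : ∀ a b : ℝ, 0 < a → 0 < b → a + b = 1 → ∀ x y, w x ^ a * w y ^ b ≤ w (a • x + b • y)) :
    IsLogConcaveMeasure (μ.withDensity w) := by
  intro a b ha hb hab A B D hA hB hD h
  rw [withDensity_apply _ hA, withDensity_apply _ hB, withDensity_apply _ hD,
    ← lintegral_indicator hA, ← lintegral_indicator hB, ← lintegral_indicator hD]
  refine hμ a b ha hb hab _ _ _ (hw.indicator hA) (hw.indicator hB) (hw.indicator hD) ?_
  intro x y
  by_cases hx : x ∈ A
  · by_cases hy : y ∈ B
    · simpa [hx, hy, h x hx y hy] using hlc a b ha hb hab x y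
    · simp [hy, ENNReal.zero_rpow_of_pos hb]
  · simp [hx, ENNReal.zero_rpow_of_pos ha]

lemma IsLogConcaveMeasure.map {V W : Type*} [AddCommGroup V] [Module ℝ V] [MeasurableSpace V]
    [AddCommGroup W] [Module ℝ W] [MeasurableSpace W] {η : Measure V} (hη : IsLogConcaveMeasure η)
    (T : V →ₗ[ℝ] W) (hT : Measurable T) : IsLogConcaveMeasure (η.map T) := by
  intro a b ha hb hab A B D hA hB hD h
  rw [Measure.map_apply hT hA, Measure.map_apply hT hB, Measure.map_apply hT hD]
  refine hη a b ha hb hab _ _ _ (hT hA) (hT hB) (hT hD) fun x hx y hy => ?_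
  simp only [Set.mem_preimage, map_add, map_smul]
  exact h _ hx _ hy

variable {F : Type*} [NormedAddCommGroup F] [InnerProductSpace ℝ F] [FiniteDimensional ℝ F]
  [MeasurableSpace F] [BorelSpace F]

lemma measurable_measure_closedBall (η : Measure F) [SFinite η] (δ : ℝ) :
    Measurable fun z => η (Metric.closedBall z δ) := by
  have : MeasurableSet {p : F × F | dist p.2 p.1 ≤ δ} :=
    measurableSet_le (by fun_prop) measurable_const
  exact measurable_measure_prodMk_left this

lemma lintegral_measure_closedBall_mul (η : Measure F) [SFinite η] (δ : ℝ) {φ : F → ℝ≥0∞}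
    (hφ : Measurable φ) :
    ∫⁻ z, η (Metric.closedBall z δ) * φ z = ∫⁻ w, (∫⁻ z in Metric.closedBall w δ, φ z) ∂η := by
  have hm : MeasurableSet {p : F × F | dist p.2 p.1 ≤ δ} :=
    measurableSet_le (by fun_prop) measurable_const
  have h1 : ∀ z, η (Metric.closedBall z δ) * φ z =
      ∫⁻ w, {p : F × F | dist p.2 p.1 ≤ δ}.indicator (fun p => φ p.1) (z, w) ∂η := by
    intro z
    rw [mul_comm, ← lintegral_indicator_const Metric.isClosed_closedBall.measurableSet]
    rfl
  have h2 : ∀ w, ∫⁻ z in Metric.closedBall w δ, φ z =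
      ∫⁻ z, {p : F × F | dist p.2 p.1 ≤ δ}.indicator (fun p => φ p.1) (z, w) := by
    intro w
    rw [← lintegral_indicator Metric.isClosed_closedBall.measurableSet]
    refine lintegral_congr fun z => ?_
    simp [Set.indicator, dist_comm]
  simp_rw [h1, h2]
  exact lintegral_lintegral_swap ((hφ.comp measurable_fst).indicator hm).aemeasurable

/-- A symmetric log-concave measure in `m` dimensions having at least half of its mass in the ball
of radius `δ` has a direction in which it is exponentially concentrated at scale `δ / m`. -/
theorem exists_direction_exp_le {η : Measure F} (hη : IsLogConcaveMeasure η)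
    (hsymm : ∀ A, η (-A) = η A) (h1 : η Set.univ ≤ 1) (hm : 0 < Module.finrank ℝ F) {δ : ℝ}
    (hδ : 0 < δ) (hhalf : ENNReal.ofReal (1 / 2) ≤ η (Metric.closedBall 0 δ)) :
    ∃ θ : F, ‖θ‖ = 1 ∧ ∫⁻ z, ENNReal.ofReal (exp (Module.finrank ℝ F / (32 * δ) * |⟪z, θ⟫|)) ∂η ≤
      ENNReal.ofReal (exp (4 * Module.finrank ℝ F)) := by
  have hfin : IsFiniteMeasure η := ⟨h1.trans_lt ENNReal.one_lt_top⟩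
  set m : ℕ := Module.finrank ℝ F with hmdef
  have hm1 : (1:ℝ) ≤ m := by exact_mod_cast hm
  set g : F → ℝ := fun z => η.real (Metric.closedBall z δ) with hg
  have hg0 : ∀ z, 0 ≤ g z := fun z => measureReal_nonneg
  have hg1 : ∀ z, g z ≤ 1 := fun z => by
    have h := (measure_mono (Set.subset_univ (Metric.closedBall z δ))).trans h1
    exact ENNReal.toReal_le_of_le_ofReal zero_le_one (by simpa using h)
  have hgof : ∀ z, η (Metric.closedBall z δ) = ENNReal.ofReal (g z) := fun z =>
    (ofReal_measureReal (measure_ne_top _ _)).symm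
  have hgm : Measurable g := (measurable_measure_closedBall η δ).ennreal_toReal
  have hghalf : 1 / 2 ≤ g 0 := by
    rw [hgof] at hhalf
    exact (ENNReal.ofReal_le_ofReal_iff (hg0 0)).1 hhalf
  have hgneg : ∀ z, g (-z) = g z := by
    intro z
    simp only [hg, measureReal_def]
    rw [← hsymm (Metric.closedBall z δ)]
    congr 2
    ext x
    simp only [Metric.mem_closedBall, Set.mem_neg, dist_eq_norm]
    rw [← norm_neg (x - -z)]
    congr! 2
    abel
  have hlc : ∀ a b : ℝ, 0 < a → 0 < b → a + b = 1 → ∀ x y,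
      g x ^ a * g y ^ b ≤ g (a • x + b • y) := by
    intro a b ha hb hab x y
    have h := hη a b ha hb hab (Metric.closedBall x δ) (Metric.closedBall y δ)
      (Metric.closedBall (a • x + b • y) δ) Metric.isClosed_closedBall.measurableSet
      Metric.isClosed_closedBall.measurableSet Metric.isClosed_closedBall.measurableSet ?_
    · rw [hgof, hgof, hgof, ENNReal.ofReal_rpow_of_nonneg (hg0 _) ha.le,
        ENNReal.ofReal_rpow_of_nonneg (hg0 _) hb.le, ← ENNReal.ofReal_mul (by
          have := hg0 x; positivity)] at h
      exact (ENNReal.ofReal_le_ofReal_iff (hg0 _)).1 h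
    · intro x' hx' y' hy'
      rw [mem_closedBall_iff_norm] at *
      calc ‖a • x' + b • y' - (a • x + b • y)‖ = ‖a • (x' - x) + b • (y' - y)‖ := by
            congr 1; module
        _ ≤ ‖a • (x' - x)‖ + ‖b • (y' - y)‖ := norm_add_le _ _
        _ = a * ‖x' - x‖ + b * ‖y' - y‖ := by
            rw [norm_smul, norm_smul, Real.norm_of_nonneg ha.le, Real.norm_of_nonneg hb.le]
        _ ≤ a * δ + b * δ := by gcongr
        _ = δ := by rw [← add_mul, hab, one_mul]
  set V : Set F := {z | exp (-2 * m) * g 0 ≤ g z} with hV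
  have hc : 0 < exp (-2 * m) * g 0 := by positivity
  have hVconv : Convex ℝ V := by
    rw [convex_iff_forall_pos]
    intro x hx y hy a b ha hb hab
    simp only [hV, Set.mem_ofPred_eq] at *
    refine le_trans ?_ (hlc a b ha hb hab x y)
    calc exp (-2 * m) * g 0 = (exp (-2 * m) * g 0) ^ a * (exp (-2 * m) * g 0) ^ b := by
          rw [← Real.rpow_add hc, hab, Real.rpow_one]
      _ ≤ _ := by gcongr
  have hVneg : ∀ z ∈ V, -z ∈ V := fun z hz => by
    simp only [hV, Set.mem_ofPred_eq, hgneg] at *; exact hz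
  have hVvol : ENNReal.ofReal (exp (-2 * m) * g 0) * volume V ≤
      volume (Metric.closedBall (0:F) δ) := by
    calc ENNReal.ofReal (exp (-2 * m) * g 0) * volume V
        ≤ ENNReal.ofReal (exp (-2 * m) * g 0) *
          volume {z | ENNReal.ofReal (exp (-2 * m) * g 0) ≤ η (Metric.closedBall z δ)} := by
          gcongr
          intro z hz
          rw [Set.mem_ofPred_eq, hgof]
          exact ENNReal.ofReal_le_ofReal hz
      _ ≤ ∫⁻ z, η (Metric.closedBall z δ) :=
          mul_meas_ge_le_lintegral (measurable_measure_closedBall η δ) _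
      _ = ∫⁻ w, volume (Metric.closedBall w δ) ∂η := by
          have := lintegral_measure_closedBall_mul η δ (φ := fun _ => 1) measurable_const
          simpa using this
      _ = volume (Metric.closedBall (0:F) δ) * η Set.univ := by
          simp_rw [Measure.addHaar_closedBall_center]
          rw [lintegral_const]
      _ ≤ _ := by simpa using mul_le_mul_right h1 (volume (Metric.closedBall (0:F) δ))
  have hBpos : 0 < volume (Metric.closedBall (0:F) δ) := Metric.measure_closedBall_pos _ _ hδ
  have hBfin : volume (Metric.closedBall (0:F) δ) ≠ ∞ := measure_closedBall_lt_top.ne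
  obtain ⟨z0, hz0, hz0V⟩ : ∃ z0 ∈ Metric.closedBall (0:F) (32 * δ), z0 ∉ closure V := by
    by_contra! hcon
    have hsub : Metric.closedBall (0:F) (32 * δ) ⊆ closure V := hcon
    have hcl : volume (closure V) = volume V := by
      refine le_antisymm ?_ (measure_mono subset_closure)
      calc volume (closure V) ≤ volume (V ∪ frontier V) := by
            apply measure_mono
            rw [closure_eq_self_union_frontier]
        _ ≤ volume V + volume (frontier V) := measure_union_le _ _
        _ = volume V := by rw [hVconv.addHaar_frontier volume, add_zero]
    have h3 := (mul_le_mul_right ((measure_mono hsub).trans_eq hcl)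
      (ENNReal.ofReal (exp (-2 * m) * g 0))).trans hVvol
    rw [Measure.addHaar_closedBall_mul _ _ (by norm_num : (0:ℝ) ≤ 32) hδ.le, ← mul_assoc,
      ← hmdef, ← ENNReal.ofReal_mul hc.le] at h3
    have h4 : ENNReal.ofReal (exp (-2 * m) * g 0 * 32 ^ m) ≤ 1 := by
      by_contra! hlt
      have := ENNReal.mul_lt_mul_left hBpos.ne' hBfin hlt
      rw [one_mul] at this
      exact absurd h3 (not_le.2 this)
    rw [ENNReal.ofReal_le_one] at h4
    have h5 : 1 < exp (-2 * m) * g 0 * 32 ^ m := by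
      have he : exp 2 ≤ 8 := by
        have := Real.exp_one_lt_d9
        rw [show (2:ℝ) = 1 + 1 by norm_num, Real.exp_add]
        nlinarith [Real.exp_pos 1]
      have h6 : exp (-2 * m) * 32 ^ m = (exp (-2) * 32) ^ m := by
        rw [mul_pow, ← Real.exp_nat_mul]; ring_nf
      have h7 : 4 ≤ exp (-2) * 32 := by
        rw [Real.exp_neg]
        rw [inv_mul_eq_div, le_div_iff₀ (exp_pos _)]
        linarith
      have h8 : (4:ℝ) ≤ (exp (-2) * 32) ^ m :=
        h7.trans (le_self_pow₀ (by linarith) hm.ne')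
      calc (1:ℝ) < 4 * (1 / 2) := by norm_num
        _ ≤ (exp (-2) * 32) ^ m * g 0 := by gcongr
        _ = _ := by rw [← h6]; ring
    linarith
  obtain ⟨f, u, hfu, huz⟩ := geometric_hahn_banach_closed_point hVconv.closure isClosed_closure hz0V
  set v : F := (InnerProductSpace.toDual ℝ F).symm f with hv
  have hfv : ∀ z, f z = ⟪z, v⟫ := fun z => by
    rw [real_inner_comm, hv, InnerProductSpace.toDual_symm_apply]
  have h0V : (0:F) ∈ V := by
    simp only [hV, Set.mem_ofPred_eq]
    have : exp (-2 * m) ≤ 1 := by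
      rw [Real.exp_le_one_iff]; linarith
    nlinarith
  have hu0 : 0 < u := by simpa using hfu 0 (subset_closure h0V)
  have hv0 : v ≠ 0 := by
    intro h
    rw [hfv, h, inner_zero_right] at huz
    linarith
  have hvn : 0 < ‖v‖ := norm_pos_iff.2 hv0
  set θ : F := ‖v‖⁻¹ • v with hθ
  have hθ1 : ‖θ‖ = 1 := by rw [hθ, norm_smul, norm_inv, norm_norm, inv_mul_cancel₀ hvn.ne']
  have hVlt : ∀ z ∈ V, ⟪z, θ⟫ < 32 * δ := by
    intro z hz
    have h2 : ⟪z, v⟫ < ⟪z0, v⟫ := by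
      rw [← hfv, ← hfv]; exact (hfu z (subset_closure hz)).trans huz
    calc ⟪z, θ⟫ = ‖v‖⁻¹ * ⟪z, v⟫ := by rw [hθ, inner_smul_right]
      _ < ‖v‖⁻¹ * ⟪z0, v⟫ := by gcongr
      _ = ⟪z0, θ⟫ := by rw [hθ, inner_smul_right]
      _ ≤ ‖z0‖ * ‖θ‖ := real_inner_le_norm _ _
      _ ≤ 32 * δ := by rw [hθ1, mul_one]; simpa using hz0
  have hVabs : ∀ z ∈ V, |⟪z, θ⟫| < 32 * δ := by
    intro z hz
    rw [abs_lt]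
    have := hVlt _ (hVneg z hz)
    rw [inner_neg_left] at this
    exact ⟨by linarith, hVlt z hz⟩
  refine ⟨θ, hθ1, ?_⟩
  set τ : ℝ := m / (32 * δ) with hτ
  have hτ0 : 0 < τ := by positivity
  have hdecay : ∀ z, √(g z) ≤ exp (m - τ * |⟪z, θ⟫|) := by
    intro z
    set t : ℝ := |⟪z, θ⟫| / (32 * δ) with ht
    have htm : τ * |⟪z, θ⟫| = m * t := by rw [hτ, ht]; ring
    rw [htm]
    rcases le_or_gt t 1 with h | h
    · calc √(g z) ≤ 1 := Real.sqrt_le_one.2 (hg1 z)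
        _ ≤ _ := Real.one_le_exp (by nlinarith)
    · have ht0 : 0 < t := by linarith
      have hzt : (1 / t) • z ∉ V := by
        intro hz
        have := hVabs _ hz
        rw [inner_smul_left, abs_mul] at this
        simp only [conj_trivial] at this
        rw [abs_of_pos (by positivity)] at this
        have h2 : |⟪z, θ⟫| = 32 * δ * t := by rw [ht]; field_simp
        rw [h2] at this
        have h3 : 1 / t * (32 * δ * t) = 32 * δ := by field_simp
        linarith
      have h1t : 0 < 1 - 1 / t := by
        rw [sub_pos, div_lt_one ht0]; exact h
      have h2 := hlc (1 / t) (1 - 1 / t) (by positivity) h1t (by ring) z 0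
      rw [smul_zero, add_zero] at h2
      have h3 : g z ^ (1 / t) * g 0 ^ (1 - 1 / t) < exp (-2 * m) * g 0 :=
        h2.trans_lt (not_le.1 hzt)
      have hg00 : 0 < g 0 := by linarith
      have h4 : g z ^ (1 / t) ≤ exp (-2 * m) := by
        rw [Real.rpow_sub hg00, Real.rpow_one, ← mul_div_assoc,
          div_lt_iff₀ (by positivity)] at h3
        have h5 : g z ^ (1 / t) * g 0 ≤ exp (-2 * m) * g 0 ^ (1 / t) * g 0 := by nlinarith
        have h6 := le_of_mul_le_mul_right h5 hg00
        have h7 : g 0 ^ (1 / t) ≤ 1 := Real.rpow_le_one (hg0 _) (hg1 _) (by positivity)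
        nlinarith [exp_pos (-2 * (m:ℝ))]
      have h5 : g z ≤ exp (-2 * m * t) := by
        have := Real.rpow_le_rpow (by have := hg0 z; positivity) h4 ht0.le
        rw [← Real.rpow_mul (hg0 z), one_div_mul_cancel ht0.ne', Real.rpow_one, ← Real.exp_mul] at this
        exact this
      rw [Real.sqrt_le_iff]
      refine ⟨(exp_pos _).le, h5.trans ?_⟩
      rw [← Real.exp_nat_mul]
      apply Real.exp_le_exp.2
      push_cast
      nlinarith
  have hpt : ∀ z, g z * exp (τ * |⟪z, θ⟫|) ≤ 2 * exp m * g ((1/2 : ℝ) • z) := by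
    intro z
    have h2 := hlc (1/2) (1/2) (by norm_num) (by norm_num) (by norm_num) z 0
    rw [smul_zero, add_zero, ← Real.sqrt_eq_rpow, ← Real.sqrt_eq_rpow] at h2
    have h3 : 1 / 2 ≤ √(g 0) := by
      apply Real.le_sqrt_of_sq_le; linarith
    have h4 : √(g z) ≤ 2 * g ((1/2 : ℝ) • z) := by
      nlinarith [Real.sqrt_nonneg (g z)]
    calc g z * exp (τ * |⟪z, θ⟫|) = √(g z) * √(g z) * exp (τ * |⟪z, θ⟫|) := by
          rw [Real.mul_self_sqrt (hg0 z)]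
      _ ≤ exp (m - τ * |⟪z, θ⟫|) * (2 * g ((1/2 : ℝ) • z)) * exp (τ * |⟪z, θ⟫|) := by
          gcongr
          exact hdecay z
      _ = (exp (m - τ * |⟪z, θ⟫|) * exp (τ * |⟪z, θ⟫|)) * 2 * g ((1/2 : ℝ) • z) := by ring
      _ = _ := by rw [← Real.exp_add, sub_add_cancel]; ring
  set φ : F → ℝ≥0∞ := fun z => ENNReal.ofReal (exp (τ * |⟪z, θ⟫|)) with hφ
  have hφm : Measurable φ := by fun_prop
  have hlow : ∀ w, ENNReal.ofReal (exp (-m)) * φ w * volume (Metric.closedBall (0:F) δ) ≤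
      ∫⁻ z in Metric.closedBall w δ, φ z := by
    intro w
    rw [← Measure.addHaar_closedBall_center volume w δ, ← setLIntegral_const]
    refine setLIntegral_mono hφm fun z hz => ?_
    simp only [hφ]
    rw [← ENNReal.ofReal_mul (exp_pos _).le, ← Real.exp_add]
    apply ENNReal.ofReal_le_ofReal
    apply Real.exp_le_exp.2
    have h2 : |⟪w, θ⟫| ≤ |⟪z, θ⟫| + δ := by
      have h3 : ⟪w, θ⟫ = ⟪z, θ⟫ + ⟪w - z, θ⟫ := by rw [inner_sub_left]; ring
      have h4 : |⟪w - z, θ⟫| ≤ ‖w - z‖ * ‖θ‖ := abs_real_inner_le_norm _ _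
      rw [hθ1, mul_one] at h4
      have h5 : ‖w - z‖ ≤ δ := by rw [norm_sub_rev, ← dist_eq_norm]; exact hz
      rw [h3]
      exact (abs_add_le _ _).trans (by linarith)
    have h6 : τ * δ ≤ m := by
      rw [hτ, div_mul_eq_mul_div, div_le_iff₀ (by positivity)]
      nlinarith
    nlinarith
  have hfinal : ENNReal.ofReal (exp (-m)) * (∫⁻ w, φ w ∂η) * volume (Metric.closedBall (0:F) δ) ≤
      ENNReal.ofReal (2 * exp m * 2 ^ m) * volume (Metric.closedBall (0:F) δ) := by
    calc ENNReal.ofReal (exp (-m)) * (∫⁻ w, φ w ∂η) * volume (Metric.closedBall (0:F) δ)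
        = ∫⁻ w, ENNReal.ofReal (exp (-m)) * φ w * volume (Metric.closedBall (0:F) δ) ∂η := by
          rw [lintegral_mul_const _ (by fun_prop), lintegral_const_mul _ hφm]
      _ ≤ ∫⁻ w, (∫⁻ z in Metric.closedBall w δ, φ z) ∂η := lintegral_mono hlow
      _ = ∫⁻ z, η (Metric.closedBall z δ) * φ z := (lintegral_measure_closedBall_mul η δ hφm).symm
      _ ≤ ∫⁻ z, ENNReal.ofReal (2 * exp m) * η (Metric.closedBall ((1/2 : ℝ) • z) δ) := by
          refine lintegral_mono fun z => ?_
          simp only [hφ, hgof]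
          rw [← ENNReal.ofReal_mul (hg0 _), ← ENNReal.ofReal_mul (by positivity)]
          exact ENNReal.ofReal_le_ofReal (hpt z)
      _ = ENNReal.ofReal (2 * exp m) * ∫⁻ z, η (Metric.closedBall ((1/2 : ℝ) • z) δ) := by
          rw [lintegral_const_mul]
          exact (measurable_measure_closedBall η δ).comp (measurable_const_smul _)
      _ = ENNReal.ofReal (2 * exp m) * (ENNReal.ofReal (2 ^ m) *
          ∫⁻ z, η (Metric.closedBall z δ)) := by
          congr 1
          have h2 : Measure.map (fun z : F => (1/2 : ℝ) • z) volume =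
              ENNReal.ofReal (2 ^ m) • (volume : Measure F) := by
            rw [Measure.map_addHaar_smul _ (by norm_num)]
            congr 2
            rw [← hmdef, abs_of_pos (by positivity)]
            simp
          rw [← smul_eq_mul, ← lintegral_smul_measure, ← h2,
            lintegral_map (measurable_measure_closedBall η δ) (measurable_const_smul _)]
      _ ≤ ENNReal.ofReal (2 * exp m) * (ENNReal.ofReal (2 ^ m) *
          volume (Metric.closedBall (0:F) δ)) := by
          gcongr
          have := lintegral_measure_closedBall_mul η δ (φ := fun _ => 1) measurable_const
          simp only [mul_one, setLIntegral_const, one_mul, Measure.addHaar_closedBall_center,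
            lintegral_const (volume _)] at this
          rw [this]
          simpa using mul_le_mul_right h1 (volume (Metric.closedBall (0:F) δ))
      _ = _ := by rw [← mul_assoc, ← ENNReal.ofReal_mul (by positivity)]
  have h9 := (ENNReal.mul_le_mul_iff_left hBpos.ne' hBfin).1 hfinal
  have h10 : ∫⁻ w, φ w ∂η = ENNReal.ofReal (exp m) * (ENNReal.ofReal (exp (-m)) * ∫⁻ w, φ w ∂η) := by
    rw [← mul_assoc, ← ENNReal.ofReal_mul (exp_pos _).le, ← Real.exp_add]
    simp
  rw [h10]
  refine (mul_le_mul_right h9 _).trans ?_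
  rw [← ENNReal.ofReal_mul (exp_pos _).le]
  apply ENNReal.ofReal_le_ofReal
  have h2 : (2:ℝ) * 2 ^ m ≤ exp m * exp m := by
    have he : (2:ℝ) ^ m ≤ exp m := by
      rw [show exp m = exp 1 ^ m by rw [← Real.exp_nat_mul]; simp]
      gcongr
      linarith [Real.exp_one_gt_d9]
    have h3 : (2:ℝ) ≤ 2 ^ m := le_self_pow₀ (by norm_num) hm.ne'
    exact mul_le_mul (h3.trans he) he (by positivity) (exp_pos _).le
  calc exp m * (2 * exp m * 2 ^ m) = exp m * exp m * (2 * 2 ^ m) := by ring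
    _ ≤ exp m * exp m * (exp m * exp m) := by gcongr
    _ = _ := by rw [← Real.exp_add, ← Real.exp_add]; ring_nf

end LogConcave

section Dvoretzky

set_option linter.unusedSectionVars false

lemma card_le_of_separated_unit {F : Type*} [NormedAddCommGroup F] [NormedSpace ℝ F]
    [FiniteDimensional ℝ F] (s : Finset F) (hs : ∀ c ∈ s, ‖c‖ = 1)
    (h : ∀ c ∈ s, ∀ d ∈ s, c ≠ d → 1 / 8 ≤ ‖c - d‖) : s.card ≤ 17 ^ Module.finrank ℝ F := by
  borelize F
  let μ : Measure F := Measure.addHaar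
  set A := ⋃ c ∈ s, Metric.ball (c : F) (1 / 16) with hA
  have D : Set.Pairwise (s : Set F) (Function.onFun Disjoint fun c => Metric.ball (c : F) (1 / 16)) := by
    rintro c hc d hd hcd
    apply Metric.ball_disjoint_ball
    rw [dist_eq_norm]
    have := h c hc d hd hcd
    linarith
  have A_subset : A ⊆ Metric.ball (0 : F) (17 / 16) := by
    refine Set.iUnion₂_subset fun x hx => ?_
    apply Metric.ball_subset_ball'
    rw [dist_zero_right, hs x hx]
    norm_num
  have I : (s.card : ℝ≥0∞) * ENNReal.ofReal ((1 / 16) ^ Module.finrank ℝ F) * μ (Metric.ball 0 1) ≤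
      ENNReal.ofReal ((17 / 16) ^ Module.finrank ℝ F) * μ (Metric.ball 0 1) :=
    calc
      (s.card : ℝ≥0∞) * ENNReal.ofReal ((1 / 16) ^ Module.finrank ℝ F) * μ (Metric.ball 0 1)
          = μ A := by
        rw [hA, measure_biUnion_finset D fun c _ => measurableSet_ball]
        simp only [μ.addHaar_ball_of_pos _ (by norm_num : (0:ℝ) < 1 / 16)]
        simp only [Finset.sum_const, nsmul_eq_mul, mul_assoc]
      _ ≤ μ (Metric.ball (0 : F) (17 / 16)) := measure_mono A_subset
      _ = _ := by simp only [μ.addHaar_ball_of_pos _ (by norm_num : (0:ℝ) < 17 / 16)]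
  have J := (ENNReal.mul_le_mul_iff_left (Metric.measure_ball_pos μ _ zero_lt_one).ne'
    measure_ball_lt_top.ne).1 I
  have K : (s.card : ℝ) ≤ (17 : ℝ) ^ Module.finrank ℝ F := by
    have := ENNReal.toReal_le_of_le_ofReal (by positivity) J
    simpa [div_eq_mul_inv, mul_pow] using this
  exact mod_cast K

lemma exists_net_sphere (F : Type*) [NormedAddCommGroup F] [NormedSpace ℝ F]
    [FiniteDimensional ℝ F] : ∃ s : Finset F, s.card ≤ 17 ^ Module.finrank ℝ F ∧
      (∀ c ∈ s, ‖c‖ = 1) ∧ ∀ x : F, ‖x‖ = 1 → ∃ c ∈ s, ‖x - c‖ ≤ 1 / 8 := by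
  classical
  set P : Set ℕ := {N | ∃ s : Finset F, s.card = N ∧ (∀ c ∈ s, ‖c‖ = 1) ∧
    ∀ c ∈ s, ∀ d ∈ s, c ≠ d → 1 / 8 ≤ ‖c - d‖} with hP
  have hne : P.Nonempty := ⟨0, ∅, by simp⟩
  have hb : BddAbove P := by
    refine ⟨17 ^ Module.finrank ℝ F, ?_⟩
    rintro N ⟨s, rfl, h1, h2⟩
    exact card_le_of_separated_unit s h1 h2
  obtain ⟨s, hs, h1, h2⟩ := Nat.sSup_mem hne hb
  refine ⟨s, card_le_of_separated_unit s h1 h2, h1, fun x hx => ?_⟩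
  by_contra! hcon
  have hxs : x ∉ s := fun h => by have := hcon x h; simp at this; linarith
  have : (insert x s).card ≤ sSup P := le_csSup hb ⟨insert x s, rfl, by simpa [hx] using h1, ?_⟩
  · rw [Finset.card_insert_of_notMem hxs, hs] at this
    omega
  · intro c hc d hd hcd
    rw [Finset.mem_insert] at hc hd
    rcases hc with rfl | hc <;> rcases hd with rfl | hd
    · exact absurd rfl hcd
    · exact (hcon d hd).le
    · rw [norm_sub_rev]; exact (hcon c hc).le
    · exact h2 c hc d hd hcd

variable {H : Type*} [NormedAddCommGroup H] [InnerProductSpace ℝ H] [FiniteDimensional ℝ H]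
  [MeasurableSpace H] [BorelSpace H]

lemma integral_norm_sq_stdGaussian : ∫ x, ‖x‖ ^ 2 ∂(stdGaussian H) = Module.finrank ℝ H := by
  have h : ∀ x : H, ‖x‖ ^ 2 = ∑ i, ⟪x, stdOrthonormalBasis ℝ H i⟫ ^ 2 := fun x => by
    rw [← (stdOrthonormalBasis ℝ H).sum_sq_norm_inner_left x]
    simp
  simp_rw [h]
  rw [integral_finsetSum]
  · simp_rw [integral_inner_sq_stdGaussian]
    simp
  · intro i _
    have : MemLp (fun x : H => ⟪x, stdOrthonormalBasis ℝ H i⟫) 2 (stdGaussian H) := by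
      have h := IsGaussian.memLp_dual (stdGaussian H) (innerSL ℝ (stdOrthonormalBasis ℝ H i)) 2
        (by simp)
      refine h.congr_norm (by fun_prop) (Filter.Eventually.of_forall fun x => ?_)
      simp [real_inner_comm]
    exact this.integrable_sq

lemma stdGaussian_abs_sub_le {f : H → ℝ} {σ : ℝ} (hσ : 0 < σ)
    (hf : ∀ x y, |f x - f y| ≤ σ * ‖x - y‖) (hm : Measurable f) {t : ℝ} (ht : 0 < t) :
    stdGaussian H {x | t < |f x - ∫ y, f y ∂(stdGaussian H)|} ≤
      ENNReal.ofReal (2 * exp (-(t ^ 2 / (4 * σ ^ 2)))) := by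
  set M := ∫ y, f y ∂(stdGaussian H) with hM
  set l := t / (2 * σ ^ 2) with hl
  have hl0 : 0 < l := by positivity
  have key : ∀ h : H → ℝ, (∀ x y, |h x - h y| ≤ σ * ‖x - y‖) → Measurable h →
      stdGaussian H {x | t < h x - ∫ y, h y ∂(stdGaussian H)} ≤
        ENNReal.ofReal (exp (-(t ^ 2 / (4 * σ ^ 2)))) := by
    intro h hh hhm
    have h1 := gauss_lintegral_exp_le hh hhm l
    set m := ∫ y, h y ∂(stdGaussian H)
    have h2 : ENNReal.ofReal (exp (l * t)) * stdGaussian H {x | t < h x - m} ≤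
        ENNReal.ofReal (exp (l ^ 2 * σ ^ 2)) := by
      refine le_trans ?_ h1
      refine le_trans ?_ (mul_meas_ge_le_lintegral (by fun_prop) (ENNReal.ofReal (exp (l * t))))
      refine mul_le_mul_right (measure_mono fun x hx => ?_) _
      exact ENNReal.ofReal_le_ofReal (exp_le_exp.2 (by nlinarith [show t < h x - m from hx]))
    have h3 : stdGaussian H {x | t < h x - m} = ENNReal.ofReal (exp (-(l * t))) *
        (ENNReal.ofReal (exp (l * t)) * stdGaussian H {x | t < h x - m}) := by
      rw [← mul_assoc, ← ENNReal.ofReal_mul (exp_pos _).le, ← Real.exp_add]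
      simp
    rw [h3]
    refine (mul_le_mul_right h2 _).trans ?_
    rw [← ENNReal.ofReal_mul (exp_pos _).le, ← Real.exp_add]
    apply ENNReal.ofReal_le_ofReal
    apply exp_le_exp.2
    rw [hl]
    apply le_of_eq
    field_simp
    ring
  have h1 := key f hf hm
  have h2 := key (fun x => -f x) (fun x y => by
    rw [← abs_neg]; convert hf x y using 2; ring) hm.neg
  rw [integral_neg] at h2
  calc stdGaussian H {x | t < |f x - M|}
      ≤ stdGaussian H ({x | t < f x - M} ∪ {x | t < -f x - -M}) := by
        apply measure_mono
        intro x hx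
        rcases lt_abs.1 (show t < |f x - M| from hx) with h | h
        · exact Or.inl h
        · exact Or.inr (show t < -f x - -M by linarith)
    _ ≤ _ := measure_union_le _ _
    _ ≤ _ := add_le_add h1 h2
    _ = _ := by rw [← ENNReal.ofReal_add (exp_pos _).le (exp_pos _).le]; ring_nf

/-- The linear combination of a tuple of vectors. -/
noncomputable def combo {m : ℕ} (a : EuclideanSpace ℝ (Fin m)) :
    PiLp 2 (fun _ : Fin m => H) →ₗ[ℝ] H where
  toFun z := ∑ i, a i • z i
  map_add' x y := by simp [smul_add, Finset.sum_add_distrib]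
  map_smul' c x := by simp [Finset.smul_sum, smul_comm c]

lemma combo_apply {m : ℕ} (a : EuclideanSpace ℝ (Fin m)) (z : PiLp 2 (fun _ : Fin m => H)) :
    combo a z = ∑ i, a i • z i := rfl

lemma inner_combo {m : ℕ} (a : EuclideanSpace ℝ (Fin m)) (z : PiLp 2 (fun _ : Fin m => H)) (y : H) :
    ⟪combo a z, y⟫ = ⟪z, WithLp.toLp 2 fun i => a i • y⟫ := by
  rw [combo_apply, sum_inner, PiLp.inner_apply]
  refine Finset.sum_congr rfl fun i _ => ?_
  simp [inner_smul_left, inner_smul_right]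

lemma norm_toLp_smul {m : ℕ} (a : EuclideanSpace ℝ (Fin m)) (y : H) :
    ‖(WithLp.toLp 2 fun i => a i • y : PiLp 2 (fun _ : Fin m => H))‖ = ‖a‖ * ‖y‖ := by
  rw [PiLp.norm_eq_of_L2, EuclideanSpace.norm_eq, ← Real.sqrt_sq (norm_nonneg y),
    ← Real.sqrt_mul (by positivity), Finset.sum_mul]
  congr 1
  refine Finset.sum_congr rfl fun i _ => ?_
  simp [norm_smul, mul_pow]

lemma measurable_combo {m : ℕ} (a : EuclideanSpace ℝ (Fin m)) : Measurable (combo (H := H) a) :=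
  (LinearMap.continuous_of_finiteDimensional _).measurable

lemma map_combo_stdGaussian {m : ℕ} {a : EuclideanSpace ℝ (Fin m)} (ha : ‖a‖ = 1) :
    (stdGaussian (PiLp 2 (fun _ : Fin m => H))).map (combo a) = stdGaussian H := by
  have : IsProbabilityMeasure ((stdGaussian (PiLp 2 (fun _ : Fin m => H))).map (combo a)) :=
    Measure.isProbabilityMeasure_map (measurable_combo a).aemeasurable
  apply Measure.ext_of_charFun
  ext y
  rw [charFun_stdGaussian, charFun_apply, integral_map (measurable_combo a).aemeasurable
    (by fun_prop)]
  simp_rw [inner_combo]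
  rw [← charFun_apply, charFun_stdGaussian, norm_toLp_smul, ha, one_mul]

/-- A seminorm on Euclidean space with large Gaussian mean is bounded below on the image of
an `m`-dimensional Euclidean space. -/
theorem exists_combo_lower_bound {m : ℕ} (hm : 0 < m) {N : Seminorm ℝ H} {σ : ℝ} (hσ : 0 < σ)
    (hN : ∀ x, N x ≤ σ * ‖x‖) (hM0 : 0 < ∫ x, N x ∂(stdGaussian H))
    (hM : 320 * m * σ ^ 2 ≤ (∫ x, N x ∂(stdGaussian H)) ^ 2) :
    ∃ z : Fin m → H, ∑ i, ‖z i‖ ^ 2 ≤ 4 * m * Module.finrank ℝ H ∧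
      ∀ a : EuclideanSpace ℝ (Fin m),
        (∫ x, N x ∂(stdGaussian H)) / 2 * ‖a‖ ≤ N (∑ i, a i • z i) := by
  set M := ∫ x, N x ∂(stdGaussian H) with hMdef
  have hlip : ∀ x y, |N x - N y| ≤ σ * ‖x - y‖ := fun x y =>
    (abs_sub_map_le_sub N x y).trans (hN _)
  have hNc : Continuous N := by
    refine (LipschitzWith.of_dist_le_mul (K := σ.toNNReal) fun x y => ?_).continuous
    rw [Real.dist_eq, dist_eq_norm, Real.coe_toNNReal _ hσ.le]
    exact hlip x y
  let G := PiLp 2 (fun _ : Fin m => H)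
  obtain ⟨s, hcard, hs1, hsnet⟩ := exists_net_sphere (EuclideanSpace ℝ (Fin m))
  rw [finrank_euclideanSpace_fin] at hcard
  have hbad1 : ∀ a ∈ s, stdGaussian G {z | M / 4 < |N (combo (H := H) a z) - M|} ≤
      ENNReal.ofReal (2 * exp (-(5 * m))) := by
    intro a ha
    have h1 : stdGaussian G {z | M / 4 < |N (combo (H := H) a z) - M|} =
        stdGaussian H {x | M / 4 < |N x - M|} := by
      rw [← map_combo_stdGaussian (H := H) (hs1 a ha), Measure.map_apply (measurable_combo a)
        (measurableSet_lt measurable_const (by fun_prop))]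
      rfl
    rw [h1]
    refine (stdGaussian_abs_sub_le hσ hlip hNc.measurable (by positivity)).trans ?_
    apply ENNReal.ofReal_le_ofReal
    gcongr
    rw [le_div_iff₀ (by positivity)]
    nlinarith
  have hfin : Module.finrank ℝ G = m * Module.finrank ℝ H := by
    rw [LinearEquiv.finrank_eq (WithLp.linearEquiv 2 ℝ (Fin m → H)), Module.finrank_pi_fintype]
    simp
  have hbad2 : stdGaussian G {z | 4 * m * Module.finrank ℝ H < ‖z‖ ^ 2} ≤ ENNReal.ofReal (1 / 4) := by
    rcases Nat.eq_zero_or_pos (Module.finrank ℝ H) with hk | hk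
    · rw [hk, mul_zero] at hfin
      have : Subsingleton G := Module.finrank_zero_iff.1 hfin
      have : {z : G | 4 * m * (Module.finrank ℝ H : ℝ) < ‖z‖ ^ 2} = ∅ := by
        ext z
        simp [Subsingleton.elim z 0, hk]
      rw [this]
      simp
    have hc : 0 < 4 * (m : ℝ) * Module.finrank ℝ H := by positivity
    have h1 := integral_norm_sq_stdGaussian (H := G)
    have h_int : Integrable (fun z : G => ‖z‖ ^ 2) (stdGaussian G) := by
      by_contra hni
      rw [integral_undef hni, hfin] at h1
      have : (0:ℝ) < (m * Module.finrank ℝ H : ℕ) := by positivity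
      linarith
    have h2 := mul_meas_ge_le_integral_of_nonneg
      (Filter.Eventually.of_forall fun z : G => by positivity) h_int (4 * m * Module.finrank ℝ H)
    rw [h1, hfin, Nat.cast_mul] at h2
    have h3 : (stdGaussian G).real {z | 4 * m * (Module.finrank ℝ H : ℝ) ≤ ‖z‖ ^ 2} ≤ 1 / 4 := by
      have : (0:ℝ) < m * Module.finrank ℝ H := by positivity
      nlinarith
    refine (measure_mono fun z hz => ?_).trans
      ((ENNReal.le_ofReal_iff_toReal_le (measure_ne_top _ _) (by norm_num)).2 h3)
    exact (show 4 * m * (Module.finrank ℝ H : ℝ) < ‖z‖ ^ 2 from hz).le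
  have hex : ∃ z : G, z ∉ (⋃ a ∈ s, {z | M / 4 < |N (combo (H := H) a z) - M|}) ∪
      {z | 4 * m * Module.finrank ℝ H < ‖z‖ ^ 2} := by
    by_contra! hcon
    have h1 : stdGaussian G Set.univ ≤ ENNReal.ofReal (17 ^ m * (2 * exp (-(5 * m))) + 1 / 4) := by
      rw [← Set.eq_univ_of_forall hcon]
      refine (measure_union_le _ _).trans ?_
      rw [ENNReal.ofReal_add (by positivity) (by positivity)]
      gcongr
      refine (measure_biUnion_finset_le _ _).trans ?_
      refine (Finset.sum_le_sum hbad1).trans ?_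
      rw [Finset.sum_const, nsmul_eq_mul, ENNReal.ofReal_mul (p := 17 ^ m) (by positivity)]
      gcongr
      rw [← ENNReal.ofReal_natCast]
      exact ENNReal.ofReal_le_ofReal (by exact_mod_cast hcard)
    rw [measure_univ, ENNReal.one_le_ofReal] at h1
    have h2 : (17:ℝ) ^ m * (2 * exp (-(5 * m))) < 3 / 4 := by
      have he : exp (-(5 * (m:ℝ))) = (exp (-5)) ^ m := by rw [← Real.exp_nat_mul]; ring_nf
      have h5 : 17 * exp (-5) ≤ 1 / 4 := by
        rw [Real.exp_neg]
        have : (68:ℝ) ≤ exp 5 := by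
          have := Real.exp_one_gt_d9
          calc (68:ℝ) ≤ 2.7182818283 ^ 5 := by norm_num
            _ ≤ (exp 1) ^ 5 := by gcongr
            _ = exp 5 := by rw [← Real.exp_nat_mul]; norm_num
        rw [← div_eq_mul_inv, div_le_iff₀ (exp_pos _)]
        linarith
      calc (17:ℝ) ^ m * (2 * exp (-(5 * m))) = 2 * (17 * exp (-5)) ^ m := by
            rw [he, mul_pow]; ring
        _ ≤ 2 * (17 * exp (-5)) := by
            gcongr
            exact pow_le_of_le_one (by positivity) (by linarith) hm.ne'
        _ < 3 / 4 := by linarith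
    linarith
  obtain ⟨z, hz⟩ := hex
  simp only [Set.mem_union, Set.mem_iUnion, not_or, not_exists] at hz
  refine ⟨fun i => z i, ?_, ?_⟩
  · rw [← PiLp.norm_sq_eq_of_L2]
    exact not_lt.1 hz.2
  let T : EuclideanSpace ℝ (Fin m) →ₗ[ℝ] H :=
    { toFun := fun a => ∑ i, a i • z i
      map_add' := fun x y => by simp [add_smul, Finset.sum_add_distrib]
      map_smul' := fun c x => by simp [Finset.smul_sum, smul_smul] }
  have hTc : Continuous fun a => N (T a) := hNc.comp (LinearMap.continuous_of_finiteDimensional T)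
  have hunit : ∀ a : EuclideanSpace ℝ (Fin m), ‖a‖ = 1 → M / 2 ≤ N (T a) := by
    have : Nonempty (Fin m) := ⟨⟨0, hm⟩⟩
    obtain ⟨b, hb, hbmax⟩ := (isCompact_sphere (0 : EuclideanSpace ℝ (Fin m)) 1).exists_isMaxOn
      (NormedSpace.sphere_nonempty.2 zero_le_one) hTc.continuousOn
    set S := N (T b) with hS
    have hSmax : ∀ x, N (T x) ≤ S * ‖x‖ := by
      intro x
      rcases (norm_nonneg x).eq_or_lt with h0 | h0
      · have : x = 0 := norm_eq_zero.1 h0.symm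
        simp [this]
      · have h1 : N (T (‖x‖⁻¹ • x)) ≤ S := hbmax (show ‖x‖⁻¹ • x ∈ Metric.sphere (0 : EuclideanSpace ℝ (Fin m)) 1 by
          rw [mem_sphere_zero_iff_norm, norm_smul, norm_inv, norm_norm, inv_mul_cancel₀ h0.ne'])
        rw [map_smul, map_smul_eq_mul, norm_inv, norm_norm] at h1
        rw [← div_le_iff₀ h0, div_eq_inv_mul]
        exact h1
    have hclose : ∀ x, ‖x‖ = 1 → ∃ c, |N (T c) - M| ≤ M / 4 ∧ |N (T x) - N (T c)| ≤ S / 8 := by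
      intro x hx
      obtain ⟨c, hc, hxc⟩ := hsnet x hx
      refine ⟨c, not_lt.1 (hz.1 c hc), ?_⟩
      refine (abs_sub_map_le_sub N _ _).trans ?_
      rw [← map_sub]
      refine (hSmax _).trans ?_
      have : 0 ≤ S := apply_nonneg N _
      nlinarith
    obtain ⟨c, hc1, hc2⟩ := hclose b (by simpa using hb)
    rw [abs_le] at hc1 hc2
    intro a ha
    obtain ⟨d, hd1, hd2⟩ := hclose a ha
    rw [abs_le] at hd1 hd2
    linarith
  intro a
  show M / 2 * ‖a‖ ≤ N (T a)
  rcases (norm_nonneg a).eq_or_lt with h0 | h0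
  · rw [← h0]; simp
  · have h1 := hunit (‖a‖⁻¹ • a) (by rw [norm_smul, norm_inv, norm_norm, inv_mul_cancel₀ h0.ne'])
    rw [map_smul, map_smul_eq_mul, norm_inv, norm_norm] at h1
    rwa [inv_mul_eq_div, le_div_iff₀ h0] at h1

end Dvoretzky

section Moments

open scoped Nat

lemma lintegral_rpow_le_rpow_lintegral {α : Type*} [MeasurableSpace α] {κ : Measure α}
    (h1 : κ Set.univ ≤ 1) {f : α → ℝ≥0∞} (hf : AEMeasurable f κ) {s : ℝ} (hs0 : 0 ≤ s)
    (hs1 : s ≤ 1) : ∫⁻ y, f y ^ s ∂κ ≤ (∫⁻ y, f y ∂κ) ^ s := by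
  have h := ENNReal.lintegral_mul_norm_pow_le (μ := κ) hf (aemeasurable_const (b := 1)) hs0
    (sub_nonneg.2 hs1) (by ring)
  simp only [ENNReal.one_rpow, mul_one, lintegral_const, one_mul] at h
  refine h.trans ?_
  calc (∫⁻ y, f y ∂κ) ^ s * κ Set.univ ^ (1 - s) ≤ (∫⁻ y, f y ∂κ) ^ s * 1 ^ (1 - s) := by
        gcongr
    _ = _ := by simp

lemma pow_le_factorial_mul_exp (n : ℕ) {x : ℝ} (hx : 0 ≤ x) : x ^ n ≤ n.factorial * exp x := by
  have := Real.pow_div_factorial_le_exp x hx n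
  rwa [div_le_iff₀ (by positivity), mul_comm] at this

lemma half_pow_le_lintegral_gaussianReal (j : ℕ) :
    ENNReal.ofReal ((j / 2) ^ j / 2) ≤ ∫⁻ x, ENNReal.ofReal (x ^ (2 * j)) ∂(gaussianReal 0 1) := by
  have hG := integral_rpow_mul_exp_neg_mul_rpow (p := 2) (q := (2 * j : ℕ)) (b := 1 / 2)
    (by norm_num) (by have : (0:ℝ) ≤ (2 * j : ℕ) := by positivity
                      linarith) (by norm_num)
  have h_int : IntegrableOn (fun x : ℝ => x ^ (((2 * j : ℕ) : ℝ)) * exp (-(1 / 2) * x ^ (2:ℝ)))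
      (Set.Ioi 0) := by
    by_contra h
    rw [IntegrableOn] at h
    rw [integral_undef h] at hG
    have : 0 < Real.Gamma ((((2 * j : ℕ) : ℝ) + 1) / 2) := Real.Gamma_pos_of_pos (by positivity)
    have : 0 < ((1:ℝ) / 2) ^ (-((((2 * j : ℕ) : ℝ)) + 1) / 2) * (1 / 2) *
      Real.Gamma ((((2 * j : ℕ) : ℝ) + 1) / 2) := by positivity
    linarith
  have hfac : ((j:ℝ) / 2) ^ j ≤ ((2 * j - 1 : ℕ)‼ : ℕ) := by
    rcases Nat.eq_zero_or_pos j with rfl | hj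
    · simp
    have h1 : j.factorial * j ^ j ≤ (2 * j).factorial := by
      refine le_trans ?_ ((Nat.factorial_mul_pow_le_factorial (m := j) (n := j)).trans
        (by rw [two_mul]))
      gcongr
      omega
    have h2 : (2 * j).factorial = 2 ^ j * j.factorial * (2 * j - 1)‼ := by
      rw [← Nat.doubleFactorial_two_mul]
      obtain ⟨i, rfl⟩ : ∃ i, j = i + 1 := ⟨j - 1, by omega⟩
      rw [show 2 * (i + 1) = (2 * i + 1) + 1 by ring, Nat.factorial_eq_mul_doubleFactorial]
      simp
    rw [h2] at h1
    have h3 : j ^ j ≤ 2 ^ j * (2 * j - 1)‼ := by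
      have := Nat.factorial_pos j
      nlinarith
    rw [div_pow, div_le_iff₀ (by positivity)]
    have : ((j ^ j : ℕ) : ℝ) ≤ (2 ^ j * (2 * j - 1)‼ : ℕ) := by exact_mod_cast h3
    push_cast at this
    linarith
  have hval : (√(2 * π))⁻¹ * ∫ x in Set.Ioi (0:ℝ), x ^ (((2 * j : ℕ) : ℝ)) * exp (-(1 / 2) * x ^ (2:ℝ))
      = ((2 * j - 1 : ℕ)‼ : ℕ) / 2 := by
    rw [hG, show ((((2 * j : ℕ) : ℝ) + 1) / 2) = j + 1 / 2 by push_cast; ring,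
      Real.Gamma_nat_add_half]
    rw [show -((((2 * j : ℕ) : ℝ)) + 1) / 2 = -(j + 1 / 2 : ℝ) by push_cast; ring,
      one_div, Real.inv_rpow (by norm_num), Real.rpow_neg (by norm_num), inv_inv,
      Real.rpow_add (by norm_num), Real.rpow_natCast, Real.sqrt_mul (by norm_num),
      show ((2:ℝ) ^ (2⁻¹ : ℝ)) = √2 by rw [Real.sqrt_eq_rpow, one_div]]
    have : 0 < √π := Real.sqrt_pos.2 Real.pi_pos
    field_simp
  rw [gaussianReal_of_var_ne_zero 0 one_ne_zero, lintegral_withDensity_eq_lintegral_mul _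
    (measurable_gaussianPDF _ _) (by fun_prop)]
  calc ENNReal.ofReal ((j / 2) ^ j / 2) ≤ ENNReal.ofReal (∫ x in Set.Ioi (0:ℝ), (√(2 * π))⁻¹ *
        (x ^ (((2 * j : ℕ) : ℝ)) * exp (-(1 / 2) * x ^ (2:ℝ)))) := by
        apply ENNReal.ofReal_le_ofReal
        rw [integral_const_mul, hval]
        linarith
    _ = ∫⁻ x in Set.Ioi (0:ℝ), ENNReal.ofReal ((√(2 * π))⁻¹ *
        (x ^ (((2 * j : ℕ) : ℝ)) * exp (-(1 / 2) * x ^ (2:ℝ)))) := by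
        rw [ofReal_integral_eq_lintegral_ofReal (h_int.const_mul _)]
        refine (ae_restrict_iff' measurableSet_Ioi).2 (Filter.Eventually.of_forall fun x hx => ?_)
        have : (0:ℝ) < x := hx
        positivity
    _ ≤ ∫⁻ x in Set.Ioi (0:ℝ), (gaussianPDF 0 1 * fun x => ENNReal.ofReal (x ^ (2 * j))) x := by
        refine lintegral_mono fun x => ?_
        rw [Pi.mul_apply, gaussianPDF, gaussianPDFReal, ← ENNReal.ofReal_mul (by positivity)]
        apply ENNReal.ofReal_le_ofReal
        rw [Real.rpow_natCast, Real.rpow_two]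
        apply le_of_eq
        simp
        ring_nf
    _ ≤ _ := setLIntegral_le_lintegral _ _

variable {F : Type*} [NormedAddCommGroup F] [InnerProductSpace ℝ F] [FiniteDimensional ℝ F]
  [MeasurableSpace F] [BorelSpace F]

lemma quarter_pow_le_lintegral_inner_stdGaussian {j : ℕ} (hj : 0 < j) (y : F) :
    ENNReal.ofReal ((j / 4 * ‖y‖ ^ 2) ^ j) ≤
      ∫⁻ g, ENNReal.ofReal (⟪y, g⟫ ^ (2 * j)) ∂(stdGaussian F) := by
  rcases eq_or_ne y 0 with rfl | hy
  · simp [hj.ne']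
  have hy0 : 0 < ‖y‖ := norm_pos_iff.2 hy
  have hm : (stdGaussian F).map (fun g => ⟪g, ‖y‖⁻¹ • y⟫) = gaussianReal 0 1 := by
    rw [map_inner_stdGaussian]
    simp [norm_smul, hy0.ne']
  have h := half_pow_le_lintegral_gaussianReal j
  rw [← hm, lintegral_map (by fun_prop) (by fun_prop)] at h
  have h2 : ∀ g : F, ENNReal.ofReal (⟪y, g⟫ ^ (2 * j)) =
      ENNReal.ofReal (‖y‖ ^ (2 * j)) * ENNReal.ofReal (⟪g, ‖y‖⁻¹ • y⟫ ^ (2 * j)) := by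
    intro g
    rw [← ENNReal.ofReal_mul (by positivity), ← mul_pow, inner_smul_right, ← mul_assoc,
      mul_inv_cancel₀ hy0.ne', one_mul, real_inner_comm]
  simp_rw [h2]
  rw [lintegral_const_mul _ (by fun_prop)]
  refine le_trans ?_ (mul_le_mul_right h _)
  rw [← ENNReal.ofReal_mul (by positivity)]
  apply ENNReal.ofReal_le_ofReal
  have h3 : ((1:ℝ) / 2) ^ j ≤ 1 / 2 := pow_le_of_le_one (by norm_num) (by norm_num) hj.ne'
  calc (j / 4 * ‖y‖ ^ 2) ^ j = ‖y‖ ^ (2 * j) * ((j / 2 : ℝ) ^ j * (1 / 2) ^ j) := by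
        rw [← mul_pow, pow_mul, ← mul_pow]; ring
    _ ≤ ‖y‖ ^ (2 * j) * ((j / 2 : ℝ) ^ j * (1 / 2)) := by gcongr
    _ = _ := by ring

end Moments

section Transfer

variable {F : Type*} [NormedAddCommGroup F] [InnerProductSpace ℝ F] [FiniteDimensional ℝ F]
  [MeasurableSpace F] [BorelSpace F]

lemma measure_map_neg_of_symm {V W : Type*} [AddCommGroup V] [Module ℝ V] [MeasurableSpace V]
    [MeasurableNeg V] [AddCommGroup W] [Module ℝ W] [MeasurableSpace W] [MeasurableNeg W]
    {η : Measure V} (hsymm : ∀ A, η (-A) = η A) (T : V →ₗ[ℝ] W) (hT : Measurable T) (A : Set W) :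
    (η.map T) (-A) = (η.map T) A := by
  have h1 : η.map (fun x => -x) = η := by
    ext A hA
    rw [Measure.map_apply measurable_neg hA]
    exact hsymm A
  have h2 : (η.map T).map (MeasurableEquiv.neg W) = η.map T := by
    conv_rhs => rw [← h1]
    rw [Measure.map_map (MeasurableEquiv.measurable _) hT, Measure.map_map hT measurable_neg]
    congr 1
    ext x
    simp
  conv_rhs => rw [← h2, MeasurableEquiv.map_apply]
  rfl

/-- If exponential moments of linear functionals under `κ` are controlled by those under a
symmetric log-concave probability `η` with small covariance, then the moments of `κ` cannot be
large on the image of an `m`-dimensional Euclidean space. -/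
theorem mul_le_of_exp_moment_transfer {κ η : Measure F} (hκ1 : κ Set.univ ≤ 1)
    (hη : IsLogConcaveMeasure η) (hsymm : ∀ A, η (-A) = η A) (hη1 : η Set.univ = 1)
    {p lam r Z Q : ℝ} (hlam : 0 < lam) (hZ : 0 < Z) {m j : ℕ} (hm : 0 < m)
    (htr : ∀ τ : ℝ, 0 ≤ τ → ∀ z, ∫⁻ y, ENNReal.ofReal (exp (τ * |⟪y, z⟫|)) ∂κ ≤
      ENNReal.ofReal (exp (2 * p)) *
        (∫⁻ y, ENNReal.ofReal (exp (2 * τ * |⟪y, z⟫|)) ∂η) ^ (1 / 2 : ℝ))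
    (hη2 : ∀ z, ∫⁻ y, ENNReal.ofReal (⟪y, z⟫ ^ 2) ∂η ≤ ENNReal.ofReal (2 * lam * ‖z‖ ^ 2))
    (z : Fin m → F) (hz : ∑ i, ‖z i‖ ^ 2 ≤ Z ^ 2) (_hr0 : 0 ≤ r) (hj : 0 < j)
    (hr : ∀ a : EuclideanSpace ℝ (Fin m), ENNReal.ofReal ((r * ‖a‖) ^ (2 * j)) ≤
      ∫⁻ y, ENNReal.ofReal (⟪y, ∑ i, a i • z i⟫ ^ (2 * j)) ∂κ)
    (hpQ : p ≤ Q) (hmQ : m ≤ Q) (hjQ : j ≤ Q) : r * m ≤ 2000 * Q * √lam * Z := by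
  have : IsProbabilityMeasure η := ⟨hη1⟩
  have hm0 : (0:ℝ) < m := by exact_mod_cast hm
  have hj0 : (0:ℝ) < j := by exact_mod_cast hj
  have hQ0 : 0 < Q := hm0.trans_le hmQ
  have hsl : 0 < √lam := Real.sqrt_pos.2 hlam
  let W : F →ₗ[ℝ] EuclideanSpace ℝ (Fin m) :=
    { toFun := fun y => WithLp.toLp 2 fun i => ⟪y, z i⟫
      map_add' := fun x y => by ext i; simp [inner_add_left]
      map_smul' := fun c x => by ext i; simp [inner_smul_left] }
  have hWi : ∀ y i, W y i = ⟪y, z i⟫ := fun y i => rfl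
  have hWm : Measurable W := (LinearMap.continuous_of_finiteDimensional W).measurable
  have hWin : ∀ y a, ⟪W y, a⟫ = ⟪y, ∑ i, a i • z i⟫ := by
    intro y a
    rw [PiLp.inner_apply, inner_sum]
    refine Finset.sum_congr rfl fun i _ => ?_
    rw [hWi, inner_smul_right]
    simp
  set δ := 2 * √lam * Z with hδ
  have hδ0 : 0 < δ := by positivity
  have hsec : ∫⁻ y, ENNReal.ofReal (‖W y‖ ^ 2) ∂η ≤ ENNReal.ofReal (2 * lam * Z ^ 2) := by
    simp_rw [EuclideanSpace.norm_sq_eq, hWi, Real.norm_eq_abs, sq_abs]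
    simp_rw [ENNReal.ofReal_sum_of_nonneg (fun i _ => sq_nonneg _)]
    rw [lintegral_finsetSum _ (fun i _ => by fun_prop)]
    refine (Finset.sum_le_sum fun i _ => hη2 (z i)).trans ?_
    rw [← ENNReal.ofReal_sum_of_nonneg (fun i _ => by positivity)]
    apply ENNReal.ofReal_le_ofReal
    rw [← Finset.mul_sum]
    gcongr
  have hhalf : ENNReal.ofReal (1 / 2) ≤ η.map W (Metric.closedBall 0 δ) := by
    rw [Measure.map_apply hWm Metric.isClosed_closedBall.measurableSet]
    set S := W ⁻¹' Metric.closedBall 0 δ with hS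
    have hSm : MeasurableSet S := hWm Metric.isClosed_closedBall.measurableSet
    have h1 : ENNReal.ofReal (δ ^ 2) * η Sᶜ ≤ ENNReal.ofReal (2 * lam * Z ^ 2) := by
      refine le_trans ?_ hsec
      refine le_trans ?_ (mul_meas_ge_le_lintegral (by fun_prop) (ENNReal.ofReal (δ ^ 2)))
      refine mul_le_mul_right (measure_mono fun y hy => ?_) _
      have : δ < ‖W y‖ := by simpa [S] using hy
      exact ENNReal.ofReal_le_ofReal (by gcongr)
    have h2 : η Sᶜ ≤ ENNReal.ofReal (1 / 2) := by
      have h3 : η Sᶜ ≤ ENNReal.ofReal (2 * lam * Z ^ 2) / ENNReal.ofReal (δ ^ 2) := by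
        rw [ENNReal.le_div_iff_mul_le (Or.inl (by simp; positivity)) (Or.inl (by simp)), mul_comm]
        exact h1
      refine h3.trans ?_
      rw [← ENNReal.ofReal_div_of_pos (by positivity)]
      apply ENNReal.ofReal_le_ofReal
      rw [hδ, mul_pow, mul_pow, Real.sq_sqrt hlam.le, div_le_iff₀ (by positivity)]
      linarith
    have h4 : (1:ℝ≥0∞) ≤ η S + ENNReal.ofReal (1 / 2) := by
      rw [← hη1, ← measure_add_measure_compl hSm]
      gcongr
    have h5 : (1:ℝ≥0∞) = ENNReal.ofReal (1 / 2) + ENNReal.ofReal (1 / 2) := by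
      rw [← ENNReal.ofReal_add (by norm_num) (by norm_num)]; norm_num
    rw [h5] at h4
    exact (ENNReal.add_le_add_iff_right ENNReal.ofReal_ne_top).1 h4
  obtain ⟨θ, hθ, hexp⟩ := exists_direction_exp_le (hη.map W hWm)
    (measure_map_neg_of_symm hsymm W hWm)
    (by rw [Measure.map_apply hWm MeasurableSet.univ]; simp)
      (by rwa [finrank_euclideanSpace_fin]) hδ0 hhalf
  rw [finrank_euclideanSpace_fin, lintegral_map (by fun_prop) hWm] at hexp
  simp_rw [hWin] at hexp
  set w := ∑ i, θ i • z i with hw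
  set τ := m / (64 * δ) with hτ
  have hτ0 : 0 < τ := by positivity
  have h1 : ∫⁻ y, ENNReal.ofReal (exp (τ * |⟪y, w⟫|)) ∂κ ≤ ENNReal.ofReal (exp (4 * Q)) := by
    refine (htr τ hτ0.le w).trans ?_
    have h2τ : 2 * τ = m / (32 * δ) := by rw [hτ]; field_simp; norm_num
    rw [h2τ]
    calc ENNReal.ofReal (exp (2 * p)) *
          (∫⁻ y, ENNReal.ofReal (exp (m / (32 * δ) * |⟪y, w⟫|)) ∂η) ^ (1 / 2 : ℝ)
        ≤ ENNReal.ofReal (exp (2 * p)) * ENNReal.ofReal (exp (4 * m)) ^ (1 / 2 : ℝ) := by gcongr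
      _ = ENNReal.ofReal (exp (2 * p + 2 * m)) := by
        rw [ENNReal.ofReal_rpow_of_pos (exp_pos _), ← Real.exp_mul, ← ENNReal.ofReal_mul (exp_pos _).le,
          ← Real.exp_add]
        ring_nf
      _ ≤ _ := ENNReal.ofReal_le_ofReal (exp_le_exp.2 (by linarith))
  set s := j / Q with hs
  have hs0 : 0 < s := by positivity
  have hs1 : s ≤ 1 := (div_le_one hQ0).2 hjQ
  have h2 : ∫⁻ y, ENNReal.ofReal (exp (s * τ * |⟪y, w⟫|)) ∂κ ≤ ENNReal.ofReal (exp (4 * j)) := by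
    calc ∫⁻ y, ENNReal.ofReal (exp (s * τ * |⟪y, w⟫|)) ∂κ
        = ∫⁻ y, ENNReal.ofReal (exp (τ * |⟪y, w⟫|)) ^ s ∂κ := by
          refine lintegral_congr fun y => ?_
          rw [ENNReal.ofReal_rpow_of_pos (exp_pos _), ← Real.exp_mul]
          ring_nf
      _ ≤ (∫⁻ y, ENNReal.ofReal (exp (τ * |⟪y, w⟫|)) ∂κ) ^ s :=
          lintegral_rpow_le_rpow_lintegral hκ1 (by fun_prop) hs0.le hs1
      _ ≤ ENNReal.ofReal (exp (4 * Q)) ^ s := by gcongr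
      _ = _ := by
          rw [ENNReal.ofReal_rpow_of_pos (exp_pos _), ← Real.exp_mul, hs]
          congr 2
          field_simp
  have h3 : ENNReal.ofReal ((r * s * τ) ^ (2 * j)) ≤
      ENNReal.ofReal ((2 * j * exp 2) ^ (2 * j)) := by
    have h4 := hr θ
    rw [hθ, mul_one] at h4
    calc ENNReal.ofReal ((r * s * τ) ^ (2 * j))
        = ENNReal.ofReal ((s * τ) ^ (2 * j)) * ENNReal.ofReal (r ^ (2 * j)) := by
          rw [← ENNReal.ofReal_mul (by positivity)]; ring_nf
      _ ≤ ENNReal.ofReal ((s * τ) ^ (2 * j)) * ∫⁻ y, ENNReal.ofReal (⟪y, w⟫ ^ (2 * j)) ∂κ := by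
          gcongr
      _ = ∫⁻ y, ENNReal.ofReal ((s * τ * |⟪y, w⟫|) ^ (2 * j)) ∂κ := by
          rw [← lintegral_const_mul _ (by fun_prop)]
          refine lintegral_congr fun y => ?_
          rw [← ENNReal.ofReal_mul (by positivity), mul_pow (s * τ), pow_mul |_|, sq_abs, ← pow_mul]
      _ ≤ ∫⁻ y, ENNReal.ofReal ((2 * j : ℝ) ^ (2 * j)) *
            ENNReal.ofReal (exp (s * τ * |⟪y, w⟫|)) ∂κ := by
          refine lintegral_mono fun y => ?_
          dsimp only
          rw [← ENNReal.ofReal_mul (by positivity)]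
          apply ENNReal.ofReal_le_ofReal
          refine (pow_le_factorial_mul_exp _ (by positivity)).trans ?_
          gcongr
          exact_mod_cast Nat.factorial_le_pow (2 * j)
      _ = ENNReal.ofReal ((2 * j : ℝ) ^ (2 * j)) *
            ∫⁻ y, ENNReal.ofReal (exp (s * τ * |⟪y, w⟫|)) ∂κ := lintegral_const_mul _ (by fun_prop)
      _ ≤ ENNReal.ofReal ((2 * j : ℝ) ^ (2 * j)) * ENNReal.ofReal (exp (4 * j)) := by gcongr
      _ = _ := by
          rw [← ENNReal.ofReal_mul (by positivity), mul_pow _ (exp 2), ← Real.exp_nat_mul]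
          push_cast
          ring_nf
  rw [ENNReal.ofReal_le_ofReal_iff (by positivity)] at h3
  have h4 := le_of_pow_le_pow_left₀ (by omega) (by positivity) h3
  have he : exp 2 ≤ 7.4 := by
    have := Real.exp_one_lt_d9
    calc exp 2 = exp 1 ^ 2 := by rw [← Real.exp_nat_mul]; norm_num
      _ ≤ 2.7182818286 ^ 2 := by gcongr
      _ ≤ 7.4 := by norm_num
  have h5 : r * (j / Q) * (m / (64 * (2 * √lam * Z))) ≤ 2 * j * 7.4 :=
    h4.trans (by gcongr)
  have h6 : r * (j / Q) * (m / (64 * (2 * √lam * Z))) = j * (r * m / (128 * Q * √lam * Z)) := by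
    field_simp
    ring
  rw [h6] at h5
  have h7 : r * m / (128 * Q * √lam * Z) ≤ 14.8 := by
    refine le_of_mul_le_mul_left ?_ hj0
    linarith
  rw [div_le_iff₀ (by positivity)] at h7
  have : 0 < Q * √lam * Z := by positivity
  linarith

end Transfer

section Eigenvalue

set_option linter.unusedSectionVars false

variable {F : Type*} [NormedAddCommGroup F] [InnerProductSpace ℝ F] [FiniteDimensional ℝ F]
  [MeasurableSpace F] [BorelSpace F]

lemma eLpNorm_inner_pow {κ : Measure F} {j : ℕ} (hj : 0 < j) (z : F) :
    eLpNorm (fun y => ⟪y, z⟫) ((2 * j : ℕ) : ℝ≥0∞) κ ^ (2 * j) =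
      ∫⁻ y, ENNReal.ofReal (⟪y, z⟫ ^ (2 * j)) ∂κ := by
  have h := eLpNorm_nnreal_pow_eq_lintegral (f := fun y : F => ⟪y, z⟫) (μ := κ)
    (p := ((2 * j : ℕ) : NNReal)) (by positivity)
  simp only [ENNReal.coe_natCast, NNReal.coe_natCast, ENNReal.rpow_natCast] at h
  rw [h]
  refine lintegral_congr fun y => ?_
  rw [Real.enorm_eq_ofReal_abs, ← ENNReal.ofReal_pow (abs_nonneg _), pow_mul, sq_abs, pow_mul]

/-- The `L^p` norm, `p = 2 * j`, of linear functionals, as a seminorm. -/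
noncomputable def momentSeminorm (κ : Measure F) (j : ℕ) (hj : 0 < j)
    (hfin : ∀ z, ∫⁻ y, ENNReal.ofReal (⟪y, z⟫ ^ (2 * j)) ∂κ ≠ ∞) : Seminorm ℝ F :=
  have hlt : ∀ z : F, eLpNorm (fun y => ⟪y, z⟫) ((2 * j : ℕ) : ℝ≥0∞) κ ≠ ∞ := fun z h => by
    have := eLpNorm_inner_pow (κ := κ) hj z
    rw [h, ENNReal.top_pow (by omega)] at this
    exact hfin z this.symm
  Seminorm.of (fun z => (eLpNorm (fun y => ⟪y, z⟫) ((2 * j : ℕ) : ℝ≥0∞) κ).toReal)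
    (fun x z => by
      rw [← ENNReal.toReal_add (hlt x) (hlt z)]
      refine ENNReal.toReal_mono (ENNReal.add_ne_top.2 ⟨hlt x, hlt z⟩) ?_
      simp_rw [inner_add_right]
      exact eLpNorm_add_le (by fun_prop) (by fun_prop) (by exact_mod_cast (by omega : 1 ≤ 2 * j)))
    (fun c x => by
      simp_rw [inner_smul_right]
      have := eLpNorm_const_smul c (fun y => ⟪y, x⟫) ((2 * j : ℕ) : ℝ≥0∞) κ
      rw [show (c • fun y => ⟪y, x⟫) = fun y => c * ⟪y, x⟫ from rfl] at this
      rw [this, ENNReal.toReal_mul]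
      simp)

lemma ofReal_momentSeminorm_pow {κ : Measure F} {j : ℕ} (hj : 0 < j)
    (hfin : ∀ z, ∫⁻ y, ENNReal.ofReal (⟪y, z⟫ ^ (2 * j)) ∂κ ≠ ∞) (z : F) :
    ENNReal.ofReal (momentSeminorm κ j hj hfin z ^ (2 * j)) =
      ∫⁻ y, ENNReal.ofReal (⟪y, z⟫ ^ (2 * j)) ∂κ := by
  rw [← eLpNorm_inner_pow hj, ENNReal.ofReal_pow (apply_nonneg _ _)]
  congr 1
  refine ENNReal.ofReal_toReal fun h => hfin z ?_
  rw [← eLpNorm_inner_pow hj, h, ENNReal.top_pow (by omega)]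

/-- A lower bound for the Gaussian mean of `momentSeminorm`. -/
theorem sqrt_mul_le_integral_momentSeminorm {κ : Measure F} (hκ1 : κ Set.univ ≤ 1) {j : ℕ}
    (hj : 0 < j) (hfin : ∀ z, ∫⁻ y, ENNReal.ofReal (⟪y, z⟫ ^ (2 * j)) ∂κ ≠ ∞) {σ V : ℝ}
    (hσ : 0 < σ)
    (hub : ∀ z, ∫⁻ y, ENNReal.ofReal (⟪y, z⟫ ^ (2 * j)) ∂κ ≤ ENNReal.ofReal ((σ * ‖z‖) ^ (2 * j)))
    (hV : ENNReal.ofReal V ≤ ∫⁻ y, ENNReal.ofReal (‖y‖ ^ 2) ∂κ) (hσV : 8 * exp 4 * σ ^ 2 ≤ V) :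
    (∀ z, momentSeminorm κ j hj hfin z ≤ σ * ‖z‖) ∧
    √(2 * j) * σ ≤ ∫ z, momentSeminorm κ j hj hfin z ∂(stdGaussian F) := by
  have : IsFiniteMeasure κ := ⟨hκ1.trans_lt ENNReal.one_lt_top⟩
  have hj0 : (0:ℝ) < j := by exact_mod_cast hj
  have hV0 : 0 < V := lt_of_lt_of_le (by positivity) hσV
  set N := momentSeminorm κ j hj hfin with hN
  have hNσ : ∀ z, N z ≤ σ * ‖z‖ := by
    intro z
    have h := hub z
    rw [← ofReal_momentSeminorm_pow hj hfin, ENNReal.ofReal_le_ofReal_iff (by positivity)] at h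
    exact le_of_pow_le_pow_left₀ (by omega) (by positivity) h
  refine ⟨hNσ, ?_⟩
  have hlip : ∀ x y, |N x - N y| ≤ σ * ‖x - y‖ := fun x y =>
    (abs_sub_map_le_sub N x y).trans (hNσ _)
  have hNc : Continuous N := by
    refine (LipschitzWith.of_dist_le_mul (K := σ.toNNReal) fun x y => ?_).continuous
    rw [Real.dist_eq, dist_eq_norm, Real.coe_toNNReal _ hσ.le]
    exact hlip x y
  set M := ∫ z, N z ∂(stdGaussian F) with hM
  by_contra! hlt
  have hlow : ENNReal.ofReal ((j / 4 * V) ^ j) ≤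
      ∫⁻ g, ENNReal.ofReal (N g ^ (2 * j)) ∂(stdGaussian F) := by
    calc ENNReal.ofReal ((j / 4 * V) ^ j) = ENNReal.ofReal ((j / 4) ^ j) * ENNReal.ofReal V ^ j := by
          rw [← ENNReal.ofReal_pow hV0.le, ← ENNReal.ofReal_mul (by positivity), mul_pow]
      _ ≤ ENNReal.ofReal ((j / 4) ^ j) * ∫⁻ y, ENNReal.ofReal ((‖y‖ ^ 2) ^ j) ∂κ := by
          refine mul_le_mul_right ?_ _
          have h := lintegral_rpow_le_rpow_lintegral (s := (j:ℝ)⁻¹) hκ1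
            (f := fun y : F => ENNReal.ofReal ((‖y‖ ^ 2) ^ j)) (by fun_prop) (by positivity)
            (inv_le_one_of_one_le₀ (by exact_mod_cast hj))
          have h2 : ∀ y : F, ENNReal.ofReal ((‖y‖ ^ 2) ^ j) ^ (j:ℝ)⁻¹ = ENNReal.ofReal (‖y‖ ^ 2) := by
            intro y
            rw [ENNReal.ofReal_rpow_of_nonneg (by positivity) (by positivity),
              Real.pow_rpow_inv_natCast (by positivity) hj.ne']
          simp_rw [h2] at h
          have h3 := ENNReal.rpow_le_rpow (hV.trans h) hj0.le
          rwa [← ENNReal.rpow_mul, inv_mul_cancel₀ hj0.ne', ENNReal.rpow_one,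
            ENNReal.rpow_natCast] at h3
      _ = ∫⁻ y, ENNReal.ofReal ((j / 4 * ‖y‖ ^ 2) ^ j) ∂κ := by
          rw [← lintegral_const_mul _ (by fun_prop)]
          refine lintegral_congr fun y => ?_
          rw [← ENNReal.ofReal_mul (by positivity), mul_pow (_ / _)]
      _ ≤ ∫⁻ y, ∫⁻ g, ENNReal.ofReal (⟪y, g⟫ ^ (2 * j)) ∂(stdGaussian F) ∂κ :=
          lintegral_mono fun y => quarter_pow_le_lintegral_inner_stdGaussian hj y
      _ = ∫⁻ g, ∫⁻ y, ENNReal.ofReal (⟪y, g⟫ ^ (2 * j)) ∂κ ∂(stdGaussian F) :=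
          lintegral_lintegral_swap (by fun_prop)
      _ = _ := lintegral_congr fun g => (ofReal_momentSeminorm_pow hj hfin g).symm
  set q : ℝ := 2 * j with hq
  have hq0 : 0 < q := by positivity
  have hsq : √q * √q = q := Real.mul_self_sqrt hq0.le
  have hsq0 : 0 < √q := Real.sqrt_pos.2 hq0
  set l := √q / σ with hl
  have hl0 : 0 < l := by positivity
  have hup : ∫⁻ g, ENNReal.ofReal (N g ^ (2 * j)) ∂(stdGaussian F) ≤
      ENNReal.ofReal ((q / l) ^ (2 * j) * exp (l * M) * exp (l ^ 2 * σ ^ 2)) := by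
    calc ∫⁻ g, ENNReal.ofReal (N g ^ (2 * j)) ∂(stdGaussian F)
        ≤ ∫⁻ g, ENNReal.ofReal ((q / l) ^ (2 * j) * exp (l * M)) *
            ENNReal.ofReal (exp (l * (N g - M))) ∂(stdGaussian F) := by
          refine lintegral_mono fun g => ?_
          dsimp only
          rw [← ENNReal.ofReal_mul (by positivity)]
          apply ENNReal.ofReal_le_ofReal
          have h1 := pow_le_factorial_mul_exp (2 * j) (x := l * N g)
            (mul_nonneg hl0.le (apply_nonneg N g))
          have h2 : ((2 * j).factorial : ℝ) ≤ q ^ (2 * j) := by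
            have := Nat.factorial_le_pow (2 * j)
            rw [hq]
            exact_mod_cast this
          rw [mul_assoc, ← Real.exp_add, show l * M + l * (N g - M) = l * N g by ring, div_pow,
            div_mul_eq_mul_div, le_div_iff₀ (by positivity), mul_comm, ← mul_pow]
          refine h1.trans (by gcongr)
      _ = ENNReal.ofReal ((q / l) ^ (2 * j) * exp (l * M)) *
            ∫⁻ g, ENNReal.ofReal (exp (l * (N g - M))) ∂(stdGaussian F) :=
          lintegral_const_mul _ (by fun_prop)
      _ ≤ ENNReal.ofReal ((q / l) ^ (2 * j) * exp (l * M)) *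
            ENNReal.ofReal (exp (l ^ 2 * σ ^ 2)) :=
          mul_le_mul_right (gauss_lintegral_exp_le hlip hNc.measurable l) _
      _ = _ := by rw [← ENNReal.ofReal_mul (by positivity)]
  have h1 := hlow.trans hup
  rw [ENNReal.ofReal_le_ofReal_iff (by positivity)] at h1
  have hl2 : l ^ 2 * σ ^ 2 = q := by
    rw [hl]; field_simp; rw [sq, hsq]
  have hlM : l * M < q := by
    calc l * M < l * (√q * σ) := by gcongr
      _ = q := by rw [hl]; field_simp; rw [sq, hsq]
  have hql : q / l = √q * σ := by
    rw [hl]; field_simp; rw [sq, hsq]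
  have h2 : (q / l) ^ (2 * j) * exp (l * M) * exp (l ^ 2 * σ ^ 2) < (q * σ ^ 2 * exp 4) ^ j := by
    calc (q / l) ^ (2 * j) * exp (l * M) * exp (l ^ 2 * σ ^ 2)
        < (q / l) ^ (2 * j) * exp q * exp q := by rw [hl2]; gcongr
      _ = _ := by
        rw [hql, pow_mul, mul_pow (√q), sq (√q), hsq, mul_pow _ (exp 4), ← Real.exp_nat_mul,
          mul_assoc, ← Real.exp_add, hq]
        ring_nf
  have h3 : (q * σ ^ 2 * exp 4) ^ j ≤ (j / 4 * V) ^ j := by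
    apply pow_le_pow_left₀ (by positivity)
    rw [hq]
    nlinarith
  linarith

end Eigenvalue

section EigenvalueBound

variable {F : Type*} [NormedAddCommGroup F] [InnerProductSpace ℝ F] [FiniteDimensional ℝ F]
  [MeasurableSpace F] [BorelSpace F]

lemma lintegral_inner_pow_le_of_exp_sq {κ : Measure F} {β : ℝ} (hβ : 0 < β)
    (hpsi : ∀ z, ∫⁻ y, ENNReal.ofReal (exp (⟪y, z⟫ ^ 2 / (β ^ 2 * ‖z‖ ^ 2))) ∂κ ≤ 2)
    {j : ℕ} (hj : 0 < j) (z : F) :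
    ∫⁻ y, ENNReal.ofReal (⟪y, z⟫ ^ (2 * j)) ∂κ ≤
      ENNReal.ofReal ((2 * β * √j * ‖z‖) ^ (2 * j)) := by
  rcases eq_or_ne z 0 with rfl | hz
  · simp [hj.ne']
  have hz0 : 0 < ‖z‖ := norm_pos_iff.2 hz
  calc ∫⁻ y, ENNReal.ofReal (⟪y, z⟫ ^ (2 * j)) ∂κ
      ≤ ∫⁻ y, ENNReal.ofReal ((β * ‖z‖) ^ (2 * j) * j ^ j) *
          ENNReal.ofReal (exp (⟪y, z⟫ ^ 2 / (β ^ 2 * ‖z‖ ^ 2))) ∂κ := by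
        refine lintegral_mono fun y => ?_
        dsimp only
        rw [← ENNReal.ofReal_mul (by positivity)]
        apply ENNReal.ofReal_le_ofReal
        have h1 := pow_le_factorial_mul_exp j (x := ⟪y, z⟫ ^ 2 / (β ^ 2 * ‖z‖ ^ 2)) (by positivity)
        rw [div_pow, div_le_iff₀ (by positivity), ← pow_mul] at h1
        refine h1.trans ?_
        have : (j.factorial : ℝ) ≤ j ^ j := by exact_mod_cast Nat.factorial_le_pow j
        rw [pow_mul (β * ‖z‖), mul_pow β, mul_comm _ ((β ^ 2 * ‖z‖ ^ 2) ^ j), mul_assoc]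
        gcongr
    _ = ENNReal.ofReal ((β * ‖z‖) ^ (2 * j) * j ^ j) *
          ∫⁻ y, ENNReal.ofReal (exp (⟪y, z⟫ ^ 2 / (β ^ 2 * ‖z‖ ^ 2))) ∂κ :=
        lintegral_const_mul _ (by fun_prop)
    _ ≤ ENNReal.ofReal ((β * ‖z‖) ^ (2 * j) * j ^ j) * ENNReal.ofReal 2 := by
        refine mul_le_mul_right ((hpsi z).trans ?_) _
        simp
    _ ≤ _ := by
        rw [← ENNReal.ofReal_mul (by positivity)]
        apply ENNReal.ofReal_le_ofReal
        have h2 : (2:ℝ) ≤ 2 ^ (2 * j) := by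
          calc (2:ℝ) = 2 ^ 1 := by norm_num
            _ ≤ _ := pow_le_pow_right₀ (by norm_num) (by omega)
        have h3 : (√(j:ℝ)) ^ (2 * j) = (j:ℝ) ^ j := by
          rw [pow_mul, Real.sq_sqrt (by positivity)]
        calc (β * ‖z‖) ^ (2 * j) * j ^ j * 2 ≤ (β * ‖z‖) ^ (2 * j) * j ^ j * 2 ^ (2 * j) := by gcongr
          _ = _ := by rw [← h3]; ring

/-- Lower bound for the largest eigenvalue of the covariance of a symmetric log-concave
probability `η` dominating a subgaussian measure `κ`. -/
theorem mul_finrank_div_le_sqrt {κ η : Measure F} (hκ1 : κ Set.univ ≤ 1)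
    (hη : IsLogConcaveMeasure η) (hsymm : ∀ A, η (-A) = η A) (hη1 : η Set.univ = 1)
    {p lam a β p₀ n : ℝ} (hlam : 0 < lam) (ha : 0 < a) (hβ : 0 < β) (haβ : a ≤ β)
    (hpsi : ∀ z, ∫⁻ y, ENNReal.ofReal (exp (⟪y, z⟫ ^ 2 / (β ^ 2 * ‖z‖ ^ 2))) ∂κ ≤ 2)
    (hlow : ∀ z, ENNReal.ofReal (a ^ 2 * ‖z‖ ^ 2) ≤ ∫⁻ y, ENNReal.ofReal (⟪y, z⟫ ^ 2) ∂κ)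
    (htr : ∀ τ : ℝ, 0 ≤ τ → ∀ z, ∫⁻ y, ENNReal.ofReal (exp (τ * |⟪y, z⟫|)) ∂κ ≤
      ENNReal.ofReal (exp (2 * p)) *
        (∫⁻ y, ENNReal.ofReal (exp (2 * τ * |⟪y, z⟫|)) ∂η) ^ (1 / 2 : ℝ))
    (hη2 : ∀ z, ∫⁻ y, ENNReal.ofReal (⟪y, z⟫ ^ 2) ∂η ≤ ENNReal.ofReal (2 * lam * ‖z‖ ^ 2))
    (hk : 0 < Module.finrank ℝ F) (hkn : Module.finrank ℝ F ≤ n) (hp₀ : 160 ≤ p₀)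
    (hp : p ≤ p₀ * (1 + n / (280000 * β ^ 2 / a ^ 2))) :
    a * Module.finrank ℝ F / (75000 * p₀ * n) ≤ √lam := by
  set k := Module.finrank ℝ F with hkdef
  set D := 280000 * β ^ 2 / a ^ 2 with hD
  have hk0 : (0:ℝ) < k := by exact_mod_cast hk
  have hn0 : 0 < n := hk0.trans_le hkn
  have hD1 : 1 ≤ D := by
    rw [hD, le_div_iff₀ (by positivity)]
    nlinarith
  have hD0 : 0 < D := by linarith
  have hp₀0 : 0 < p₀ := by linarith
  rcases lt_or_ge (k:ℝ) D with hkD | hkD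
  · -- a single direction suffices
    have : Nontrivial F := Module.nontrivial_of_finrank_pos hk
    obtain ⟨e, he⟩ := exists_norm_eq (E := F) zero_le_one
    have h := mul_le_of_exp_moment_transfer (m := 1) (j := 1) (r := a) (Z := 1)
      (Q := p₀ * (1 + n / D)) hκ1 hη hsymm hη1 hlam one_pos one_pos htr hη2 (fun _ => e)
      (by simp [he]) ha.le one_pos (fun x => by
        refine le_trans (le_of_eq ?_) (hlow _)
        simp [norm_smul, he, mul_pow, EuclideanSpace.norm_eq, Real.sqrt_sq_eq_abs]) hp
      (by
        have : 0 ≤ n / D := by positivity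
        push_cast; nlinarith) (by
        have : 0 ≤ n / D := by positivity
        push_cast; nlinarith)
    have h2 : k * (1 + n / D) ≤ 2 * n := by
      have : k * (n / D) ≤ n := by
        rw [mul_div_assoc', div_le_iff₀ hD0]; nlinarith
      nlinarith
    rw [div_le_iff₀ (by positivity)]
    have hs := Real.sqrt_nonneg lam
    calc a * k ≤ (2000 * (p₀ * (1 + n / D)) * √lam) * k := by
          gcongr; simpa using h
      _ = 2000 * p₀ * √lam * (k * (1 + n / D)) := by ring
      _ ≤ 2000 * p₀ * √lam * (2 * n) := by gcongr
      _ ≤ √lam * (75000 * p₀ * n) := by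
          have : 0 ≤ √lam * (p₀ * n) := by positivity
          nlinarith
  · set m := ⌊k / D⌋₊ with hm
    have hm1 : 1 ≤ m := Nat.le_floor (by push_cast; exact (one_le_div hD0).2 hkD)
    have hm1' : (1:ℝ) ≤ m := by exact_mod_cast hm1
    have hm0 : (0:ℝ) < m := by linarith
    have hmle : (m:ℝ) ≤ k / D := Nat.floor_le (by positivity)
    have hmge : k / (2 * D) ≤ m := by
      have := Nat.lt_floor_add_one ((k:ℝ) / D)
      have h2 : (k:ℝ) / (2 * D) = k / D / 2 := by field_simp
      rw [h2]
      rw [← hm] at this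
      linarith
    have hj : 0 < 160 * m := by omega
    have hub := fun z => lintegral_inner_pow_le_of_exp_sq hβ hpsi hj z
    set σ := 2 * β * √((160 * m : ℕ) : ℝ) with hσ
    have hσ0 : 0 < σ := by positivity
    have hσ2 : σ ^ 2 = 640 * β ^ 2 * m := by
      rw [hσ, mul_pow, Real.sq_sqrt (by positivity)]; push_cast; ring
    have hfin : ∀ z : F, ∫⁻ y, ENNReal.ofReal (⟪y, z⟫ ^ (2 * (160 * m))) ∂κ ≠ ∞ :=
      fun z => ((hub z).trans_lt ENNReal.ofReal_lt_top).ne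
    have hV : ENNReal.ofReal (k * a ^ 2) ≤ ∫⁻ y, ENNReal.ofReal (‖y‖ ^ 2) ∂κ := by
      let b := stdOrthonormalBasis ℝ F
      have h1 : ∀ y : F, ENNReal.ofReal (‖y‖ ^ 2) = ∑ i, ENNReal.ofReal (⟪y, b i⟫ ^ 2) := by
        intro y
        rw [← ENNReal.ofReal_sum_of_nonneg (fun i _ => sq_nonneg _), ← b.sum_sq_inner_left y]
      simp_rw [h1]
      rw [lintegral_finsetSum _ (fun i _ => by fun_prop)]
      calc ENNReal.ofReal (k * a ^ 2) = ∑ i : Fin k, ENNReal.ofReal (a ^ 2 * ‖b i‖ ^ 2) := by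
            simp [ENNReal.ofReal_mul]
        _ ≤ _ := Finset.sum_le_sum fun i _ => hlow (b i)
    have he : exp 4 ≤ 54.6 := by
      have := Real.exp_one_lt_d9
      calc exp 4 = exp 1 ^ 4 := by rw [← Real.exp_nat_mul]; norm_num
        _ ≤ 2.7182818286 ^ 4 := by gcongr
        _ ≤ 54.6 := by norm_num
    have hcond : 8 * exp 4 * σ ^ 2 ≤ k * a ^ 2 := by
      rw [hσ2]
      have h1 : (m:ℝ) * (280000 * β ^ 2) ≤ k * a ^ 2 := by
        rw [le_div_iff₀ hD0, hD, mul_div_assoc', div_le_iff₀ (by positivity)] at hmle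
        exact hmle
      have h2 : 0 ≤ β ^ 2 * m := by positivity
      nlinarith
    obtain ⟨hNσ, hNM⟩ := sqrt_mul_le_integral_momentSeminorm hκ1 hj hfin hσ0 hub hV hcond
    set N := momentSeminorm κ (160 * m) hj hfin with hN
    set M := ∫ z, N z ∂(stdGaussian F) with hM
    have hM0 : 0 < M := lt_of_lt_of_le (by positivity) hNM
    have hM2 : 320 * m * σ ^ 2 ≤ M ^ 2 := by
      have := pow_le_pow_left₀ (by positivity) hNM 2
      rw [mul_pow, Real.sq_sqrt (by positivity)] at this
      push_cast at this
      linarith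
    have hM3 : 320 * β * m ≤ M := by
      refine le_of_sq_le_sq ?_ hM0.le
      rw [hσ2] at hM2
      have : 0 ≤ β ^ 2 * (m:ℝ) ^ 2 := by positivity
      nlinarith
    obtain ⟨z, hz, hzN⟩ := exists_combo_lower_bound (by omega : 0 < m) hσ0 hNσ hM0 hM2
    have hQ1 : (n:ℝ) / D ≥ 1 := (one_le_div hD0).2 (hkD.trans hkn)
    have hQ2 : (m:ℝ) ≤ n / D := hmle.trans (by gcongr)
    have hQ3 : 160 * (n / D) ≤ p₀ * (n / D) := by gcongr
    have hQ4 : p₀ ≤ p₀ * (n / D) := le_mul_of_one_le_right hp₀0.le hQ1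
    have h := mul_le_of_exp_moment_transfer (m := m) (j := 160 * m) (r := 160 * β * m)
      (Z := √(4 * m * k)) (Q := 2 * p₀ * (n / D)) hκ1 hη hsymm hη1 hlam (by positivity) (by omega)
      htr hη2 z (by rw [Real.sq_sqrt (by positivity)]; exact hz) (by positivity) hj (fun x => by
        rw [← ofReal_momentSeminorm_pow hj hfin]
        apply ENNReal.ofReal_le_ofReal
        gcongr
        refine le_trans ?_ (hzN x)
        gcongr
        linarith) (hp.trans (by linarith)) (by linarith) (by push_cast; linarith)
    have hs := Real.sqrt_nonneg lam
    have h1 : √(4 * m * k) ≤ m * (1500 * β / a) := by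
      rw [Real.sqrt_le_iff]
      refine ⟨by positivity, ?_⟩
      have h2 : (k:ℝ) ≤ m * (2 * D) := by
        rwa [div_le_iff₀ (by positivity)] at hmge
      calc 4 * m * (k:ℝ) ≤ 4 * m * (m * (2 * D)) := by gcongr
        _ = m ^ 2 * (2240000 * β ^ 2 / a ^ 2) := by rw [hD]; ring
        _ ≤ m ^ 2 * (2250000 * β ^ 2 / a ^ 2) := by gcongr; norm_num
        _ = _ := by field_simp; ring
    have h2 : 160 * β * m * m ≤ 2000 * (2 * p₀ * (n / D)) * √lam * (m * (1500 * β / a)) :=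
      h.trans (by gcongr)
    have h3 : m * a ≤ 37500 * p₀ * (n / D) * √lam := by
      have h4 : 160 * β * m * m = (m * a) * (160 * β * m / a) := by field_simp
      have h5 : 2000 * (2 * p₀ * (n / D)) * √lam * (m * (1500 * β / a)) =
        (37500 * p₀ * (n / D) * √lam) * (160 * β * m / a) := by field_simp; ring
      rw [h4, h5] at h2
      exact le_of_mul_le_mul_right h2 (by positivity)
    rw [div_le_iff₀ (by positivity)]
    have h4 : k / (2 * D) * a ≤ 37500 * p₀ * (n / D) * √lam := le_trans (by gcongr) h3
    have h5 : k / (2 * D) * a = a * k * (1 / (2 * D)) := by ring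
    have h6 : 37500 * p₀ * (n / D) * √lam = √lam * (75000 * p₀ * n) * (1 / (2 * D)) := by
      field_simp; ring
    rw [h5, h6] at h4
    exact le_of_mul_le_mul_right h4 (by positivity)

end EigenvalueBound

section Tilt

set_option linter.unusedSectionVars false

variable {E : Type*} [NormedAddCommGroup E] [InnerProductSpace ℝ E] [FiniteDimensional ℝ E]
  [MeasurableSpace E] [BorelSpace E]

/-- The distribution of the difference of two independent copies. -/
noncomputable def diffMeasure (ν : Measure E) : Measure E := (ν.prod ν).map fun p => p.1 - p.2

lemma lintegral_diffMeasure (ν : Measure E) {f : E → ℝ≥0∞} (hf : Measurable f) :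
    ∫⁻ y, f y ∂(diffMeasure ν) = ∫⁻ p, f (p.1 - p.2) ∂(ν.prod ν) :=
  lintegral_map hf (by fun_prop)

lemma diffMeasure_neg (ν : Measure E) [SFinite ν] (A : Set E) :
    diffMeasure ν (-A) = diffMeasure ν A := by
  have h : (diffMeasure ν).map (MeasurableEquiv.neg E) = diffMeasure ν := by
    unfold diffMeasure
    rw [Measure.map_map (MeasurableEquiv.measurable _) (by fun_prop)]
    conv_rhs => rw [← Measure.prod_swap, Measure.map_map (by fun_prop) measurable_swap]
    congr 1
    ext p
    simp
  conv_rhs => rw [← h, MeasurableEquiv.map_apply]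
  rfl

lemma diffMeasure_univ (ν : Measure E) [SFinite ν] :
    diffMeasure ν Set.univ = ν Set.univ * ν Set.univ := by
  unfold diffMeasure
  rw [Measure.map_apply (by fun_prop) MeasurableSet.univ, Set.preimage_univ,
    ← Set.univ_prod_univ, Measure.prod_prod]

lemma isLogConcaveMeasure_diffMeasure {w : E → ℝ≥0∞} (hw : Measurable w)
    (hlc : ∀ a b : ℝ, 0 < a → 0 < b → a + b = 1 → ∀ x y, w x ^ a * w y ^ b ≤ w (a • x + b • y)) :
    IsLogConcaveMeasure (diffMeasure ((volume : Measure E).withDensity w)) := by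
  unfold diffMeasure
  rw [prod_withDensity hw hw]
  refine IsLogConcaveMeasure.map (V := E × E)
    ((prekopaLeindler_innerProductSpace.prod prekopaLeindler_innerProductSpace).isLogConcaveMeasure
      (by fun_prop) ?_) (LinearMap.fst ℝ E E - LinearMap.snd ℝ E E) (by
        change Measurable fun p : E × E => p.1 - p.2
        fun_prop)
  intro a b ha hb hab x y
  rw [ENNReal.mul_rpow_of_nonneg _ _ ha.le, ENNReal.mul_rpow_of_nonneg _ _ hb.le, mul_mul_mul_comm]
  exact mul_le_mul' (hlc a b ha hb hab x.1 y.1) (hlc a b ha hb hab x.2 y.2)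

/-- The normalising constant of an exponential tilt of the uniform measure on `S`. -/
noncomputable def tiltZ (S : Set E) (u : E) : ℝ := ∫ x in S, exp ⟪u, x⟫

/-- The exponential tilt of the uniform measure on `S`. -/
noncomputable def tiltMeasure (S : Set E) (u : E) : Measure E :=
  ((volume : Measure E).restrict S).withDensity fun x => ENNReal.ofReal (exp ⟪u, x⟫ / tiltZ S u)

variable {S : Set E} (hSk : IsCompact S) (hS0 : 0 < volume S)

include hSk

lemma integrableOn_of_continuous {V : Type*} [NormedAddCommGroup V] {f : E → V}
    (hf : Continuous f) : Integrable f (volume.restrict S) :=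
  hf.continuousOn.integrableOn_compact hSk

include hS0

lemma tiltZ_pos (u : E) : 0 < tiltZ S u := by
  unfold tiltZ
  rw [setIntegral_pos_iff_support_of_nonneg_ae (Filter.Eventually.of_forall fun x => (exp_pos _).le)
    (integrableOn_of_continuous hSk (by fun_prop))]
  have : Function.support (fun x : E => exp ⟪u, x⟫) = Set.univ := by
    ext x; simp
  rwa [this, Set.univ_inter]

lemma ofReal_tiltZ (u : E) :
    ENNReal.ofReal (tiltZ S u) = ∫⁻ x in S, ENNReal.ofReal (exp ⟪u, x⟫) :=
  ofReal_integral_eq_lintegral_ofReal (integrableOn_of_continuous hSk (by fun_prop))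
    (Filter.Eventually.of_forall fun x => (exp_pos _).le)

lemma isProbabilityMeasure_tiltMeasure (u : E) : IsProbabilityMeasure (tiltMeasure S u) := by
  constructor
  unfold tiltMeasure
  have hZ := tiltZ_pos hSk hS0 u
  rw [withDensity_apply _ MeasurableSet.univ, Measure.restrict_univ]
  simp_rw [div_eq_inv_mul, ENNReal.ofReal_mul (inv_pos.2 hZ).le]
  rw [lintegral_const_mul _ (by fun_prop), ← ofReal_tiltZ hSk hS0,
    ← ENNReal.ofReal_mul (inv_pos.2 hZ).le, inv_mul_cancel₀ hZ.ne', ENNReal.ofReal_one]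

lemma integral_tiltMeasure {V : Type*} [NormedAddCommGroup V] [NormedSpace ℝ V] (u : E)
    (f : E → V) : ∫ x, f x ∂(tiltMeasure S u) =
      (tiltZ S u)⁻¹ • ∫ x in S, exp ⟪u, x⟫ • f x := by
  have hZ := tiltZ_pos hSk hS0 u
  unfold tiltMeasure
  rw [integral_withDensity_eq_integral_toReal_smul (by fun_prop)
    (Filter.Eventually.of_forall fun _ => ENNReal.ofReal_lt_top), ← integral_smul]
  refine integral_congr_ae (Filter.Eventually.of_forall fun x => ?_)
  dsimp only
  rw [ENNReal.toReal_ofReal (by positivity), smul_smul, div_eq_inv_mul]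

lemma ae_mem_tiltMeasure (u : E) : ∀ᵐ x ∂(tiltMeasure S u), x ∈ S :=
  (withDensity_absolutelyContinuous _ _).ae_le (ae_restrict_mem hSk.measurableSet)

lemma isLogConcaveMeasure_diffMeasure_tilt (hSc : Convex ℝ S) (u : E) :
    IsLogConcaveMeasure (diffMeasure (tiltMeasure S u)) := by
  have hZ := tiltZ_pos hSk hS0 u
  unfold tiltMeasure
  rw [← withDensity_indicator hSk.measurableSet]
  refine isLogConcaveMeasure_diffMeasure
    (Measurable.indicator (by fun_prop) hSk.measurableSet) ?_
  intro a b ha hb hab x y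
  by_cases hx : x ∈ S
  · by_cases hy : y ∈ S
    · rw [Set.indicator_of_mem hx, Set.indicator_of_mem hy,
        Set.indicator_of_mem (hSc hx hy ha.le hb.le hab),
        ENNReal.ofReal_rpow_of_pos (by positivity), ENNReal.ofReal_rpow_of_pos (by positivity),
        ← ENNReal.ofReal_mul (by positivity)]
      apply ENNReal.ofReal_le_ofReal
      rw [Real.div_rpow (exp_pos _).le hZ.le, Real.div_rpow (exp_pos _).le hZ.le,
        div_mul_div_comm, ← Real.rpow_add hZ, hab, Real.rpow_one, ← Real.exp_mul, ← Real.exp_mul,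
        ← Real.exp_add]
      apply le_of_eq
      rw [inner_add_right, inner_smul_right, inner_smul_right, mul_comm a, mul_comm b]
    · simp [hy, ENNReal.zero_rpow_of_pos hb]
  · simp [hx, ENNReal.zero_rpow_of_pos ha]

lemma lintegral_diffMeasure_le_tilt (u : E) {g : E → ℝ≥0∞} (hg : Measurable g) :
    ∫⁻ y, g y ∂(diffMeasure (volume.restrict S)) ≤ ENNReal.ofReal (tiltZ S u * tiltZ S (-u)) *
      (∫⁻ y, g y ^ 2 ∂(diffMeasure (tiltMeasure S u))) ^ (1 / 2 : ℝ) := by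
  have hZ := tiltZ_pos hSk hS0 u
  have hZ' := tiltZ_pos hSk hS0 (-u)
  have hfin : IsFiniteMeasure ((volume : Measure E).restrict S) :=
    ⟨by simpa using hSk.measure_lt_top⟩
  rw [lintegral_diffMeasure _ hg, lintegral_diffMeasure _ (by fun_prop)]
  set P := ((volume : Measure E).restrict S).prod ((volume : Measure E).restrict S) with hP
  set w : E → ℝ≥0∞ := fun x => ENNReal.ofReal (exp ⟪u, x⟫ / tiltZ S u) with hw
  have hwm : Measurable w := by fun_prop
  have hw0 : ∀ x, w x ≠ 0 := fun x => by
    rw [hw]; simp only [ne_eq, ENNReal.ofReal_eq_zero, not_le]; positivity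
  have hwt : ∀ x, w x ≠ ∞ := fun x => ENNReal.ofReal_ne_top
  have hprod : (tiltMeasure S u).prod (tiltMeasure S u) =
      P.withDensity fun p => w p.1 * w p.2 := prod_withDensity hwm hwm
  rw [hprod, lintegral_withDensity_eq_lintegral_mul _ (by fun_prop) (by fun_prop)]
  have hinv : ∫⁻ p, (w p.1 * w p.2)⁻¹ ∂P = ENNReal.ofReal (tiltZ S u * tiltZ S (-u)) ^ 2 := by
    have h1 : ∀ p : E × E, (w p.1 * w p.2)⁻¹ = (w p.1)⁻¹ * (w p.2)⁻¹ := fun p =>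
      ENNReal.mul_inv (Or.inl (hw0 _)) (Or.inl (hwt _))
    simp_rw [h1]
    rw [lintegral_prod_mul (f := fun x => (w x)⁻¹) (g := fun x => (w x)⁻¹) (by fun_prop) (by fun_prop), sq]
    have h2 : ∫⁻ x in S, (w x)⁻¹ = ENNReal.ofReal (tiltZ S u * tiltZ S (-u)) := by
      rw [ENNReal.ofReal_mul hZ.le, ofReal_tiltZ hSk hS0 (-u), ← lintegral_const_mul _ (by fun_prop)]
      refine lintegral_congr fun x => ?_
      rw [hw, ← ENNReal.ofReal_inv_of_pos (by positivity), ← ENNReal.ofReal_mul hZ.le, inv_div,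
        inner_neg_left, Real.exp_neg, div_eq_mul_inv]
    rw [h2]
  have hH := ENNReal.lintegral_mul_norm_pow_le (μ := P) (p := 1 / 2) (q := 1 / 2)
    (f := fun p => (w p.1 * w p.2) * g (p.1 - p.2) ^ 2) (g := fun p => (w p.1 * w p.2)⁻¹)
    (by fun_prop) (by fun_prop) (by norm_num) (by norm_num) (by norm_num)
  rw [hinv] at hH
  calc ∫⁻ p, g (p.1 - p.2) ∂P
      = ∫⁻ p, ((w p.1 * w p.2) * g (p.1 - p.2) ^ 2) ^ (1 / 2 : ℝ) *
          ((w p.1 * w p.2)⁻¹) ^ (1 / 2 : ℝ) ∂P := by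
        refine lintegral_congr fun p => ?_
        rw [← ENNReal.mul_rpow_of_nonneg _ _ (by norm_num), mul_right_comm,
          ENNReal.mul_inv_cancel (mul_ne_zero (hw0 _) (hw0 _)) (ENNReal.mul_ne_top (hwt _) (hwt _)),
          one_mul, ← ENNReal.rpow_natCast, ← ENNReal.rpow_mul]
        norm_num
    _ ≤ _ := hH
    _ = _ := by
        rw [mul_comm]
        congr 1
        rw [← ENNReal.rpow_natCast, ← ENNReal.rpow_mul]
        norm_num

end Tilt

section TiltMean

set_option linter.unusedSectionVars false

variable {E : Type*} [NormedAddCommGroup E] [InnerProductSpace ℝ E] [FiniteDimensional ℝ E]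
  [MeasurableSpace E] [BorelSpace E]
variable {S : Set E} (hSk : IsCompact S) (hS0 : 0 < volume S)

/-- The barycentre of the tilted measure. -/
noncomputable def tiltMean (S : Set E) (u : E) : E :=
  (tiltZ S u)⁻¹ • ∫ x in S, exp ⟪u, x⟫ • x

include hSk

lemma hasFDerivAt_integral_exp_smul {V : Type*} [NormedAddCommGroup V] [NormedSpace ℝ V]
    [CompleteSpace V] {φ : E → V} (hφ : Continuous φ) (u : E) :
    HasFDerivAt (fun u => ∫ x in S, exp ⟪u, x⟫ • φ x)
      (∫ x in S, exp ⟪u, x⟫ • (innerSL ℝ x).smulRight (φ x)) u := by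
  have hc : Continuous fun x : E => (innerSL ℝ x).smulRight (φ x) :=
    (ContinuousLinearMap.smulRightL ℝ E V).continuous₂.comp
      ((innerSL ℝ).continuous.prodMk hφ)
  refine hasFDerivAt_integral_of_dominated_of_fderiv_le
    (F' := fun u x => exp ⟪u, x⟫ • (innerSL ℝ x).smulRight (φ x))
    (bound := fun x => exp ((‖u‖ + 1) * ‖x‖) * (‖x‖ * ‖φ x‖))
    (Metric.ball_mem_nhds u one_pos) ?_ ?_ ?_ ?_ ?_ ?_
  · exact Filter.Eventually.of_forall fun v =>
      (integrableOn_of_continuous hSk (by fun_prop)).aestronglyMeasurable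
  · exact integrableOn_of_continuous hSk (by fun_prop)
  · exact (integrableOn_of_continuous hSk (by fun_prop)).aestronglyMeasurable
  · refine Filter.Eventually.of_forall fun x v hv => ?_
    rw [norm_smul, ContinuousLinearMap.norm_smulRight_apply, innerSL_apply_norm,
      Real.norm_of_nonneg (exp_pos _).le]
    gcongr
    have h1 : ‖v‖ ≤ ‖u‖ + 1 := by
      have := norm_sub_norm_le v u
      rw [Metric.mem_ball, dist_eq_norm] at hv
      linarith
    calc ⟪v, x⟫ ≤ ‖v‖ * ‖x‖ := real_inner_le_norm _ _
      _ ≤ _ := by gcongr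
  · exact integrableOn_of_continuous hSk (by fun_prop)
  · refine Filter.Eventually.of_forall fun x v _ => ?_
    have h1 : HasFDerivAt (fun v : E => ⟪v, x⟫) (innerSL ℝ x) v := by
      have := (innerSL ℝ x).hasFDerivAt (x := v)
      refine this.congr_of_eventuallyEq (Filter.Eventually.of_forall fun w => ?_)
      simp [real_inner_comm]
    have h2 := (h1.exp).smul_const (φ x)
    convert h2 using 1
    ext w
    simp [smul_smul]

include hS0

/-- The derivative of `tiltMean`. -/
noncomputable def tiltCov (S : Set E) (u : E) : E →L[ℝ] E :=
  (tiltZ S u)⁻¹ • (∫ x in S, exp ⟪u, x⟫ • (innerSL ℝ x).smulRight x) +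
    (-(tiltZ S u ^ 2)⁻¹ • (∫ x in S, exp ⟪u, x⟫ • innerSL ℝ x)).smulRight
      (∫ x in S, exp ⟪u, x⟫ • x)

lemma hasFDerivAt_tiltMean (u : E) : HasFDerivAt (tiltMean S) (tiltCov S u) u := by
  have hZ := tiltZ_pos hSk hS0 u
  have h1 : HasFDerivAt (tiltZ S) (∫ x in S, exp ⟪u, x⟫ • innerSL ℝ x) u := by
    have := hasFDerivAt_integral_exp_smul hSk (φ := fun _ : E => (1 : ℝ)) (by fun_prop) u
    have e1 : (fun u : E => ∫ x in S, exp ⟪u, x⟫ • (1 : ℝ)) = tiltZ S := by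
      ext v; simp [tiltZ]
    have e2 : ∀ x : E, (innerSL ℝ x).smulRight (1 : ℝ) = innerSL ℝ x := fun x => by
      ext v; simp
    simp_rw [e2] at this
    rwa [e1] at this
  have h2 := (hasDerivAt_inv hZ.ne').comp_hasFDerivAt u h1
  exact h2.smul (hasFDerivAt_integral_exp_smul hSk continuous_id u)

lemma inner_tiltCov (u v w : E) : ⟪tiltCov S u v, w⟫ =
    (∫ x, ⟪x, v⟫ * ⟪x, w⟫ ∂(tiltMeasure S u)) -
      (∫ x, ⟪x, v⟫ ∂(tiltMeasure S u)) * ∫ x, ⟪x, w⟫ ∂(tiltMeasure S u) := by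
  have hZ := tiltZ_pos hSk hS0 u
  rw [integral_tiltMeasure hSk hS0, integral_tiltMeasure hSk hS0, integral_tiltMeasure hSk hS0]
  have hc : Continuous fun x : E => (innerSL ℝ x).smulRight x :=
    (ContinuousLinearMap.smulRightL ℝ E E).continuous₂.comp
      ((innerSL ℝ).continuous.prodMk continuous_id)
  unfold tiltCov
  simp only [add_apply, smul_apply,
    ContinuousLinearMap.smulRight_apply, inner_add_left, real_inner_smul_left]
  rw [ContinuousLinearMap.integral_apply (integrableOn_of_continuous hSk (by fun_prop)),
    ContinuousLinearMap.integral_apply (integrableOn_of_continuous hSk (by fun_prop)),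
    real_inner_comm, real_inner_comm w,
    ← integral_inner (integrableOn_of_continuous hSk (by fun_prop)),
    ← integral_inner (integrableOn_of_continuous hSk (by fun_prop))]
  simp only [smul_apply, ContinuousLinearMap.smulRight_apply,
    innerSL_apply_apply, smul_eq_mul, real_inner_comm _ w, real_inner_smul_left]
  field_simp
  ring

/-- Twice the covariance form is the second moment of the difference of two copies. -/
lemma lintegral_inner_sq_diffMeasure (u v : E) :
    ∫⁻ y, ENNReal.ofReal (⟪y, v⟫ ^ 2) ∂(diffMeasure (tiltMeasure S u)) =
      ENNReal.ofReal (2 * ⟪tiltCov S u v, v⟫) := by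
  have hprob := isProbabilityMeasure_tiltMeasure hSk hS0 u
  set ν := tiltMeasure S u with hν
  have h_int : ∀ f : E → ℝ, Continuous f → Integrable f ν := by
    intro f hf
    obtain ⟨M, hM⟩ := hSk.exists_bound_of_continuousOn hf.continuousOn
    refine Integrable.of_bound hf.aestronglyMeasurable M ?_
    filter_upwards [ae_mem_tiltMeasure hSk hS0 u] with x hx using hM x hx
  have i1 : Integrable (fun x => ⟪x, v⟫) ν := h_int _ (by fun_prop)
  have i2 : Integrable (fun x => ⟪x, v⟫ ^ 2) ν := h_int _ (by fun_prop)
  have j1 : Integrable (fun p : E × E => ⟪p.1, v⟫ ^ 2) (ν.prod ν) := i2.comp_fst ν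
  have j2 : Integrable (fun p : E × E => ⟪p.2, v⟫ ^ 2) (ν.prod ν) := i2.comp_snd ν
  have j3 : Integrable (fun p : E × E => ⟪p.1, v⟫ * ⟪p.2, v⟫) (ν.prod ν) := i1.mul_prod i1
  have heq : ∀ p : E × E, ⟪p.1 - p.2, v⟫ ^ 2 =
      ⟪p.1, v⟫ ^ 2 + ⟪p.2, v⟫ ^ 2 - 2 * (⟪p.1, v⟫ * ⟪p.2, v⟫) := fun p => by
    rw [inner_sub_left]; ring
  have j4 : Integrable (fun p : E × E => ⟪p.1 - p.2, v⟫ ^ 2) (ν.prod ν) := by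
    simp_rw [heq]
    exact (j1.add j2).sub (j3.const_mul 2)
  rw [lintegral_diffMeasure _ (by fun_prop), ← ofReal_integral_eq_lintegral_ofReal j4
    (Filter.Eventually.of_forall fun p => sq_nonneg _), inner_tiltCov hSk hS0]
  congr 1
  simp_rw [heq]
  rw [integral_sub (f := fun p : E × E => ⟪p.1, v⟫ ^ 2 + ⟪p.2, v⟫ ^ 2) (j1.add j2)
    (j3.const_mul 2), integral_add j1 j2, integral_const_mul,
    integral_prod_mul (fun x => ⟪x, v⟫) (fun x => ⟪x, v⟫),
    integral_fun_fst (μ := ν) (ν := ν) (fun x => ⟪x, v⟫ ^ 2),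
    integral_fun_snd (μ := ν) (ν := ν) (fun x => ⟪x, v⟫ ^ 2)]
  simp only [probReal_univ, one_smul, hν]
  simp only [← sq]
  ring

lemma tiltCov_symm (u : E) : (tiltCov S u).toLinearMap.IsSymmetric := by
  intro v w
  simp only [ContinuousLinearMap.coe_coe]
  rw [inner_tiltCov hSk hS0, real_inner_comm, inner_tiltCov hSk hS0, mul_comm (∫ x, ⟪x, v⟫ ∂_)]
  simp only [mul_comm]

/-- Nondegeneracy of `S` passes to the tilted covariances. -/
lemma inner_tiltCov_pos (hnd : ∀ v : E, v ≠ 0 →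
      ∫⁻ y, ENNReal.ofReal (⟪y, v⟫ ^ 2) ∂(diffMeasure (volume.restrict S)) ≠ 0)
    (u v : E) (hv : v ≠ 0) : 0 < ⟪tiltCov S u v, v⟫ := by
  by_contra! hcon
  have h0 := lintegral_inner_sq_diffMeasure hSk hS0 u v
  rw [ENNReal.ofReal_of_nonpos (by linarith), lintegral_eq_zero_iff (by fun_prop)] at h0
  apply hnd v hv
  have h1 := lintegral_diffMeasure_le_tilt hSk hS0 u
    (g := fun y => ENNReal.ofReal (⟪y, v⟫ ^ 2)) (by fun_prop)
  have h2 : ∫⁻ y, ENNReal.ofReal (⟪y, v⟫ ^ 2) ^ 2 ∂(diffMeasure (tiltMeasure S u)) = 0 := by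
    rw [lintegral_eq_zero_iff (by fun_prop)]
    filter_upwards [h0] with y hy
    simp only [Pi.zero_apply] at hy ⊢
    rw [hy]; simp
  rw [h2, ENNReal.zero_rpow_of_pos (by norm_num), mul_zero] at h1
  exact le_antisymm h1 bot_le

lemma tiltMean_mem (hSc : Convex ℝ S) (u : E) : tiltMean S u ∈ S := by
  have hprob := isProbabilityMeasure_tiltMeasure hSk hS0 u
  have h := integral_tiltMeasure hSk hS0 u (fun x : E => x)
  rw [tiltMean, ← h]
  refine hSc.integral_mem hSk.isClosed (ae_mem_tiltMeasure hSk hS0 u) ?_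
  obtain ⟨M, hM⟩ := hSk.exists_bound_of_continuousOn (f := fun x : E => x) continuousOn_id
  refine Integrable.of_bound (by fun_prop) M ?_
  filter_upwards [ae_mem_tiltMeasure hSk hS0 u] with x hx using hM x hx

lemma tiltMean_injective (hpos : ∀ u v : E, v ≠ 0 → 0 < ⟪tiltCov S u v, v⟫) :
    Function.Injective (tiltMean S) := by
  intro a b hab
  by_contra hne
  have hv : b - a ≠ 0 := sub_ne_zero.2 (Ne.symm hne)
  have hmono : StrictMono fun r : ℝ => ⟪tiltMean S (a + r • (b - a)), b - a⟫ := by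
    refine strictMono_of_hasDerivAt_pos
      (f' := fun r => ⟪tiltCov S (a + r • (b - a)) (b - a), b - a⟫) (fun r => ?_)
      fun r => hpos _ _ hv
    have h1 : HasDerivAt (fun r : ℝ => a + r • (b - a)) (b - a) r := by
      simpa using ((hasDerivAt_id r).smul_const (b - a)).const_add a
    have h2 := (hasFDerivAt_tiltMean hSk hS0 (a + r • (b - a))).comp_hasDerivAt r h1
    simpa using h2.inner ℝ (hasDerivAt_const r (b - a))
  have := hmono zero_lt_one
  simp [hab] at this

lemma lintegral_det_tiltCov_le (hSc : Convex ℝ S)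
    (hpos : ∀ u v : E, v ≠ 0 → 0 < ⟪tiltCov S u v, v⟫) {D : Set E} (hD : MeasurableSet D) :
    ∫⁻ u in D, ENNReal.ofReal |(tiltCov S u).det| ≤ volume S := by
  rw [lintegral_abs_det_fderiv_eq_addHaar_image volume hD
    (fun u _ => (hasFDerivAt_tiltMean hSk hS0 u).hasFDerivWithinAt)
    (tiltMean_injective hSk hS0 hpos).injOn]
  apply measure_mono
  rintro _ ⟨u, -, rfl⟩
  exact tiltMean_mem hSk hS0 hSc u

end TiltMean

section TiltDet

set_option linter.unusedSectionVars false

variable {E : Type*} [NormedAddCommGroup E] [InnerProductSpace ℝ E] [FiniteDimensional ℝ E]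
  [MeasurableSpace E] [BorelSpace E]

lemma LinearMap.IsSymmetric.inner_le_eigenvalue_mul {A : E →ₗ[ℝ] E} (hA : A.IsSymmetric) {n : ℕ}
    (hn : Module.finrank ℝ E = n) (j : Fin n) {z : E}
    (hz : ∀ i, i < j → ⟪hA.eigenvectorBasis hn i, z⟫ = 0) :
    ⟪A z, z⟫ ≤ hA.eigenvalues hn j * ‖z‖ ^ 2 := by
  rw [← (hA.eigenvectorBasis hn).sum_inner_mul_inner,
    ← (hA.eigenvectorBasis hn).sum_sq_norm_inner_right, Finset.mul_sum]
  refine Finset.sum_le_sum fun i _ => ?_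
  rw [hA, hA.apply_eigenvectorBasis, inner_smul_right, real_inner_comm, Real.norm_eq_abs, sq_abs]
  rcases lt_or_ge i j with h | h
  · rw [hz i h]; simp
  · have h1 := hA.eigenvalues_antitone hn h
    have h2 := mul_le_mul_of_nonneg_right h1 (sq_nonneg ⟪hA.eigenvectorBasis hn i, z⟫)
    simp only [RCLike.ofReal_real_eq_id, id_eq]
    linarith

lemma exists_subspace_finrank_eq {A : E →ₗ[ℝ] E} (hA : A.IsSymmetric) {n : ℕ}
    (hn : Module.finrank ℝ E = n) (j : Fin n) :
    ∃ W : Submodule ℝ E, Module.finrank ℝ W = n - j ∧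
      ∀ z ∈ W, ⟪A z, z⟫ ≤ hA.eigenvalues hn j * ‖z‖ ^ 2 := by
  set e : Fin (j : ℕ) → E := fun i => hA.eigenvectorBasis hn ⟨i, i.2.trans j.2⟩ with he
  refine ⟨(Submodule.span ℝ (Set.range e))ᗮ, ?_, fun z hz => ?_⟩
  · have h1 := Submodule.finrank_add_finrank_orthogonal (Submodule.span ℝ (Set.range e))
    have hli : LinearIndependent ℝ e :=
      (hA.eigenvectorBasis hn).orthonormal.linearIndependent.comp _ fun a b hab => by
        simpa [Fin.ext_iff] using hab
    rw [finrank_span_eq_card hli, Fintype.card_fin] at h1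
    omega
  · refine hA.inner_le_eigenvalue_mul hn j fun i hi => ?_
    exact (Submodule.mem_orthogonal _ _).1 hz _ (Submodule.subset_span ⟨⟨i, hi⟩, rfl⟩)

variable {S : Set E} (hSk : IsCompact S) (hS0 : 0 < volume S) (hSc : Convex ℝ S)
  (hS1 : volume S ≤ 1)
  {p lam a β p₀ : ℝ} (ha : 0 < a) (hβ : 0 < β) (haβ : a ≤ β)
  (hpsi : ∀ z : E, ∫⁻ y, ENNReal.ofReal (exp (⟪y, z⟫ ^ 2 / (β ^ 2 * ‖z‖ ^ 2)))
    ∂(diffMeasure (volume.restrict S)) ≤ 2)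
  (hlow : ∀ z : E, ENNReal.ofReal (a ^ 2 * ‖z‖ ^ 2) ≤
    ∫⁻ y, ENNReal.ofReal (⟪y, z⟫ ^ 2) ∂(diffMeasure (volume.restrict S)))
  {u : E} (hZ : tiltZ S u * tiltZ S (-u) ≤ exp (2 * p)) (hp₀ : 160 ≤ p₀)
  (hp : p ≤ p₀ * (1 + Module.finrank ℝ E / (280000 * β ^ 2 / a ^ 2)))

include hSk hS0 hSc hS1 ha hβ haβ hpsi hlow hZ hp₀ hp

lemma mul_finrank_subspace_div_le_sqrt (W : Submodule ℝ E) (hW : 0 < Module.finrank ℝ W)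
    (hlam : 0 < lam) (hq : ∀ z ∈ W, ⟪tiltCov S u z, z⟫ ≤ lam * ‖z‖ ^ 2) :
    a * Module.finrank ℝ W / (75000 * p₀ * Module.finrank ℝ E) ≤ √lam := by
  have hprob := isProbabilityMeasure_tiltMeasure hSk hS0 u
  have hfin : IsFiniteMeasure ((volume : Measure E).restrict S) :=
    ⟨by simpa using hSk.measure_lt_top⟩
  set T : E →ₗ[ℝ] W := (W.orthogonalProjectionOnto : E →L[ℝ] W).toLinearMap with hT
  have hTm : Measurable T := (W.orthogonalProjectionOnto : E →L[ℝ] W).continuous.measurable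
  have hTi : ∀ (y : E) (z : W), ⟪T y, z⟫ = ⟪y, (z : E)⟫ := fun y z =>
    Submodule.inner_orthogonalProjectionOnto_eq_of_mem_right z y
  refine mul_finrank_div_le_sqrt (κ := (diffMeasure (volume.restrict S)).map T)
    (η := (diffMeasure (tiltMeasure S u)).map T) (p := p) ?_
    ((isLogConcaveMeasure_diffMeasure_tilt hSk hS0 hSc u).map T hTm)
    (measure_map_neg_of_symm (diffMeasure_neg _) T hTm) ?_ hlam ha hβ haβ ?_ ?_ ?_ ?_ hW
    (by exact_mod_cast W.finrank_le) hp₀ hp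
  · rw [Measure.map_apply hTm MeasurableSet.univ, Set.preimage_univ, diffMeasure_univ,
      Measure.restrict_apply_univ]
    exact mul_le_one' hS1 hS1
  · rw [Measure.map_apply hTm MeasurableSet.univ, Set.preimage_univ, diffMeasure_univ]
    simp
  · intro z
    rw [lintegral_map (by fun_prop) hTm]
    simp_rw [hTi]
    exact hpsi z
  · intro z
    rw [lintegral_map (by fun_prop) hTm]
    simp_rw [hTi]
    exact hlow z
  · intro τ hτ z
    rw [lintegral_map (by fun_prop) hTm, lintegral_map (by fun_prop) hTm]
    simp_rw [hTi]
    refine (lintegral_diffMeasure_le_tilt hSk hS0 u (by fun_prop)).trans ?_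
    refine mul_le_mul' (ENNReal.ofReal_le_ofReal hZ) (le_of_eq ?_)
    congr 1
    refine lintegral_congr fun y => ?_
    rw [← ENNReal.ofReal_pow (exp_pos _).le, ← Real.exp_nat_mul]
    congr 2
    push_cast
    ring
  · intro z
    rw [lintegral_map (by fun_prop) hTm]
    simp_rw [hTi]
    rw [lintegral_inner_sq_diffMeasure hSk hS0]
    apply ENNReal.ofReal_le_ofReal
    have := hq z z.2
    rw [Submodule.coe_norm] 
    linarith

lemma pow_le_abs_det_tiltCov :
    (a / (75000 * p₀ * exp 1)) ^ (2 * Module.finrank ℝ E) ≤ |(tiltCov S u).det| := by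
  set n := Module.finrank ℝ E with hn
  have hp0 : 0 < p₀ := by linarith
  have hA := tiltCov_symm hSk hS0 u
  have hpos : ∀ v : E, v ≠ 0 → 0 < ⟪tiltCov S u v, v⟫ := fun v hv => by
    refine inner_tiltCov_pos hSk hS0 (fun v hv h0 => ?_) u v hv
    have h1 := hlow v
    rw [h0, nonpos_iff_eq_zero, ENNReal.ofReal_eq_zero] at h1
    have : 0 < a ^ 2 * ‖v‖ ^ 2 := by
      have := norm_pos_iff.2 hv
      positivity
    linarith
  have hev : ∀ j, 0 < hA.eigenvalues hn.symm j := fun j => by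
    have hb : ‖hA.eigenvectorBasis hn.symm j‖ = 1 := (hA.eigenvectorBasis hn.symm).norm_eq_one j
    have h1 := hpos (hA.eigenvectorBasis hn.symm j) (by
      intro h0; rw [h0, norm_zero] at hb; exact zero_ne_one hb)
    rw [← ContinuousLinearMap.coe_coe, hA.apply_eigenvectorBasis, real_inner_smul_left,
      real_inner_self_eq_norm_sq, hb] at h1
    simpa using h1
  have hlb : ∀ j : Fin n, (a * ((n - j : ℕ) : ℝ) / (75000 * p₀ * n)) ^ 2 ≤
      hA.eigenvalues hn.symm j := fun j => by
    obtain ⟨W, hW, hq⟩ := exists_subspace_finrank_eq hA hn.symm j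
    have h := mul_finrank_subspace_div_le_sqrt hSk hS0 hSc hS1 ha hβ haβ hpsi hlow hZ hp₀ hp W
      (by rw [hW]; omega) (hev j) hq
    rw [hW] at h
    calc _ ≤ (√(hA.eigenvalues hn.symm j)) ^ 2 := by gcongr
      _ = _ := Real.sq_sqrt (hev j).le
  have hdet : (tiltCov S u).det = ∏ j, hA.eigenvalues hn.symm j := by
    rw [ContinuousLinearMap.det, hA.det_eq_prod_eigenvalues hn.symm]
    simp
  rw [hdet, abs_of_pos (Finset.prod_pos fun j _ => hev j)]
  refine le_trans ?_ (Finset.prod_le_prod (fun j _ => sq_nonneg _) fun j _ => hlb j)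
  rw [Finset.prod_pow, mul_comm 2, pow_mul]
  gcongr
  rw [Fin.prod_univ_eq_prod_range (fun j => a * ((n - j : ℕ) : ℝ) / (75000 * p₀ * n)) n]
  have hprod : ∏ j ∈ Finset.range n, a * ((n - j : ℕ) : ℝ) / (75000 * p₀ * n) =
      (a / (75000 * p₀)) ^ n * (n.factorial / n ^ n) := by
    rw [← Finset.prod_range_reflect] 
    have : ∀ j ∈ Finset.range n, a * ((n - (n - 1 - j) : ℕ) : ℝ) / (75000 * p₀ * n) =
        (a / (75000 * p₀)) * (((j + 1 : ℕ) : ℝ) / n) := fun j hj => by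
      rw [Finset.mem_range] at hj
      rw [show n - (n - 1 - j) = j + 1 by omega]
      ring
    rw [Finset.prod_congr rfl this, Finset.prod_mul_distrib, Finset.prod_const, Finset.card_range,
      Finset.prod_div_distrib, Finset.prod_const, Finset.card_range, ← Finset.prod_range_add_one_eq_factorial]
    push_cast
    rfl
  rw [hprod, ← div_div, div_pow _ (exp 1), div_eq_mul_inv]
  gcongr
  have h := Real.pow_div_factorial_le_exp (n : ℝ) (by positivity) n
  rcases Nat.eq_zero_or_pos n with h0 | h0
  · simp [h0]
  rw [← inv_div]
  apply inv_anti₀ (by positivity)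
  rw [← Real.exp_nat_mul, mul_one]
  exact h

end TiltDet

section TiltVolume

set_option linter.unusedSectionVars false

variable {E : Type*} [NormedAddCommGroup E] [InnerProductSpace ℝ E] [FiniteDimensional ℝ E]
  [MeasurableSpace E] [BorelSpace E]

lemma stdGaussian_le_volume (A : Set E) : stdGaussian E A ≤ volume A := by
  have h : stdGaussian E ≤ volume := by
    rw [stdGaussian_eq_withDensity]
    conv_rhs => rw [← withDensity_one (μ := (volume : Measure E))]
    refine withDensity_mono (Filter.Eventually.of_forall fun x => ?_)
    rw [Pi.one_apply, ← ENNReal.ofReal_one]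
    apply ENNReal.ofReal_le_ofReal
    unfold gaussDensity
    refine mul_le_one₀ ?_ (exp_pos _).le ?_
    · apply Real.rpow_le_one_of_one_le_of_nonpos
      · linarith [Real.pi_gt_three]
      · have : (0:ℝ) ≤ Module.finrank ℝ E := by positivity
        linarith
    · rw [Real.exp_le_one_iff]
      have := sq_nonneg ‖x‖
      linarith
  exact h A

variable {S : Set E} (hSk : IsCompact S) (hS0 : 0 < volume S)

include hSk in
lemma continuous_tiltZ : Continuous (tiltZ S) := by
  rw [continuous_iff_continuousAt]
  intro u
  have := (hasFDerivAt_integral_exp_smul hSk (φ := fun _ : E => (1 : ℝ)) (by fun_prop) u).continuousAt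
  have e : (fun u : E => ∫ x in S, exp ⟪u, x⟫ • (1 : ℝ)) = tiltZ S := by
    ext v; simp [tiltZ]
  rwa [e] at this

variable (hS1 : volume S ≤ 1)

include hSk hS0 hS1 in
lemma lintegral_tiltZ_le {R : ℝ} (hR : ∀ x ∈ S, ‖x‖ ≤ R) (σ : ℝ) :
    ∫⁻ g, ENNReal.ofReal (tiltZ S (σ • g)) ∂(stdGaussian E) ≤
      ENNReal.ofReal (exp (σ ^ 2 * R ^ 2 / 2)) := by
  simp_rw [ofReal_tiltZ hSk hS0]
  rw [lintegral_lintegral_swap (by fun_prop)]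
  calc ∫⁻ x in S, ∫⁻ g, ENNReal.ofReal (exp ⟪σ • g, x⟫) ∂(stdGaussian E)
      ≤ ∫⁻ x in S, ENNReal.ofReal (exp (σ ^ 2 * R ^ 2 / 2)) := by
        refine setLIntegral_mono measurable_const fun x hx => ?_
        have h1 : ∀ g : E, ⟪σ • g, x⟫ = ⟪g, σ • x⟫ := fun g => by
          rw [real_inner_smul_left, real_inner_smul_right]
        simp_rw [h1]
        rw [← ofReal_integral_eq_lintegral_ofReal (integrable_exp_inner_stdGaussian _)
          (Filter.Eventually.of_forall fun x => (exp_pos _).le), integral_exp_inner_stdGaussian]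
        apply ENNReal.ofReal_le_ofReal
        rw [norm_smul, mul_pow, Real.norm_eq_abs, sq_abs]
        have := hR x hx
        gcongr
    _ ≤ _ := by
        rw [setLIntegral_const]
        exact mul_le_of_le_one_right' hS1

open scoped Pointwise in
/-- A convex set of volume at most one with isotropic-type lower bound `a` and subgaussian
constant `β` satisfies `a² ≤ C β`. -/
theorem sq_le_of_subgaussian_convex {a β p₀ R : ℝ} (hSk : IsCompact S) (hS0 : 0 < volume S)
    (hS1 : volume S ≤ 1) (hSc : Convex ℝ S)
    (hR : ∀ x ∈ S, ‖x‖ ≤ R) (ha : 0 < a) (hβ : 0 < β)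
    (haβ : a ≤ β)
    (hpsi : ∀ z : E, ∫⁻ y, ENNReal.ofReal (exp (⟪y, z⟫ ^ 2 / (β ^ 2 * ‖z‖ ^ 2)))
      ∂(diffMeasure (volume.restrict S)) ≤ 2)
    (hlow : ∀ z : E, ENNReal.ofReal (a ^ 2 * ‖z‖ ^ 2) ≤
      ∫⁻ y, ENNReal.ofReal (⟪y, z⟫ ^ 2) ∂(diffMeasure (volume.restrict S)))
    (hp₀ : 160 ≤ p₀)
    (hp : log 4 + R ^ 2 / (2 * β ^ 2) ≤
      p₀ * (1 + Module.finrank ℝ E / (280000 * β ^ 2 / a ^ 2)))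
    (hn : 0 < Module.finrank ℝ E) :
    a ^ 2 ≤ 2 * (75000 * p₀ * exp 1) ^ 2 * β := by
  set n := Module.finrank ℝ E with hndef
  set σ := β⁻¹ with hσ
  have hσ0 : 0 < σ := inv_pos.2 hβ
  set M := exp (σ ^ 2 * R ^ 2 / 2) with hM
  have hM0 : 0 < M := exp_pos _
  have hcont := continuous_tiltZ hSk
  set G : Set E := {g | tiltZ S (σ • g) < 4 * M ∧ tiltZ S (-(σ • g)) < 4 * M} with hG
  have hGm : MeasurableSet G := by
    have c1 : Continuous fun g : E => tiltZ S (σ • g) := by fun_prop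
    have c2 : Continuous fun g : E => tiltZ S (-(σ • g)) := by fun_prop
    exact (measurableSet_lt c1.measurable measurable_const).inter
      (measurableSet_lt c2.measurable measurable_const)
  have hmk : ∀ σ' : ℝ, σ' ^ 2 = σ ^ 2 →
      stdGaussian E {g | 4 * M ≤ tiltZ S (σ' • g)} ≤ ENNReal.ofReal (1 / 4) := by
    intro σ' hσ'
    have h1 := lintegral_tiltZ_le hSk hS0 hS1 hR σ'
    rw [hσ'] at h1
    have h2 := meas_ge_le_lintegral_div (μ := stdGaussian E)
      (f := fun g => ENNReal.ofReal (tiltZ S (σ' • g))) (by fun_prop)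
      (ε := ENNReal.ofReal (4 * M)) (by simp [hM0]) ENNReal.ofReal_ne_top
    refine le_trans (measure_mono fun g hg => ?_) (h2.trans ?_)
    · exact ENNReal.ofReal_le_ofReal hg
    · refine (ENNReal.div_le_div_right h1 _).trans ?_
      rw [← ENNReal.ofReal_div_of_pos (by positivity)]
      apply ENNReal.ofReal_le_ofReal
      rw [← hM]
      apply le_of_eq
      field_simp
  have hGhalf : ENNReal.ofReal (1 / 2) ≤ stdGaussian E G := by
    have hc : stdGaussian E Gᶜ ≤ ENNReal.ofReal (1 / 2) := by
      have hsub : Gᶜ ⊆ {g | 4 * M ≤ tiltZ S (σ • g)} ∪ {g | 4 * M ≤ tiltZ S ((-σ) • g)} := by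
        intro g hg
        by_contra hcon
        apply hg
        simp only [Set.mem_union, Set.mem_ofPred_eq, not_or, not_le, neg_smul] at hcon
        exact hcon
      refine (measure_mono hsub).trans ((measure_union_le _ _).trans ?_)
      refine (add_le_add (hmk σ rfl) (hmk (-σ) (by ring))).trans ?_
      rw [← ENNReal.ofReal_add (by norm_num) (by norm_num)]
      norm_num
    have h1 := prob_compl_eq_one_sub (μ := stdGaussian E) hGm.compl
    rw [compl_compl] at h1
    rw [h1]
    refine le_trans ?_ (tsub_le_tsub_left hc _)
    rw [← ENNReal.ofReal_one, ← ENNReal.ofReal_sub _ (by norm_num)]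
    norm_num
  have hvol := hGhalf.trans (stdGaussian_le_volume G)
  set c := (a / (75000 * p₀ * exp 1)) ^ (2 * n) with hc
  have hp0 : 0 < p₀ := by linarith
  have hc0 : 0 ≤ c := by positivity
  have hDm : MeasurableSet (σ • G) := hGm.const_smul₀ σ
  have hpos : ∀ u v : E, v ≠ 0 → 0 < ⟪tiltCov S u v, v⟫ := fun u v hv => by
    refine inner_tiltCov_pos hSk hS0 (fun v hv h0 => ?_) u v hv
    have h1 := hlow v
    rw [h0, nonpos_iff_eq_zero, ENNReal.ofReal_eq_zero] at h1
    have : 0 < a ^ 2 * ‖v‖ ^ 2 := by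
      have := norm_pos_iff.2 hv
      positivity
    linarith
  have hmain : ENNReal.ofReal c * volume (σ • G) ≤ 1 := by
    refine le_trans ?_ ((lintegral_det_tiltCov_le hSk hS0 hSc hpos hDm).trans hS1)
    rw [← setLIntegral_const]
    refine setLIntegral_mono_ae' hDm (Filter.Eventually.of_forall fun u hu => ?_)
    obtain ⟨g, hg, rfl⟩ := Set.mem_smul_set.1 hu
    apply ENNReal.ofReal_le_ofReal
    refine pow_le_abs_det_tiltCov hSk hS0 hSc hS1 ha hβ haβ hpsi hlow ?_ hp₀ hp
    have hexp : exp (2 * (log 4 + R ^ 2 / (2 * β ^ 2))) = (4 * M) * (4 * M) := by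
      have e : R ^ 2 / (2 * β ^ 2) = σ ^ 2 * R ^ 2 / 2 := by
        rw [hσ]; field_simp
      rw [two_mul, Real.exp_add, Real.exp_add, Real.exp_log (by norm_num), e]
    rw [hexp]
    exact mul_le_mul hg.1.le hg.2.le (tiltZ_pos hSk hS0 _).le (by positivity)
  rw [Measure.addHaar_smul, ← hndef, abs_of_pos (by positivity)] at hmain
  have h3 : ENNReal.ofReal (c * σ ^ n * (1 / 2)) ≤ ENNReal.ofReal 1 := by
    rw [ENNReal.ofReal_mul (by positivity), ENNReal.ofReal_mul (by positivity), ENNReal.ofReal_one,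
      mul_assoc]
    exact le_trans (by gcongr) hmain
  rw [ENNReal.ofReal_le_ofReal_iff zero_le_one] at h3
  have h4 : ((a / (75000 * p₀ * exp 1)) ^ 2 * σ) ^ n ≤ 2 ^ n := by
    calc ((a / (75000 * p₀ * exp 1)) ^ 2 * σ) ^ n = c * σ ^ n := by
          rw [mul_pow, hc, pow_mul]
      _ ≤ 2 ^ 1 := by linarith
      _ ≤ 2 ^ n := pow_le_pow_right₀ (by norm_num) hn
  have h5 := (pow_le_pow_iff_left₀ (by positivity) (by norm_num) hn.ne').1 h4
  rw [hσ, ← div_eq_mul_inv, div_le_iff₀ hβ, div_pow, div_le_iff₀ (by positivity)] at h5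
  linarith

end TiltVolume

section Truncation

set_option linter.unusedSectionVars false

variable {E : Type*} [NormedAddCommGroup E] [InnerProductSpace ℝ E] [FiniteDimensional ℝ E]
  [MeasurableSpace E] [BorelSpace E]

lemma tiltMeasure_zero {S : Set E} (h1 : volume S = 1) : tiltMeasure S 0 = volume.restrict S := by
  have hZ : tiltZ S (0 : E) = 1 := by simp [tiltZ, Measure.real, h1]
  unfold tiltMeasure
  rw [hZ]
  simp

lemma integral_inner_sq_of_isotropic {C : Set E} {L : ℝ}
    (hiso : ∀ ξ : E, ‖ξ‖ = 1 → ∫ x in C, ⟪x, ξ⟫ ^ 2 = L ^ 2) (z : E) :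
    ∫ x in C, ⟪x, z⟫ ^ 2 = L ^ 2 * ‖z‖ ^ 2 := by
  rcases eq_or_ne z 0 with rfl | hz
  · simp
  · have hz' : ‖z‖ ≠ 0 := norm_ne_zero_iff.2 hz
    have h := hiso (‖z‖⁻¹ • z) (by rw [norm_smul, norm_inv, norm_norm, inv_mul_cancel₀ hz'])
    simp_rw [inner_smul_right, mul_pow] at h
    rw [integral_const_mul] at h
    rw [← h]
    field_simp

variable {C : Set E} {L : ℝ} (hCk : IsCompact C) (h1 : volume C = 1)
  (hiso : ∀ ξ : E, ‖ξ‖ = 1 → ∫ x in C, ⟪x, ξ⟫ ^ 2 = L ^ 2)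

include hCk h1 hiso

lemma lintegral_inner_sq_diff_of_isotropic (hbar : ∫ x in C, x = 0) (z : E) :
    ∫⁻ y, ENNReal.ofReal (⟪y, z⟫ ^ 2) ∂(diffMeasure (volume.restrict C)) =
      ENNReal.ofReal (2 * L ^ 2 * ‖z‖ ^ 2) := by
  have hC0 : 0 < volume C := by rw [h1]; exact one_pos
  have h := lintegral_inner_sq_diffMeasure hCk hC0 0 z
  rw [inner_tiltCov hCk hC0, tiltMeasure_zero h1] at h
  have hb : ∫ x in C, ⟪x, z⟫ = 0 := by
    simp_rw [real_inner_comm z]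
    rw [integral_inner (integrableOn_of_continuous hCk continuous_id'), hbar, inner_zero_right]
  rw [h, hb]
  simp_rw [← sq]
  rw [integral_inner_sq_of_isotropic hiso]
  congr 1
  ring

lemma measure_compl_closedBall_le (hL : 0 < L) (hn : 0 < Module.finrank ℝ E) {R Q : ℝ} (hQ : 0 < Q)
    (hR0 : 0 < R)
    (hR : R ^ 2 = Q * Module.finrank ℝ E * L ^ 2) :
    (volume.restrict C) (Metric.closedBall 0 R)ᶜ ≤ ENNReal.ofReal (1 / Q) := by
  set b := stdOrthonormalBasis ℝ E
  have h_int : ∫⁻ x in C, ENNReal.ofReal (‖x‖ ^ 2) = ENNReal.ofReal (Module.finrank ℝ E * L ^ 2) := by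
    rw [← ofReal_integral_eq_lintegral_ofReal (integrableOn_of_continuous hCk (by fun_prop))
      (Filter.Eventually.of_forall fun x => sq_nonneg _)]
    congr 1
    simp_rw [← b.sum_sq_norm_inner_left, Real.norm_eq_abs, sq_abs]
    rw [integral_finsetSum _ fun i _ => integrableOn_of_continuous hCk (by fun_prop)]
    simp [hiso _ (b.norm_eq_one _)]
  have h2 := meas_ge_le_lintegral_div (μ := volume.restrict C)
      (f := fun x => ENNReal.ofReal (‖x‖ ^ 2)) (by fun_prop)
      (ε := ENNReal.ofReal (R ^ 2)) (by simp; positivity) ENNReal.ofReal_ne_top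
  refine (measure_mono fun x hx => ?_).trans (h2.trans ?_)
  · simp only [Set.mem_compl_iff, Metric.mem_closedBall, dist_zero_right, not_le] at hx
    exact ENNReal.ofReal_le_ofReal (by gcongr)
  · rw [h_int, ← ENNReal.ofReal_div_of_pos (by positivity), hR]
    apply ENNReal.ofReal_le_ofReal
    apply le_of_eq
    have : (0:ℝ) < Module.finrank ℝ E := by exact_mod_cast hn
    field_simp

lemma lintegral_inner_pow_four_diff_le (hL : 0 < L) (hbar : ∫ x in C, x = 0) (hCc : Convex ℝ C)
    {z : E} (hz : ‖z‖ = 1) :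
    ∫⁻ y, ENNReal.ofReal (⟪y, z⟫ ^ 4) ∂(diffMeasure (volume.restrict C)) ≤
      ENNReal.ofReal (22500000000 * L ^ 4) := by
  have hC0 : 0 < volume C := by rw [h1]; exact one_pos
  have hlc := isLogConcaveMeasure_diffMeasure_tilt hCk hC0 hCc 0
  rw [tiltMeasure_zero h1] at hlc
  set κ := diffMeasure (volume.restrict C) with hκ
  have hκ1 : κ Set.univ = 1 := by
    rw [hκ, diffMeasure_univ, Measure.restrict_apply_univ, h1, one_mul]
  have hprob : IsProbabilityMeasure κ := ⟨hκ1⟩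
  set T : E →ₗ[ℝ] ℝ := (innerSL ℝ z).toLinearMap with hT
  have hTa : ∀ y, T y = ⟪z, y⟫ := fun y => rfl
  have hTm : Measurable T := (innerSL ℝ z).continuous.measurable
  obtain ⟨θ, hθ, hexp⟩ := exists_direction_exp_le (η := κ.map T) (δ := 2 * L) (hlc.map T hTm)
    (measure_map_neg_of_symm (diffMeasure_neg _) T hTm)
    (by rw [Measure.map_apply hTm MeasurableSet.univ, Set.preimage_univ, hκ1])
    (by simp) (by positivity) (by
      rw [Measure.map_apply hTm Metric.isClosed_closedBall.measurableSet]
      have hc : κ (T ⁻¹' Metric.closedBall 0 (2 * L))ᶜ ≤ ENNReal.ofReal (1 / 2) := by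
        have h2 := meas_ge_le_lintegral_div (μ := κ)
          (f := fun y => ENNReal.ofReal (⟪y, z⟫ ^ 2)) (by fun_prop)
          (ε := ENNReal.ofReal ((2 * L) ^ 2)) (by simp; positivity) ENNReal.ofReal_ne_top
        refine (measure_mono fun y hy => ?_).trans (h2.trans ?_)
        · simp only [Set.mem_compl_iff, Set.mem_preimage, Metric.mem_closedBall, dist_zero_right,
            not_le, hTa, Real.norm_eq_abs] at hy
          apply ENNReal.ofReal_le_ofReal
          rw [real_inner_comm, ← sq_abs ⟪z, y⟫]
          gcongr
        · rw [hκ, lintegral_inner_sq_diff_of_isotropic hCk h1 hiso hbar, hz,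
            ← ENNReal.ofReal_div_of_pos (by positivity)]
          apply ENNReal.ofReal_le_ofReal
          apply le_of_eq
          field_simp
      have h3 := prob_compl_eq_one_sub (μ := κ)
        (hTm (Metric.isClosed_closedBall (x := (0:ℝ)) (ε := 2 * L)).measurableSet).compl
      rw [compl_compl] at h3
      rw [h3]
      refine le_trans ?_ (tsub_le_tsub_left hc _)
      rw [← ENNReal.ofReal_one, ← ENNReal.ofReal_sub _ (by norm_num)]
      norm_num)
  rw [lintegral_map (by fun_prop) hTm] at hexp
  calc ∫⁻ y, ENNReal.ofReal (⟪y, z⟫ ^ 4) ∂κ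
      ≤ ∫⁻ y, ENNReal.ofReal (24 * (64 * L) ^ 4) *
          ENNReal.ofReal (exp (Module.finrank ℝ ℝ / (32 * (2 * L)) * |⟪T y, θ⟫|)) ∂κ := by
        refine lintegral_mono fun y => ?_
        rw [← ENNReal.ofReal_mul (by positivity)]
        apply ENNReal.ofReal_le_ofReal
        have hab : |⟪T y, θ⟫| = |⟪y, z⟫| := by
          have e : ⟪T y, θ⟫ = θ * T y := by simp
          rw [e, abs_mul, ← Real.norm_eq_abs θ, hθ, one_mul, hTa, real_inner_comm]
        rw [hab]
        have h4 := pow_le_factorial_mul_exp 4 (x := |⟪y, z⟫| / (64 * L)) (by positivity)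
        rw [div_pow, div_le_iff₀ (by positivity)] at h4
        have e2 : ((Module.finrank ℝ ℝ : ℕ) : ℝ) / (32 * (2 * L)) * |⟪y, z⟫| = |⟪y, z⟫| / (64 * L) := by
          simp only [Module.finrank_self, Nat.cast_one]
          field_simp
          ring
        rw [e2, ← abs_of_nonneg (show 0 ≤ ⟪y, z⟫ ^ 4 by positivity), abs_pow]
        refine h4.trans (le_of_eq ?_)
        simp only [Nat.factorial]
        push_cast
        ring
    _ ≤ ENNReal.ofReal (24 * (64 * L) ^ 4) * ENNReal.ofReal (exp (4 * Module.finrank ℝ ℝ)) := by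
        rw [lintegral_const_mul _ (by fun_prop)]
        gcongr
    _ ≤ _ := by
        rw [← ENNReal.ofReal_mul (by positivity)]
        apply ENNReal.ofReal_le_ofReal
        have he : exp (4 * ((Module.finrank ℝ ℝ : ℕ) : ℝ)) ≤ 55 := by
          rw [Module.finrank_self, Nat.cast_one, mul_one]
          have := Real.exp_one_lt_d9
          calc exp 4 = exp 1 ^ 4 := by rw [← Real.exp_nat_mul]; norm_num
            _ ≤ 2.72 ^ 4 := by gcongr; linarith
            _ ≤ 55 := by norm_num
        have hL4 : 0 < L ^ 4 := by positivity
        calc 24 * (64 * L) ^ 4 * exp (4 * ((Module.finrank ℝ ℝ : ℕ) : ℝ))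
            ≤ 24 * (64 * L) ^ 4 * 55 := by gcongr
          _ ≤ _ := by
            rw [mul_pow]
            norm_num
            linarith

/-- Truncating at radius `√(Q n) L` costs at most half of the second moments. -/
lemma le_lintegral_inner_sq_diff_truncate (hL : 0 < L) (hbar : ∫ x in C, x = 0) (hCc : Convex ℝ C)
    (hn : 0 < Module.finrank ℝ E) {R : ℝ} (hR0 : 0 < R)
    (hR : R ^ 2 = 45000000000 * Module.finrank ℝ E * L ^ 2) (z : E) :
    ENNReal.ofReal (L ^ 2 * ‖z‖ ^ 2) ≤ ∫⁻ y, ENNReal.ofReal (⟪y, z⟫ ^ 2)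
      ∂(diffMeasure (volume.restrict (C ∩ Metric.closedBall 0 R))) := by
  have key : ∀ z : E, ‖z‖ = 1 → ENNReal.ofReal (L ^ 2) ≤ ∫⁻ y, ENNReal.ofReal (⟪y, z⟫ ^ 2)
      ∂(diffMeasure (volume.restrict (C ∩ Metric.closedBall 0 R))) := by
    intro z hz
    have hBm : MeasurableSet (Metric.closedBall (0 : E) R) := Metric.isClosed_closedBall.measurableSet
    have hres : (volume : Measure E).restrict (C ∩ Metric.closedBall 0 R) =
        (volume.restrict C).restrict (Metric.closedBall 0 R) := by
      rw [Measure.restrict_restrict hBm, Set.inter_comm]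
    have h2 := lintegral_inner_sq_diff_of_isotropic hCk h1 hiso hbar z
    have h4 := lintegral_inner_pow_four_diff_le hCk h1 hiso hL hbar hCc hz
    have hsm := measure_compl_closedBall_le hCk h1 hiso hL hn (Q := 45000000000) (by norm_num) hR0 hR
    have hprob : IsProbabilityMeasure ((volume : Measure E).restrict C) :=
      ⟨by rw [Measure.restrict_apply_univ, h1]⟩
    rw [hres]
    set μ := (volume : Measure E).restrict C with hμ
    set B := Metric.closedBall (0 : E) R with hB
    rw [lintegral_diffMeasure _ (by fun_prop)] at h2 h4 ⊢
    rw [Measure.prod_restrict]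
    rw [← lintegral_add_compl _ (hBm.prod hBm), hz] at h2
    have hA : (μ.prod μ) (B ×ˢ B)ᶜ ≤ ENNReal.ofReal (2 / 45000000000) := by
      have hsub : (B ×ˢ B)ᶜ ⊆ (Bᶜ ×ˢ Set.univ) ∪ (Set.univ ×ˢ Bᶜ) := by
        rintro ⟨x, y⟩ hxy
        by_cases hx : x ∈ B
        · right
          exact ⟨trivial, fun hy => hxy ⟨hx, hy⟩⟩
        · left
          exact ⟨hx, trivial⟩
      refine (measure_mono hsub).trans ((measure_union_le _ _).trans ?_)
      rw [Measure.prod_prod, Measure.prod_prod, measure_univ, one_mul, mul_one]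
      refine (add_le_add hsm hsm).trans (le_of_eq ?_)
      rw [← ENNReal.ofReal_add (by norm_num) (by norm_num)]
      norm_num
    have hpt : ∀ p : E × E, ENNReal.ofReal (⟪p.1 - p.2, z⟫ ^ 2) ≤
        ENNReal.ofReal (1 / (45000000000 * L ^ 2)) * ENNReal.ofReal (⟪p.1 - p.2, z⟫ ^ 4) +
          ENNReal.ofReal (11250000000 * L ^ 2) := fun p => by
      rw [← ENNReal.ofReal_mul (by positivity), ← ENNReal.ofReal_add (by positivity) (by positivity)]
      apply ENNReal.ofReal_le_ofReal
      set w := ⟪p.1 - p.2, z⟫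
      have e : 1 / (45000000000 * L ^ 2) * w ^ 4 + 11250000000 * L ^ 2 - w ^ 2 =
          (w ^ 2 - 22500000000 * L ^ 2) ^ 2 / (45000000000 * L ^ 2) := by
        field_simp
        ring
      have : 0 ≤ (w ^ 2 - 22500000000 * L ^ 2) ^ 2 / (45000000000 * L ^ 2) := by positivity
      linarith
    have hc : ∫⁻ p in (B ×ˢ B)ᶜ, ENNReal.ofReal (⟪p.1 - p.2, z⟫ ^ 2) ∂(μ.prod μ) ≤
        ENNReal.ofReal (L ^ 2) := by
      calc _ ≤ ∫⁻ p in (B ×ˢ B)ᶜ, (ENNReal.ofReal (1 / (45000000000 * L ^ 2)) *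
                ENNReal.ofReal (⟪p.1 - p.2, z⟫ ^ 4) +
              ENNReal.ofReal (11250000000 * L ^ 2)) ∂(μ.prod μ) := lintegral_mono hpt
        _ = ENNReal.ofReal (1 / (45000000000 * L ^ 2)) *
              (∫⁻ p in (B ×ˢ B)ᶜ, ENNReal.ofReal (⟪p.1 - p.2, z⟫ ^ 4) ∂(μ.prod μ)) +
              ENNReal.ofReal (11250000000 * L ^ 2) * (μ.prod μ) (B ×ˢ B)ᶜ := by
            rw [lintegral_add_right _ measurable_const, lintegral_const_mul _ (by fun_prop),
              setLIntegral_const]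
        _ ≤ ENNReal.ofReal (1 / (45000000000 * L ^ 2)) * ENNReal.ofReal (22500000000 * L ^ 4) +
              ENNReal.ofReal (11250000000 * L ^ 2) * ENNReal.ofReal (2 / 45000000000) := by
            gcongr
            exact (setLIntegral_le_lintegral _ _).trans h4
        _ = ENNReal.ofReal (L ^ 2) := by
            rw [← ENNReal.ofReal_mul (by positivity), ← ENNReal.ofReal_mul (by positivity),
              ← ENNReal.ofReal_add (by positivity) (by positivity)]
            congr 1
            field_simp
            ring
    have h5 : ENNReal.ofReal (L ^ 2) + ENNReal.ofReal (L ^ 2) ≤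
        (∫⁻ p in B ×ˢ B, ENNReal.ofReal (⟪p.1 - p.2, z⟫ ^ 2) ∂(μ.prod μ)) + ENNReal.ofReal (L ^ 2) := by
      rw [← ENNReal.ofReal_add (by positivity) (by positivity)]
      calc _ = ENNReal.ofReal (2 * L ^ 2 * 1 ^ 2) := by congr 1; ring
        _ ≤ _ := by rw [← h2]; gcongr
    exact ENNReal.le_of_add_le_add_right ENNReal.ofReal_ne_top h5
  rcases eq_or_ne z 0 with rfl | hz
  · simp
  · have hz' : ‖z‖ ≠ 0 := norm_ne_zero_iff.2 hz
    have h := key (‖z‖⁻¹ • z) (by rw [norm_smul, norm_inv, norm_norm, inv_mul_cancel₀ hz'])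
    calc ENNReal.ofReal (L ^ 2 * ‖z‖ ^ 2)
        = ENNReal.ofReal (‖z‖ ^ 2) * ENNReal.ofReal (L ^ 2) := by
          rw [← ENNReal.ofReal_mul (by positivity), mul_comm]
      _ ≤ ENNReal.ofReal (‖z‖ ^ 2) * _ := mul_le_mul_right h _
      _ = _ := by
        rw [← lintegral_const_mul _ (by fun_prop)]
        refine lintegral_congr fun y => ?_
        rw [← ENNReal.ofReal_mul (by positivity), inner_smul_right]
        congr 1
        field_simp

end Truncation

section IsotropicConstant

set_option linter.unusedSectionVars false

variable {E : Type*} [NormedAddCommGroup E] [InnerProductSpace ℝ E] [FiniteDimensional ℝ E]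
  [MeasurableSpace E] [BorelSpace E]

variable {C : Set E} {L ϱ : ℝ} (hCk : IsCompact C) (h1 : volume C = 1) (hL : 0 < L) (hϱ : 0 < ϱ)
  (hiso : ∀ ξ : E, ‖ξ‖ = 1 → ∫ x in C, ⟪x, ξ⟫ ^ 2 = L ^ 2)
  (hψ : ∀ ξ : E, ‖ξ‖ = 1 →
    sInf {r : ℝ | 0 < r ∧ (∫ x in C, Real.exp ((|⟪x, ξ⟫| / r) ^ 2)) ≤ 2}
      ≤ ϱ * Real.sqrt (∫ x in C, ⟪x, ξ⟫ ^ 2))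

include hCk h1 hL hϱ hiso hψ

lemma integral_exp_sq_le_two_of_psiTwo {ξ : E} (hξ : ‖ξ‖ = 1) :
    ∫ x in C, exp (⟪x, ξ⟫ ^ 2 / (2 * ϱ * L) ^ 2) ≤ 2 := by
  have h := hψ ξ hξ
  rw [hiso ξ hξ, Real.sqrt_sq hL.le] at h
  have hne : {r : ℝ | 0 < r ∧ (∫ x in C, Real.exp ((|⟪x, ξ⟫| / r) ^ 2)) ≤ 2}.Nonempty := by
    obtain ⟨M, hM⟩ := hCk.exists_bound_of_continuousOn (f := fun x : E => ⟪x, ξ⟫) (by fun_prop)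
    have hl : 0 < √(log 2) := Real.sqrt_pos.2 (Real.log_pos (by norm_num))
    set r := (|M| + 1) / √(log 2) with hr
    have hr0 : 0 < r := by positivity
    refine ⟨r, hr0, ?_⟩
    calc ∫ x in C, exp ((|⟪x, ξ⟫| / r) ^ 2) ≤ ∫ x in C, (2 : ℝ) := by
          refine setIntegral_mono_on (integrableOn_of_continuous hCk (by fun_prop))
            (integrableOn_of_continuous hCk (by fun_prop)) hCk.measurableSet fun x hx => ?_
          have h2 : |⟪x, ξ⟫| / r ≤ √(log 2) := by
            rw [div_le_iff₀ hr0, hr, mul_div_cancel₀ _ hl.ne']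
            have := hM x hx
            rw [Real.norm_eq_abs] at this
            linarith [le_abs_self M]
          calc exp ((|⟪x, ξ⟫| / r) ^ 2) ≤ exp (√(log 2) ^ 2) := by gcongr
            _ = 2 := by
              rw [Real.sq_sqrt (Real.log_pos (by norm_num)).le, Real.exp_log (by norm_num)]
      _ = 2 := by simp [Measure.real, h1]
  obtain ⟨r, ⟨hr0, hr⟩, hlt⟩ := exists_lt_of_csInf_lt hne (h.trans_lt (b := ϱ * L) (c := 2 * ϱ * L) (by
    have : 0 < ϱ * L := by positivity
    linarith))
  refine le_trans (setIntegral_mono (integrableOn_of_continuous hCk (by fun_prop))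
    (integrableOn_of_continuous hCk (by fun_prop)) fun x => ?_) hr
  dsimp only
  rw [div_pow, sq_abs]
  gcongr

lemma lintegral_exp_sq_le_two_of_psiTwo (z : E) :
    ∫⁻ x in C, ENNReal.ofReal (exp (⟪x, z⟫ ^ 2 / ((2 * ϱ * L) ^ 2 * ‖z‖ ^ 2))) ≤ 2 := by
  rcases eq_or_ne z 0 with rfl | hz
  · simp [h1]
  · have hz' : ‖z‖ ≠ 0 := norm_ne_zero_iff.2 hz
    have h := integral_exp_sq_le_two_of_psiTwo hCk h1 hL hϱ hiso hψ (ξ := ‖z‖⁻¹ • z)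
      (by rw [norm_smul, norm_inv, norm_norm, inv_mul_cancel₀ hz'])
    rw [← ofReal_integral_eq_lintegral_ofReal (integrableOn_of_continuous hCk (by fun_prop))
      (Filter.Eventually.of_forall fun x => (exp_pos _).le)]
    rw [show (2 : ℝ≥0∞) = ENNReal.ofReal 2 by simp]
    apply ENNReal.ofReal_le_ofReal
    refine le_trans (le_of_eq ?_) h
    congr 1
    ext x
    rw [inner_smul_right]
    congr 1
    field_simp

lemma lintegral_exp_sq_diff_le_two {S : Set E} (hSC : S ⊆ C) (z : E) :
    ∫⁻ y, ENNReal.ofReal (exp (⟪y, z⟫ ^ 2 / ((8 * ϱ * L) ^ 2 * ‖z‖ ^ 2)))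
      ∂(diffMeasure (volume.restrict S)) ≤ 2 := by
  set f : E → ℝ≥0∞ := fun x => ENNReal.ofReal (exp (⟪x, z⟫ ^ 2 / ((2 * ϱ * L) ^ 2 * ‖z‖ ^ 2))) with hf
  have hfm : Measurable f := by fun_prop
  have hS1 : (volume : Measure E).restrict S Set.univ ≤ 1 := by
    rw [Measure.restrict_apply_univ, ← h1]
    exact measure_mono hSC
  have hf2 : ∫⁻ x in S, f x ≤ 2 :=
    (lintegral_mono_set hSC).trans (lintegral_exp_sq_le_two_of_psiTwo hCk h1 hL hϱ hiso hψ z)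
  have hfin : IsFiniteMeasure ((volume : Measure E).restrict S) := ⟨hS1.trans_lt ENNReal.one_lt_top⟩
  rw [lintegral_diffMeasure _ (by fun_prop)]
  calc _ ≤ ∫⁻ p, f p.1 ^ (1 / 2 : ℝ) * f p.2 ^ (1 / 2 : ℝ)
        ∂(((volume : Measure E).restrict S).prod (volume.restrict S)) := by
        refine lintegral_mono fun p => ?_
        rw [hf]
        dsimp only
        rw [ENNReal.ofReal_rpow_of_pos (exp_pos _), ENNReal.ofReal_rpow_of_pos (exp_pos _),
          ← ENNReal.ofReal_mul (by positivity), ← Real.exp_mul, ← Real.exp_mul, ← Real.exp_add]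
        apply ENNReal.ofReal_le_ofReal
        apply Real.exp_le_exp.2
        rcases eq_or_ne z 0 with rfl | hz
        · simp
        have hz' : 0 < ‖z‖ := norm_pos_iff.2 hz
        rw [inner_sub_left]
        set a := ⟪p.1, z⟫
        set b := ⟪p.2, z⟫
        have e : a ^ 2 / ((2 * ϱ * L) ^ 2 * ‖z‖ ^ 2) * (1 / 2) +
            b ^ 2 / ((2 * ϱ * L) ^ 2 * ‖z‖ ^ 2) * (1 / 2) =
            (8 * (a ^ 2 + b ^ 2)) / ((8 * ϱ * L) ^ 2 * ‖z‖ ^ 2) := by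
          field_simp
          ring
        rw [e]
        gcongr
        nlinarith [sq_nonneg (a + b), sq_nonneg a, sq_nonneg b]
    _ = (∫⁻ x in S, f x ^ (1 / 2 : ℝ)) * ∫⁻ x in S, f x ^ (1 / 2 : ℝ) :=
        lintegral_prod_mul (f := fun x => f x ^ (1 / 2 : ℝ)) (g := fun x => f x ^ (1 / 2 : ℝ))
          (by fun_prop) (by fun_prop)
    _ ≤ 2 ^ (1 / 2 : ℝ) * 2 ^ (1 / 2 : ℝ) := by
        have h := (lintegral_rpow_le_rpow_lintegral hS1 hfm.aemeasurable
          (s := 1 / 2) (by norm_num) (by norm_num)).trans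
            (ENNReal.rpow_le_rpow hf2 (by norm_num : (0:ℝ) ≤ 1 / 2))
        gcongr
    _ = 2 := by
        rw [← ENNReal.rpow_add _ _ (by norm_num) (by norm_num)]
        norm_num

lemma le_two_mul_of_psiTwo (hn : 0 < Module.finrank ℝ E) : 1 ≤ 2 * ϱ := by
  have : Nontrivial E := Module.nontrivial_of_finrank_pos hn
  obtain ⟨ξ, hξ⟩ := exists_norm_eq (E := E) zero_le_one
  have h := integral_exp_sq_le_two_of_psiTwo hCk h1 hL hϱ hiso hψ hξ
  have h2 : ∫ x in C, (⟪x, ξ⟫ ^ 2 / (2 * ϱ * L) ^ 2 + 1) ≤ 2 := by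
    refine le_trans (setIntegral_mono (integrableOn_of_continuous hCk (by fun_prop))
      (integrableOn_of_continuous hCk (by fun_prop)) fun x => Real.add_one_le_exp _) h
  rw [integral_add (integrableOn_of_continuous hCk (by fun_prop))
      (integrableOn_of_continuous hCk (by fun_prop)), integral_div, hiso ξ hξ] at h2
  simp only [integral_const, Measure.real, Measure.restrict_apply_univ, h1,
    ENNReal.toReal_one, smul_eq_mul, mul_one] at h2
  have h3 : L ^ 2 / (2 * ϱ * L) ^ 2 ≤ 1 := by linarith
  rw [div_le_one (by positivity)] at h3
  have h4 := (pow_le_pow_iff_left₀ hL.le (by positivity) (by norm_num)).1 h3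
  by_contra! hcon
  have := mul_lt_mul_of_pos_right hcon hL
  linarith

/-- The isotropic constant of a `ψ₂`-body is at most a constant times its `ψ₂`-constant. -/
theorem isotropic_constant_le (hbar : ∫ x in C, x = 0) (hCc : Convex ℝ C)
    (hn : 0 < Module.finrank ℝ E) :
    L ≤ 16 * (75000 * (140000 * 45000000000) * exp 1) ^ 2 * ϱ := by
  have hn' : (0:ℝ) < Module.finrank ℝ E := by exact_mod_cast hn
  set R := √(45000000000 * Module.finrank ℝ E * L ^ 2) with hRdef
  have hR0 : 0 < R := Real.sqrt_pos.2 (by positivity)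
  have hR : R ^ 2 = 45000000000 * Module.finrank ℝ E * L ^ 2 := Real.sq_sqrt (by positivity)
  have h2ϱ := le_two_mul_of_psiTwo hCk h1 hL hϱ hiso hψ hn
  set S := C ∩ Metric.closedBall (0 : E) R with hS
  have hSC : S ⊆ C := Set.inter_subset_left
  have hSk : IsCompact S := hCk.inter_right Metric.isClosed_closedBall
  have hsm := measure_compl_closedBall_le hCk h1 hiso hL hn (Q := 45000000000) (by norm_num) hR0 hR
  have hS0 : 0 < volume S := by
    rw [pos_iff_ne_zero]
    intro h0
    have h3 := measure_add_measure_compl (μ := (volume : Measure E).restrict C)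
      (Metric.isClosed_closedBall (x := (0 : E)) (ε := R)).measurableSet
    rw [Measure.restrict_apply Metric.isClosed_closedBall.measurableSet, Set.inter_comm, ← hS, h0,
      zero_add, Measure.restrict_apply_univ, h1] at h3
    rw [h3, ← ENNReal.ofReal_one, ENNReal.ofReal_le_ofReal_iff (by norm_num)] at hsm
    norm_num at hsm
  have hmain := sq_le_of_subgaussian_convex (a := L) (β := 8 * ϱ * L) (R := R)
    (p₀ := 140000 * 45000000000) hSk hS0 (h1 ▸ measure_mono hSC)
    (hCc.inter (convex_closedBall _ _)) (fun x hx => by simpa using hx.2) hL (by positivity)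
    (by
      have := mul_le_mul_of_nonneg_right h2ϱ hL.le
      have := mul_pos hϱ hL
      linarith)
    (lintegral_exp_sq_diff_le_two hCk h1 hL hϱ hiso hψ hSC)
    (le_lintegral_inner_sq_diff_truncate hCk h1 hiso hL hbar hCc hn hR0 hR) (by norm_num)
    (by
      have hlog : log 4 ≤ 3 := by
        have := Real.log_le_sub_one_of_pos (show (0:ℝ) < 4 by norm_num)
        linarith
      have e : R ^ 2 / (2 * (8 * ϱ * L) ^ 2) = 140000 * 45000000000 *
          (Module.finrank ℝ E / (280000 * (8 * ϱ * L) ^ 2 / L ^ 2)) := by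
        rw [hR]
        field_simp
        norm_num
      rw [e, mul_add]
      linarith) hn
  have h5 : L * L ≤ (16 * (75000 * (140000 * 45000000000) * exp 1) ^ 2 * ϱ) * L := by
    calc L * L = L ^ 2 := by ring
      _ ≤ _ := hmain
      _ = _ := by ring
  exact le_of_mul_le_mul_right h5 hL

end IsotropicConstant

section Laplace

lemma exp_le_self_add_exp_sq (x : ℝ) : exp x ≤ x + exp (x ^ 2) := by
  have h2 := Real.add_one_le_exp (x ^ 2)
  rcases le_or_gt |x| 1 with h | h
  · have h1 := Real.abs_exp_sub_one_sub_id_le h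
    linarith [(abs_le.1 h1).2]
  · rcases lt_abs.1 h with h' | h'
    · have : exp x ≤ exp (x ^ 2) := Real.exp_le_exp.2 (by nlinarith)
      linarith
    · have : exp x ≤ 1 := Real.exp_le_one_iff.2 (by linarith)
      nlinarith

lemma rpow_le_two_rpow_mul {u θ : ℝ} (hu : 0 ≤ u) (h0 : 0 ≤ θ) (h1 : θ ≤ 1) :
    u ^ θ ≤ 2 ^ θ * (1 + θ * (u / 2 - 1)) := by
  have h := rpow_one_add_le_one_add_mul_self (s := u / 2 - 1) (by linarith) h0 h1
  rw [add_sub_cancel, Real.div_rpow hu (by norm_num), div_le_iff₀' (by positivity)] at h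
  exact h

variable {Ω : Type*} [MeasurableSpace Ω] {μ : Measure Ω} [IsProbabilityMeasure μ]

lemma integral_exp_le_exp_sq {Y : Ω → ℝ} {b : ℝ} (hb : 0 < b) (hY : Integrable Y μ)
    (h0 : ∫ w, Y w ∂μ = 0) (hYi : Integrable (fun w => exp (Y w)) μ)
    (hi : Integrable (fun w => exp (Y w ^ 2 / b ^ 2)) μ)
    (h2 : ∫ w, exp (Y w ^ 2 / b ^ 2) ∂μ ≤ 2) : ∫ w, exp (Y w) ∂μ ≤ exp (b ^ 2) := by
  have hl : log 2 ≤ 1 := by linarith [Real.log_two_lt_d9]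
  have hlin (θ : ℝ) : Integrable
      (fun w => (2 : ℝ) ^ θ * (1 + θ * (exp (Y w ^ 2 / b ^ 2) / 2 - 1))) μ := by
    have h' : Integrable (fun w => exp (Y w ^ 2 / b ^ 2) / 2 - 1) μ :=
      (hi.div_const 2).sub (integrable_const 1)
    exact ((integrable_const (1 : ℝ)).add (h'.const_mul θ)).const_mul _
  have h_int (θ : ℝ) (hθ : 0 ≤ θ) :
      ∫ w, (2 : ℝ) ^ θ * (1 + θ * (exp (Y w ^ 2 / b ^ 2) / 2 - 1)) ∂μ ≤ exp θ := by
    have h' : Integrable (fun w => exp (Y w ^ 2 / b ^ 2) / 2 - 1) μ :=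
      (hi.div_const 2).sub (integrable_const 1)
    have e : ∫ w, (2 : ℝ) ^ θ * (1 + θ * (exp (Y w ^ 2 / b ^ 2) / 2 - 1)) ∂μ
        = 2 ^ θ * (1 + θ * ((∫ w, exp (Y w ^ 2 / b ^ 2) ∂μ) / 2 - 1)) := by
      rw [integral_const_mul, integral_add (f := fun _ => (1 : ℝ))
        (g := fun w => θ * (exp (Y w ^ 2 / b ^ 2) / 2 - 1)) (integrable_const _)
        (h'.const_mul θ), integral_const_mul,
        integral_sub (f := fun w => exp (Y w ^ 2 / b ^ 2) / 2) (g := fun _ => (1 : ℝ))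
        (hi.div_const 2) (integrable_const _), integral_div]
      simp
    rw [e]
    have h3 : θ * ((∫ w, exp (Y w ^ 2 / b ^ 2) ∂μ) / 2 - 1) ≤ 0 :=
      mul_nonpos_of_nonneg_of_nonpos hθ (by linarith)
    calc (2 : ℝ) ^ θ * (1 + θ * ((∫ w, exp (Y w ^ 2 / b ^ 2) ∂μ) / 2 - 1)) ≤ 2 ^ θ * 1 := by
          gcongr; linarith
      _ = exp (log 2 * θ) := by rw [mul_one, Real.rpow_def_of_pos (by norm_num)]
      _ ≤ exp θ := Real.exp_le_exp.2 (mul_le_of_le_one_left hθ hl)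
  have hb2 : 0 < b ^ 2 := by positivity
  rcases le_or_gt (b ^ 2) 1 with hb1 | hb1
  · have hp (w : Ω) : exp (Y w)
        ≤ Y w + 2 ^ (b ^ 2) * (1 + b ^ 2 * (exp (Y w ^ 2 / b ^ 2) / 2 - 1)) := by
      have h := rpow_le_two_rpow_mul (exp_pos (Y w ^ 2 / b ^ 2)).le hb2.le hb1
      rw [← Real.exp_mul, div_mul_cancel₀ _ hb2.ne'] at h
      linarith [exp_le_self_add_exp_sq (Y w)]
    calc ∫ w, exp (Y w) ∂μ
        ≤ ∫ w, (Y w + 2 ^ (b ^ 2) * (1 + b ^ 2 * (exp (Y w ^ 2 / b ^ 2) / 2 - 1))) ∂μ :=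
          integral_mono hYi (hY.add (hlin _)) hp
      _ = 0 + ∫ w, (2 : ℝ) ^ (b ^ 2) * (1 + b ^ 2 * (exp (Y w ^ 2 / b ^ 2) / 2 - 1)) ∂μ := by
          rw [integral_add hY (hlin _), h0]
      _ ≤ exp (b ^ 2) := by rw [zero_add]; exact h_int _ hb2.le
  · have hp (w : Ω) : exp (Y w) ≤ exp (b ^ 2 / 2) *
        (2 ^ (1 / 2 : ℝ) * (1 + 1 / 2 * (exp (Y w ^ 2 / b ^ 2) / 2 - 1))) := by
      have h := rpow_le_two_rpow_mul (exp_pos (Y w ^ 2 / b ^ 2)).le (θ := 1 / 2)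
        (by norm_num) (by norm_num)
      refine le_trans ?_ (mul_le_mul_of_nonneg_left h (exp_pos _).le)
      rw [← Real.exp_mul, ← Real.exp_add]
      refine Real.exp_le_exp.2 ?_
      have h3 : b ^ 2 / 2 + Y w ^ 2 / b ^ 2 * (1 / 2) - Y w = (b - Y w / b) ^ 2 / 2 := by
        field_simp; ring
      nlinarith [sq_nonneg (b - Y w / b)]
    calc ∫ w, exp (Y w) ∂μ
        ≤ ∫ w, exp (b ^ 2 / 2) *
          (2 ^ (1 / 2 : ℝ) * (1 + 1 / 2 * (exp (Y w ^ 2 / b ^ 2) / 2 - 1))) ∂μ :=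
          integral_mono hYi ((hlin _).const_mul _) hp
      _ ≤ exp (b ^ 2 / 2) * exp (1 / 2) := by
          rw [integral_const_mul]
          exact mul_le_mul_of_nonneg_left (h_int _ (by norm_num)) (exp_pos _).le
      _ ≤ exp (b ^ 2) := by
          rw [← Real.exp_add]
          exact Real.exp_le_exp.2 (by linarith)

lemma lintegral_exp_sq_div_four_stdGaussian :
    ∫⁻ g, ENNReal.ofReal (exp (g ^ 2 / 4)) ∂stdGaussian ℝ ≤ 2 := by
  rw [lintegral_stdGaussian (by fun_prop)]
  have e (g : ℝ) : ENNReal.ofReal (gaussDensity ℝ g) * ENNReal.ofReal (exp (g ^ 2 / 4))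
      = ENNReal.ofReal ((2 * π) ^ (-(1 : ℝ) / 2) * exp (-(1 / 4) * g ^ 2)) := by
    rw [← ENNReal.ofReal_mul (by unfold gaussDensity; positivity)]
    unfold gaussDensity
    rw [mul_assoc, ← Real.exp_add, Module.finrank_self, Real.norm_eq_abs, sq_abs]
    norm_num
    ring_nf
  simp_rw [e]
  rw [← ofReal_integral_eq_lintegral_ofReal
    ((integrable_exp_neg_mul_sq (by norm_num)).const_mul _) (ae_of_all _ fun g => by positivity),
    integral_const_mul, integral_gaussian]
  refine ENNReal.ofReal_le_of_le_toReal ?_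
  have h1 : (2 * π) ^ (-(1 : ℝ) / 2) = (√(2 * π))⁻¹ := by
    rw [Real.sqrt_eq_rpow, ← Real.rpow_neg (by positivity)]; norm_num
  rw [h1, inv_mul_le_iff₀ (by positivity), ENNReal.toReal_ofNat]
  rw [← Real.sqrt_sq (show (0 : ℝ) ≤ 2 by norm_num), ← Real.sqrt_mul (by positivity)]
  refine Real.sqrt_le_sqrt ?_
  rw [Real.sqrt_sq (by norm_num)]
  nlinarith [Real.pi_pos]

variable {E : Type*} [NormedAddCommGroup E] [InnerProductSpace ℝ E] [FiniteDimensional ℝ E]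
  [MeasurableSpace E] [BorelSpace E]

lemma subgaussianVec_of_laplace {S : Ω → E} (hS : Measurable S) {B : ℝ} (hB : 0 < B)
    (hi : ∀ y : E, Integrable (fun w => exp ⟪S w, y⟫) μ)
    (h : ∀ y : E, ∫ w, exp ⟪S w, y⟫ ∂μ ≤ exp (B ^ 2 * ‖y‖ ^ 2)) :
    SubgaussianVec μ (fun w => (√8 * B)⁻¹ • S w) := by
  intro y ρ hρ hy
  set a : ℝ := 1 / (2 * B * ρ) with ha
  have ha0 : 0 < a := by positivity
  have e (w : Ω) : ENNReal.ofReal (exp (⟪(√8 * B)⁻¹ • S w, y⟫ ^ 2 / ρ ^ 2))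
      = ∫⁻ g, ENNReal.ofReal (exp (g * ⟪S w, a • y⟫)) ∂stdGaussian ℝ := by
    have h3 := integral_exp_inner_stdGaussian (E := ℝ) ⟪S w, a • y⟫
    have h4 := integrable_exp_inner_stdGaussian (E := ℝ) ⟪S w, a • y⟫
    have h5 (g : ℝ) : ⟪g, ⟪S w, a • y⟫⟫ = g * ⟪S w, a • y⟫ := by
      simp [mul_comm]
    simp_rw [h5] at h3 h4
    rw [← ofReal_integral_eq_lintegral_ofReal h4 (ae_of_all _ fun g => (exp_pos _).le), h3]
    congr 2
    rw [real_inner_smul_left, real_inner_smul_right, Real.norm_eq_abs, sq_abs, ha, mul_pow, inv_pow,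
      mul_pow, Real.sq_sqrt (by norm_num)]
    field_simp
    ring
  simp_rw [e]
  rw [lintegral_lintegral_swap (by fun_prop)]
  refine le_trans (lintegral_mono fun g => ?_) lintegral_exp_sq_div_four_stdGaussian
  have h6 (w : Ω) : g * ⟪S w, a • y⟫ = ⟪S w, (g * a) • y⟫ := by
    simp only [real_inner_smul_right]; ring
  simp_rw [h6]
  rw [← ofReal_integral_eq_lintegral_ofReal (hi _) (ae_of_all _ fun g => (exp_pos _).le)]
  refine ENNReal.ofReal_le_ofReal ((h _).trans (Real.exp_le_exp.2 ?_))
  rw [norm_smul, Real.norm_eq_abs, mul_pow, sq_abs]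
  calc B ^ 2 * ((g * a) ^ 2 * ‖y‖ ^ 2) ≤ B ^ 2 * ((g * a) ^ 2 * ρ ^ 2) := by gcongr
    _ = g ^ 2 / 4 := by rw [ha]; field_simp; norm_num

end Laplace

section IsotropicSum

set_option linter.unusedSectionVars false

variable {E : Type*} [NormedAddCommGroup E] [InnerProductSpace ℝ E] [FiniteDimensional ℝ E]
  [MeasurableSpace E] [BorelSpace E]

variable {C : Set E} {L ϱ : ℝ} (hCk : IsCompact C) (h1 : volume C = 1) (hL : 0 < L) (hϱ : 0 < ϱ)
  (hiso : ∀ ξ : E, ‖ξ‖ = 1 → ∫ x in C, ⟪x, ξ⟫ ^ 2 = L ^ 2)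
  (hψ : ∀ ξ : E, ‖ξ‖ = 1 →
    sInf {r : ℝ | 0 < r ∧ (∫ x in C, Real.exp ((|⟪x, ξ⟫| / r) ^ 2)) ≤ 2}
      ≤ ϱ * Real.sqrt (∫ x in C, ⟪x, ξ⟫ ^ 2))
  (hbar : ∫ x in C, x = 0)

include hCk h1 hL hϱ hiso hψ hbar

lemma integral_exp_inner_le_of_psiTwo (y : E) :
    ∫ x in C, exp ⟪x, y⟫ ≤ exp ((2 * ϱ * L) ^ 2 * ‖y‖ ^ 2) := by
  have : IsProbabilityMeasure (volume.restrict C) := ⟨by simp [h1]⟩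
  rcases eq_or_ne y 0 with rfl | hy
  · simp [Measure.real]
  have hy0 : 0 < ‖y‖ := norm_pos_iff.2 hy
  have hξ : ‖‖y‖⁻¹ • y‖ = 1 := by rw [norm_smul, norm_inv, norm_norm, inv_mul_cancel₀ hy0.ne']
  have h2 := integral_exp_sq_le_two_of_psiTwo hCk h1 hL hϱ hiso hψ hξ
  have e (x : E) : ⟪x, ‖y‖⁻¹ • y⟫ ^ 2 / (2 * ϱ * L) ^ 2 = ⟪x, y⟫ ^ 2 / (2 * ϱ * L * ‖y‖) ^ 2 := by
    rw [real_inner_smul_right]; field_simp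
  simp_rw [e] at h2
  rw [← mul_pow]
  refine integral_exp_le_exp_sq (Y := fun x : E => ⟪x, y⟫) (by positivity)
    (integrableOn_of_continuous hCk (by fun_prop)) ?_
    (integrableOn_of_continuous hCk (by fun_prop))
    (integrableOn_of_continuous hCk (by fun_prop)) h2
  have h3 := integral_inner (𝕜 := ℝ) (integrableOn_of_continuous hCk (f := fun x : E => x) (by fun_prop)) y
  rw [hbar, inner_zero_right] at h3
  rw [← h3]
  exact integral_congr_ae (ae_of_all _ fun x => real_inner_comm _ _)

lemma laplace_sum_of_psiTwo {s : ℕ} (t : Fin s → ℝ) (y : E) :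
    Integrable (fun x : Fin s → E => exp ⟪∑ j, t j • x j, y⟫)
      (Measure.pi fun _ => volume.restrict C) ∧
    ∫ x : Fin s → E, exp ⟪∑ j, t j • x j, y⟫ ∂(Measure.pi fun _ => volume.restrict C)
      ≤ exp ((2 * ϱ * L * √(∑ j, t j ^ 2)) ^ 2 * ‖y‖ ^ 2) := by
  have : IsProbabilityMeasure (volume.restrict C) := ⟨by simp [h1]⟩
  have e (x : Fin s → E) : exp ⟪∑ j, t j • x j, y⟫ = ∏ j, exp ⟪x j, t j • y⟫ := by
    rw [sum_inner, Real.exp_sum]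
    simp only [real_inner_smul_left, real_inner_smul_right]
  simp_rw [e]
  refine ⟨Integrable.fintype_prod (f := fun j x => exp ⟪x, t j • y⟫)
    fun j => integrableOn_of_continuous hCk (by fun_prop), ?_⟩
  rw [integral_fintype_prod_eq_prod (fun j x => exp ⟪x, t j • y⟫)]
  calc ∏ j, ∫ x in C, exp ⟪x, t j • y⟫
      ≤ ∏ j, exp ((2 * ϱ * L) ^ 2 * ‖t j • y‖ ^ 2) :=
        Finset.prod_le_prod (fun j _ => integral_nonneg fun x => (exp_pos _).le)
          fun j _ => integral_exp_inner_le_of_psiTwo hCk h1 hL hϱ hiso hψ hbar _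
    _ = exp ((2 * ϱ * L * √(∑ j, t j ^ 2)) ^ 2 * ‖y‖ ^ 2) := by
        rw [← Real.exp_sum, mul_pow _ (√_),
          Real.sq_sqrt (Finset.sum_nonneg fun j _ => sq_nonneg _), Finset.mul_sum, Finset.sum_mul]
        congr 1
        refine Finset.sum_congr rfl fun j _ => ?_
        rw [norm_smul, Real.norm_eq_abs, mul_pow |t j|, sq_abs]
        ring

end IsotropicSum

section SeminormComparison

variable {E : Type*} [NormedAddCommGroup E] [InnerProductSpace ℝ E] [FiniteDimensional ℝ E]

lemma Seminorm.exists_inner_eq_and_le (p : Seminorm ℝ E) (x₀ : E) :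
    ∃ t : E, ⟪x₀, t⟫ = p x₀ ∧ ∀ x, ⟪x, t⟫ ≤ p x := by
  have key : ∃ g : E →ₗ[ℝ] ℝ, g x₀ = p x₀ ∧ ∀ x, g x ≤ p x := by
    rcases eq_or_ne x₀ 0 with rfl | hx
    · exact ⟨0, by simp, fun x => by simp⟩
    obtain ⟨g, hg, hle⟩ := exists_extension_of_le_sublinear
      (LinearPMap.mkSpanSingleton x₀ (p x₀) hx) p
      (fun c hc x => by rw [map_smul_eq_mul, Real.norm_of_nonneg hc.le])
      (fun x y => map_add_le_add p x y) (by
        rintro ⟨x, hxm⟩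
        obtain ⟨c, rfl⟩ := Submodule.mem_span_singleton.1 hxm
        refine (LinearPMap.mkSpanSingleton'_apply _ _ _ _ _).trans_le ?_
        rw [map_smul_eq_mul]
        exact mul_le_mul_of_nonneg_right (le_abs_self c) (apply_nonneg p _))
    refine ⟨g, ?_, hle⟩
    exact (hg ⟨x₀, Submodule.mem_span_singleton_self x₀⟩).trans
      (LinearPMap.mkSpanSingleton_apply ℝ ℝ hx (p x₀))
  obtain ⟨g, hg, hle⟩ := key
  have e (x : E) : ⟪x, (InnerProductSpace.toDual ℝ E).symm (LinearMap.toContinuousLinearMap g)⟫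
      = g x := by
    rw [real_inner_comm, InnerProductSpace.toDual_symm_apply]
    rfl
  exact ⟨_, (e x₀).trans hg, fun x => (e x).trans_le (hle x)⟩

variable [MeasurableSpace E] [BorelSpace E]

lemma Seminorm.integrable_stdGaussian (p : Seminorm ℝ E) (hp : Continuous p) :
    Integrable p (stdGaussian E) := by
  obtain ⟨c, hc, hle⟩ := p.bound_of_continuous_normedSpace hp
  refine (integrable_norm_stdGaussian.const_mul c).mono' hp.aestronglyMeasurable
    (ae_of_all _ fun x => ?_)
  rw [Real.norm_of_nonneg (apply_nonneg p x)]
  exact hle x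

lemma lintegral_seminorm_le_of_subgaussian {Ω : Type*} [MeasurableSpace Ω] {μ : Measure Ω}
    [IsProbabilityMeasure μ] {X : Ω → E} (hXm : Measurable X) (hX : SubgaussianVec μ X)
    (p : Seminorm ℝ E) (hp : Continuous p) :
    ∫⁻ w, ENNReal.ofReal (p (X w)) ∂μ
      ≤ ENNReal.ofReal (2200 * ∫ x, p x ∂stdGaussian E) := by
  classical
  choose τ hτ hτle using p.exists_inner_eq_and_le
  set u : ℕ → E := TopologicalSpace.denseSeq E with hu
  set A : ℕ → Finset E := fun N => insert 0 ((Finset.range N).image fun i => τ (u i)) with hA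
  have h0 (N : ℕ) : (0 : E) ∈ A N := Finset.mem_insert_self _ _
  have hle (N : ℕ) (x : E) : supp (A N) ⟨0, h0 N⟩ id x ≤ p x := by
    refine Finset.sup'_le _ _ fun y hy => ?_
    rcases Finset.mem_insert.1 hy with rfl | hy
    · simp
    · obtain ⟨i, -, rfl⟩ := Finset.mem_image.1 hy
      exact hτle _ _
  have hmono (x : E) : Monotone fun N => supp (A N) ⟨0, h0 N⟩ id x := by
    intro M N hMN
    refine Finset.sup'_mono _ (Finset.insert_subset_insert _ (Finset.image_subset_image ?_)) _
    exact Finset.range_mono hMN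
  have hmem (i : ℕ) : τ (u i) ∈ A (i + 1) :=
    Finset.mem_insert_of_mem (Finset.mem_image_of_mem _ (Finset.self_mem_range_succ i))
  have happrox (x : E) : ENNReal.ofReal (p x)
      ≤ ⨆ N, ENNReal.ofReal (supp (A N) ⟨0, h0 N⟩ id x) := by
    refine ENNReal.le_of_forall_pos_le_add fun ε hε _ => ?_
    have hε' : (0 : ℝ) < ε / 2 := by positivity
    have hopen : IsOpen {z | p (x - z) < ε / 2} := isOpen_lt (by fun_prop) continuous_const
    obtain ⟨i, hi⟩ := (TopologicalSpace.denseRange_denseSeq E).exists_mem_open hopen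
      ⟨x, by simpa using hε'⟩
    have hi' : p (x - u i) < ε / 2 := hi
    have h1 : p x ≤ supp (A (i + 1)) ⟨0, h0 _⟩ id x + ε := by
      have h2 : ⟪x, τ (u i)⟫ ≤ supp (A (i + 1)) ⟨0, h0 _⟩ id x :=
        Finset.le_sup' (fun t : E => ⟪x, id t⟫) (hmem i)
      have h3 : ⟪u i - x, τ (u i)⟫ ≤ p (u i - x) := hτle _ _
      rw [inner_sub_left, hτ, map_sub_rev] at h3
      have h4 : p x ≤ p (u i) + p (x - u i) := by
        simpa using map_add_le_add p (u i) (x - u i)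
      linarith
    calc ENNReal.ofReal (p x) ≤ ENNReal.ofReal (supp (A (i + 1)) ⟨0, h0 _⟩ id x + ε) :=
          ENNReal.ofReal_le_ofReal h1
      _ ≤ ENNReal.ofReal (supp (A (i + 1)) ⟨0, h0 _⟩ id x) + ENNReal.ofReal ε :=
          ENNReal.ofReal_add_le
      _ ≤ _ := by
          rw [ENNReal.ofReal_coe_nnreal]
          gcongr
          exact le_iSup (fun N => ENNReal.ofReal (supp (A N) ⟨0, h0 N⟩ id x)) (i + 1)
  have hcont (N : ℕ) : Continuous fun x : E => supp (A N) ⟨0, h0 N⟩ id x := by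
    unfold supp
    exact Continuous.finset_sup'_apply _ fun i _ => by fun_prop
  calc ∫⁻ w, ENNReal.ofReal (p (X w)) ∂μ
      ≤ ∫⁻ w, ⨆ N, ENNReal.ofReal (supp (A N) ⟨0, h0 N⟩ id (X w)) ∂μ :=
        lintegral_mono fun w => happrox (X w)
    _ = ⨆ N, ∫⁻ w, ENNReal.ofReal (supp (A N) ⟨0, h0 N⟩ id (X w)) ∂μ :=
        lintegral_iSup (fun N => ((hcont N).measurable.comp hXm).ennreal_ofReal)
          fun M N hMN w => ENNReal.ofReal_le_ofReal (hmono (X w) hMN)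
    _ ≤ ENNReal.ofReal (2200 * ∫ x, p x ∂stdGaussian E) := by
        refine iSup_le fun N => (lintegral_supp_le_gw hXm hX (h0 N)).trans ?_
        refine ENNReal.ofReal_le_ofReal (mul_le_mul_of_nonneg_left ?_ (by norm_num))
        rw [gw_eq ⟨0, h0 N⟩]
        exact integral_mono (integrable_supp _) (p.integrable_stdGaussian hp) (hle N)

end SeminormComparison

section PolarCoordinates

variable {E : Type*} [NormedAddCommGroup E] [InnerProductSpace ℝ E] [FiniteDimensional ℝ E]
  [MeasurableSpace E] [BorelSpace E]

lemma integral_stdGaussian_eq_toSphere_mul [Nontrivial E] (p : Seminorm ℝ E) :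
    ∫ x, p x ∂stdGaussian E = (∫ ξ, p (ξ : E) ∂(volume : Measure E).toSphere) *
      ∫ r : Set.Ioi (0 : ℝ), (2 * π) ^ (-(Module.finrank ℝ E : ℝ) / 2) *
        exp (-((r : ℝ) ^ 2 / 2)) * r ∂(Measure.volumeIoiPow (Module.finrank ℝ E - 1)) := by
  set D : ℝ → ℝ := fun r => (2 * π) ^ (-(Module.finrank ℝ E : ℝ) / 2) * exp (-(r ^ 2 / 2)) with hD
  calc ∫ x, p x ∂stdGaussian E = ∫ x, D ‖x‖ * p x := integral_stdGaussian _
    _ = ∫ x : ({(0)}ᶜ : Set E), D ‖(x : E)‖ * p x ∂((volume : Measure E).comap (↑)) := by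
        rw [integral_subtype_comap (measurableSet_singleton _).compl fun x : E => D ‖x‖ * p x,
          restrict_compl_singleton]
    _ = ∫ z : Metric.sphere (0 : E) 1 × Set.Ioi (0 : ℝ), p (z.1 : E) * (D z.2 * z.2)
          ∂((volume : Measure E).toSphere.prod
            (Measure.volumeIoiPow (Module.finrank ℝ E - 1))) := by
        rw [← (volume : Measure E).measurePreserving_homeomorphUnitSphereProd.integral_comp
          (Homeomorph.measurableEmbedding _)]
        refine integral_congr_ae (ae_of_all _ fun x => ?_)
        have hx : 0 < ‖(x : E)‖ := norm_pos_iff.2 x.2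
        simp only [homeomorphUnitSphereProd_apply_fst_coe, homeomorphUnitSphereProd_apply_snd_coe]
        rw [map_smul_eq_mul, norm_inv, norm_norm]
        field_simp
    _ = _ := integral_prod_mul (fun ξ : Metric.sphere (0 : E) 1 => p (ξ : E))
        (fun r : Set.Ioi (0 : ℝ) => D r * r)

lemma integral_norm_stdGaussian_le [Nontrivial E] : ∫ x, ‖x‖ ∂stdGaussian E ≤ √(Module.finrank ℝ E) := by
  refine Real.le_sqrt_of_sq_le ?_
  have h2 := integral_norm_sq_stdGaussian (H := E)
  have hi : Integrable (fun x : E => ‖x‖ ^ 2) (stdGaussian E) := by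
    by_contra hni
    rw [integral_undef hni] at h2
    exact (Module.finrank_pos (R := ℝ) (M := E)).ne (by exact_mod_cast h2)
  have h1 := integrable_norm_stdGaussian (E := E)
  set m := ∫ x, ‖x‖ ∂stdGaussian E with hm
  have h3 : 0 ≤ ∫ x, (‖x‖ - m) ^ 2 ∂stdGaussian E := integral_nonneg fun x => sq_nonneg _
  have e (x : E) : (‖x‖ - m) ^ 2 = ‖x‖ ^ 2 - (2 * m * ‖x‖ - m ^ 2) := by ring
  simp_rw [e] at h3
  have hl : Integrable (fun x : E => 2 * m * ‖x‖ - m ^ 2) (stdGaussian E) :=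
    (h1.const_mul _).sub (integrable_const _)
  rw [integral_sub hi hl, h2, integral_sub (f := fun x : E => 2 * m * ‖x‖)
    (g := fun _ => m ^ 2) (h1.const_mul _) (integrable_const _), integral_const_mul, ← hm] at h3
  simp only [integral_const, probReal_univ, one_smul] at h3
  linarith

lemma integral_seminorm_stdGaussian_le [Nontrivial E] (p : Seminorm ℝ E) :
    ∫ x, p x ∂stdGaussian E
      ≤ √(Module.finrank ℝ E) * ⨍ ξ, p (ξ : E) ∂(volume : Measure E).toSphere := by
  have h1 := integral_stdGaussian_eq_toSphere_mul p
  have h2 := integral_stdGaussian_eq_toSphere_mul (normSeminorm ℝ E)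
  have hpos : 0 < (volume : Measure E).toSphere.real Set.univ := by
    rw [measureReal_def]
    exact ENNReal.toReal_pos (by
      rw [Ne, Measure.measure_univ_eq_zero]; exact Measure.toSphere_ne_zero _) (measure_ne_top _ _)
  have e : ∫ ξ, normSeminorm ℝ E (ξ : E) ∂(volume : Measure E).toSphere
      = (volume : Measure E).toSphere.real Set.univ := by
    have h3 (ξ : Metric.sphere (0 : E) 1) : normSeminorm ℝ E (ξ : E) = 1 := by simp
    simp_rw [h3]
    simp
  rw [e] at h2
  have h4 : ∫ x, normSeminorm ℝ E x ∂stdGaussian E ≤ √(Module.finrank ℝ E) :=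
    integral_norm_stdGaussian_le
  have h5 : 0 ≤ ∫ ξ, p (ξ : E) ∂(volume : Measure E).toSphere :=
    integral_nonneg fun ξ => apply_nonneg p _
  rw [average_eq, smul_eq_mul, h1]
  rw [h2] at h4
  set m := (volume : Measure E).toSphere.real Set.univ
  set I := ∫ r : Set.Ioi (0 : ℝ), (2 * π) ^ (-(Module.finrank ℝ E : ℝ) / 2) *
        exp (-((r : ℝ) ^ 2 / 2)) * r ∂(Measure.volumeIoiPow (Module.finrank ℝ E - 1))
  set P := ∫ ξ, p (ξ : E) ∂(volume : Measure E).toSphere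
  calc P * I = m * I * (m⁻¹ * P) := by field_simp
    _ ≤ _ := mul_le_mul_of_nonneg_right h4 (by positivity)

end PolarCoordinates

section SeminormSum

variable {E : Type*} [NormedAddCommGroup E] [InnerProductSpace ℝ E] [FiniteDimensional ℝ E]
  [MeasurableSpace E] [BorelSpace E] [Nontrivial E]

lemma integral_seminorm_le_of_laplace {Ω : Type*} [MeasurableSpace Ω] {P : Measure Ω}
    [IsProbabilityMeasure P] {S : Ω → E} (hS : Measurable S) {B : ℝ} (hB : 0 < B)
    (hi : ∀ y : E, Integrable (fun w => exp ⟪S w, y⟫) P)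
    (h : ∀ y : E, ∫ w, exp ⟪S w, y⟫ ∂P ≤ exp (B ^ 2 * ‖y‖ ^ 2))
    (p : Seminorm ℝ E) (hp : Continuous p) :
    ∫ w, p (S w) ∂P ≤ √8 * B * (2200 * (√(Module.finrank ℝ E) *
      ⨍ ξ, p (ξ : E) ∂(volume : Measure E).toSphere)) := by
  have hSm : Measurable fun w => (√8 * B)⁻¹ • S w := by fun_prop
  have hkey := lintegral_seminorm_le_of_subgaussian hSm
    (subgaussianVec_of_laplace hS hB hi h) p hp
  have hG := integral_seminorm_stdGaussian_le p
  have hG0 : 0 ≤ ∫ x, p x ∂stdGaussian E := integral_nonneg fun x => apply_nonneg p _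
  have hX : ∫ w, p ((√8 * B)⁻¹ • S w) ∂P ≤ 2200 * ∫ x, p x ∂stdGaussian E := by
    rw [integral_eq_lintegral_of_nonneg_ae (ae_of_all _ fun w => apply_nonneg p _)
      (hp.measurable.comp hSm).aestronglyMeasurable]
    exact ENNReal.toReal_le_of_le_ofReal (by positivity) hkey
  have hscale : ∫ w, p (S w) ∂P = √8 * B * ∫ w, p ((√8 * B)⁻¹ • S w) ∂P := by
    rw [← integral_const_mul]
    congr 1
    ext w
    rw [map_smul_eq_mul, Real.norm_of_nonneg (by positivity), mul_inv_cancel_left₀ (by positivity)]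
  rw [hscale]
  exact mul_le_mul_of_nonneg_left (hX.trans (mul_le_mul_of_nonneg_left hG (by norm_num)))
    (by positivity)

end SeminormSum

end Auxiliary

section GaugeNorm

variable {n : ℕ} {K : Set (EuclideanSpace ℝ (Fin n))}

lemma IsSymmConvexBody.mem_nhds_zero (hK : IsSymmConvexBody K) :
    K ∈ nhds (0 : EuclideanSpace ℝ (Fin n)) := by
  obtain ⟨hc, -, ⟨x, hx⟩, hs⟩ := hK
  have hx' : -x ∈ interior K := by
    refine interior_maximal (fun z hz => ?_) isOpen_interior.neg (Set.neg_mem_neg.2 hx)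
    rw [hs]
    exact Set.neg_subset_neg.2 interior_subset hz
  rw [mem_interior_iff_mem_nhds.symm]
  have := hc.interior hx hx' (a := 1 / 2) (b := 1 / 2) (by norm_num) (by norm_num) (by norm_num)
  simpa using this

lemma IsSymmConvexBody.exists_seminorm (hK : IsSymmConvexBody K) :
    ∃ p : Seminorm ℝ (EuclideanSpace ℝ (Fin n)), (∀ x, p x = gauge K x) ∧ Continuous p := by
  have h0 := hK.mem_nhds_zero
  have hsymm : ∀ x ∈ K, -x ∈ K := fun x hx => by
    have h := hK.2.2.2
    rw [h] at hx
    exact hx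
  refine ⟨Seminorm.of (gauge K) (gauge_add_le hK.1 (absorbent_nhds_zero h0)) fun a x => ?_,
    fun x => rfl, continuous_gauge hK.1 h0⟩
  rcases le_total 0 a with ha | ha
  · rw [gauge_smul_of_nonneg ha, Real.norm_of_nonneg ha, smul_eq_mul]
  · rw [← neg_neg a, neg_smul, gauge_neg hsymm, gauge_smul_of_nonneg (neg_nonneg.2 ha), norm_neg,
      Real.norm_of_nonneg (neg_nonneg.2 ha), smul_eq_mul]

end GaugeNorm

/-- there is an absolute constant `c > 0` such that for any isotropic
convex body `C` in `ℝⁿ` which is a `ψ₂`-body with constant `ϱ`, any centrally symmetric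
convex body `K`, any `s ≥ 1` and any `t ∈ ℝˢ`,
`∫_C⋯∫_C ‖∑ t_j x_j‖_K ≤ c ϱ² √n M(K) ‖t‖₂`. -/
theorem stmt10 :
    ∃ c : ℝ, 0 < c ∧
      ∀ (n s : ℕ) (_hs : 1 ≤ s)
        (C : Set (EuclideanSpace ℝ (Fin n))) (_hC : IsConvexBody C)
        (L : ℝ) (_hCiso : IsIsotropic C L)
        (ϱ : ℝ) (_hϱ : 0 < ϱ) (_hψ : IsPsiTwoBody C ϱ)
        (K : Set (EuclideanSpace ℝ (Fin n))) (_hK : IsSymmConvexBody K)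
        (t : Fin s → ℝ),
        (∫ x in Set.univ.pi fun _ : Fin s => C, gauge K (∑ j, t j • x j))
          ≤ c * ϱ ^ 2 * Real.sqrt n * sphereM K * euclNorm t := by
  obtain ⟨c₀, hc₀⟩ : ∃ c₀ : ℝ, c₀ = 16 * (75000 * (140000 * 45000000000) * exp 1) ^ 2 := ⟨_, rfl⟩
  have hc₀0 : 0 < c₀ := by rw [hc₀]; positivity
  refine ⟨√8 * 4400 * c₀, by positivity, ?_⟩
  intro n s hs C hC L hiso ϱ hϱ hψ K hK t
  obtain ⟨h1, hbar, hL, hiso⟩ := hiso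
  obtain ⟨p, hp, hpc⟩ := hK.exists_seminorm
  have hCk := hC.2.1
  have : IsProbabilityMeasure (volume.restrict C) := ⟨by simp [h1]⟩
  have hM : sphereM K = ⨍ ξ, p (ξ : EuclideanSpace ℝ (Fin n))
      ∂(volume : Measure (EuclideanSpace ℝ (Fin n))).toSphere := by
    simp_rw [hp]; rfl
  have hM0 : 0 ≤ sphereM K := by
    rw [hM, average_eq]
    exact smul_nonneg (by positivity) (integral_nonneg fun ξ => apply_nonneg p _)
  have hτ0 : 0 ≤ euclNorm t := Real.sqrt_nonneg _
  rw [volume_pi, Measure.restrict_pi_pi]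
  simp_rw [← hp]
  have hrhs : 0 ≤ √8 * 4400 * c₀ * ϱ ^ 2 * √n * sphereM K * euclNorm t := by positivity
  rcases hτ0.eq_or_lt with hτ | hτ
  · have ht (j : Fin s) : t j = 0 := by
      have h := (Real.sqrt_eq_zero (Finset.sum_nonneg fun j _ => sq_nonneg (t j))).1 hτ.symm
      rw [Finset.sum_eq_zero_iff_of_nonneg fun j _ => sq_nonneg (t j)] at h
      exact pow_eq_zero_iff two_ne_zero |>.1 (h j (Finset.mem_univ _))
    simpa [ht] using hrhs
  rcases Nat.eq_zero_or_pos n with rfl | hn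
  · have h0 (x : EuclideanSpace ℝ (Fin 0)) : p x = 0 := by
      rw [Subsingleton.elim x 0, map_zero]
    simp [h0]
  have hfin : Module.finrank ℝ (EuclideanSpace ℝ (Fin n)) = n := finrank_euclideanSpace_fin
  have hnt : Nontrivial (EuclideanSpace ℝ (Fin n)) :=
    Module.finrank_pos_iff (R := ℝ).1 (by omega)
  have hLc : L ≤ c₀ * ϱ := by
    rw [hc₀]
    exact isotropic_constant_le hCk h1 hL hϱ hiso hψ hbar hC.1 (by omega)
  set B := 2 * ϱ * L * euclNorm t with hB
  have hB0 : 0 < B := by positivity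
  have hmain := integral_seminorm_le_of_laplace
    (P := Measure.pi fun _ : Fin s => (volume : Measure (EuclideanSpace ℝ (Fin n))).restrict C)
    (S := fun x : Fin s → EuclideanSpace ℝ (Fin n) => ∑ j, t j • x j) (by fun_prop) hB0
    (fun y => (laplace_sum_of_psiTwo hCk h1 hL hϱ hiso hψ hbar t y).1)
    (fun y => (laplace_sum_of_psiTwo hCk h1 hL hϱ hiso hψ hbar t y).2) p hpc
  rw [← hM, hfin] at hmain
  refine hmain.trans ?_
  calc √8 * B * (2200 * (√n * sphereM K))
      = √8 * 4400 * ϱ * L * √n * sphereM K * euclNorm t := by rw [hB]; ring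
    _ ≤ √8 * 4400 * ϱ * (c₀ * ϱ) * √n * sphereM K * euclNorm t := by gcongr
    _ = √8 * 4400 * c₀ * ϱ ^ 2 * √n * sphereM K * euclNorm t := by ring
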